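/- Let 𝔽 be an algebraically closed field of characteristic zero and let h ∈ R* be a vertex model. Then there exists a nondegenerate vertex model h' ∈ R* with f_h(G) = f_{h'}(G) for all graphs G ∈ 𝒢, such that the image p_{h'}(𝒜) equals the algebra T(V)^{Stab(h')} of all tensors invariant under Stab(h'). -/

import Mathlib

/-!
Formalization framework for "Partition functions of vertex models /
edge connection matrices" (Regts–Draisma style).

Graphs and fragments are finite multigraphs (allowing multiple edges, loops
and circles); a `k`-fragment additionally has `k` labelled open ends.  We
encode a `k`-fragment by a number `nv` of internal vertices, a number `ne`
of edges, and for each edge the multiset of its endpoints, each endpoint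
being either an internal vertex (`Sum.inl`) or an open-end label
(`Sum.inr`).  Every edge has `2` endpoints (counted with multiplicity; a
loop at `v` lists `v` twice) or `0` endpoints (a circle), and every label
occurs exactly once in total (the open ends have degree one).
-/

open MvPolynomial

namespace VertexModels

noncomputable section

/-- A `k`-fragment. For `k = 0` this is a graph. -/
structure Fragment (k : ℕ) : Type where
  nv : ℕ
  ne : ℕ
  inc : Fin ne → Multiset (Fin nv ⊕ Fin k)
  card_inc : ∀ e, Multiset.card (inc e) = 2 ∨ Multiset.card (inc e) = 0
  openEnd : ∀ j : Fin k, (∑ e, (inc e).count (Sum.inr j)) = 1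

/-- A graph: a `0`-fragment. -/
abbrev Graph := Fragment 0

/-- The basic `k`-fragment `F_k`: one internal vertex joined to each of the
`k` open ends by a half edge. -/
def basicFragment (k : ℕ) : Fragment k where
  nv := 1
  ne := k
  inc := fun e => {Sum.inl 0, Sum.inr e}
  card_inc := fun e => Or.inl (by simp)
  openEnd := fun j => by
    have h : ∀ e : Fin k,
        Multiset.count (Sum.inr j) ({Sum.inl 0, Sum.inr e} : Multiset (Fin 1 ⊕ Fin k))
          = if j = e then 1 else 0 := by
      intro e
      by_cases he : j = e <;>
        simp [Multiset.count_cons, Multiset.count_singleton, he]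
    simp only [h]
    simp

variable {𝔽 : Type} [Field 𝔽] {n : ℕ}

/-- A vertex model: a linear functional on `R = 𝔽[x_1, …, x_n]`. -/
abbrev VertexModel (𝔽 : Type) [Field 𝔽] (n : ℕ) : Type :=
  MvPolynomial (Fin n) 𝔽 →ₗ[𝔽] 𝔽

/-- The monomial `∏_{e ∈ δ(v)} x_{ψ(e)}` seen by the internal vertex `v` of a
fragment under the edge colouring `ψ`. -/
def monomialAt {k : ℕ} (F : Fragment k) (ψ : Fin F.ne → Fin n) (v : Fin F.nv) :
    MvPolynomial (Fin n) 𝔽 :=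
  ∏ e, (X (ψ e) : MvPolynomial (Fin n) 𝔽) ^ ((F.inc e).count (Sum.inl v))

/-- The partition function `f_h` of the vertex model `h`. -/
def partitionFun (h : VertexModel 𝔽 n) (G : Graph) : 𝔽 :=
  ∑ ψ : Fin G.ne → Fin n, ∏ v, h (monomialAt G ψ v)

/-- `h_φ(F)`, for a `k`-fragment `F` and a colouring `φ` of the open ends. -/
def hphi (h : VertexModel 𝔽 n) {k : ℕ} (F : Fragment k) (φ : Fin k → Fin n) : 𝔽 :=
  ∑ ψ ∈ Finset.univ.filter
      (fun ψ : Fin F.ne → Fin n => ∀ (e : Fin F.ne) (j : Fin k),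
        Sum.inr j ∈ F.inc e → ψ e = φ j),
    ∏ v, h (monomialAt F ψ v)

/-- `V^{⊗ k}` in coordinates: functions on multi-indices, with basis
`e_φ`. -/
abbrev Tensor (𝔽 : Type) [Field 𝔽] (n k : ℕ) : Type := (Fin k → Fin n) → 𝔽

/-- The tensor `p_h(F) = ∑_φ h_φ(F) e_φ ∈ V^{⊗ k}`. -/
def ph (h : VertexModel 𝔽 n) {k : ℕ} (F : Fragment k) : Tensor 𝔽 n k :=
  fun φ => hphi h F φ

/-- The standard bilinear form on `V^{⊗ k}`. -/
def tpair {k : ℕ} (t s : Tensor 𝔽 n k) : 𝔽 := ∑ φ, t φ * s φ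

/-- Tensor product `V^{⊗ k} × V^{⊗ l} → V^{⊗ (k+l)}`. -/
def tmul {k l : ℕ} (t : Tensor 𝔽 n k) (s : Tensor 𝔽 n l) : Tensor 𝔽 n (k + l) :=
  fun φ => t (fun i => φ (Fin.castAdd l i)) * s (fun i => φ (Fin.natAdd k i))

/-- The contraction `C^k_{i,j} : V^{⊗ k} → V^{⊗ (k-2)}` (here `k = m + 2`),
contracting the `i`-th and `j`-th tensor factors (`i < j`). -/
def tcontract {m : ℕ} (i j : Fin (m + 2)) (t : Tensor 𝔽 n (m + 2)) : Tensor 𝔽 n m :=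
  fun φ => ∑ c : Fin n,
    t (Fin.insertNth i c (Fin.insertNth (⟨j.1 - 1, by have := j.isLt; omega⟩ : Fin (m + 1)) c φ))

/-- The orthogonal group `O_n`, as the set of matrices `g` with `gᵀ g = 1`. -/
def orthSet (𝔽 : Type) [Field 𝔽] (n : ℕ) : Set (Matrix (Fin n) (Fin n) 𝔽) :=
  {g | g.transpose * g = 1}

/-- Substitution `X i ↦ ∑ j, g i j • X j`, i.e. composition of a polynomial
with the linear map `g`, as a linear endomorphism of `R`. -/
noncomputable def polSub (g : Matrix (Fin n) (Fin n) 𝔽) :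
    MvPolynomial (Fin n) 𝔽 →ₗ[𝔽] MvPolynomial (Fin n) 𝔽 :=
  (MvPolynomial.aeval (fun i => ∑ j, MvPolynomial.C (g i j) * X j)).toLinearMap

/-- The action of `g ∈ O_n` on vertex models: `(g h)(p) = h (p ∘ g) = h(g⁻¹ • p)`. -/
noncomputable def dualAct (g : Matrix (Fin n) (Fin n) 𝔽) (h : VertexModel 𝔽 n) :
    VertexModel 𝔽 n :=
  h.comp (polSub g)

/-- The stabilizer `Stab(h) = {g ∈ O_n ∣ g h = h}`. -/
noncomputable def Stab (h : VertexModel 𝔽 n) : Set (Matrix (Fin n) (Fin n) 𝔽) :=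
  {g | g ∈ orthSet 𝔽 n ∧ dualAct g h = h}

/-- The diagonal action of a matrix `g` on `V^{⊗ k}`. -/
def tact (g : Matrix (Fin n) (Fin n) 𝔽) (k : ℕ) :
    Tensor 𝔽 n k →ₗ[𝔽] Tensor 𝔽 n k :=
  Matrix.mulVecLin (Matrix.of fun φ ψ : Fin k → Fin n => ∏ i, g (φ i) (ψ i))

/-- The subspace `(V^{⊗ k})^S` of tensors fixed by every element of a set `S`
of matrices. -/
def invSub (S : Set (Matrix (Fin n) (Fin n) 𝔽)) (k : ℕ) :
    Submodule 𝔽 (Tensor 𝔽 n k) where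
  carrier := {t | ∀ g ∈ S, tact g k t = t}
  add_mem' := fun {a b} ha hb => by
    intro g hg
    rw [map_add, ha g hg, hb g hg]
  zero_mem' := by
    intro g hg
    rw [map_zero]
  smul_mem' := fun c a ha => by
    intro g hg
    rw [map_smul, ha g hg]

/-! ### Gluing two `k`-fragments into a graph -/

/-- `touches F H j a`: the edge `a` of the disjoint union of `F` and `H` is
incident with the open end labelled `j` (of its own fragment). -/
def touches {k : ℕ} (F H : Fragment k) (j : Fin k) : Fin F.ne ⊕ Fin H.ne → Prop
  | .inl e => Sum.inr j ∈ F.inc e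
  | .inr e => Sum.inr j ∈ H.inc e

/-- Edges of `F` and `H` which get merged into a single edge of `F * H` are
identified by the equivalence generated by sharing an open-end label. -/
def glueSetoid {k : ℕ} (F H : Fragment k) : Setoid (Fin F.ne ⊕ Fin H.ne) :=
  Relation.EqvGen.setoid (fun a b => ∃ j, touches F H j a ∧ touches F H j b)

/-- Number of edges of the glued graph `F * H`. -/
noncomputable def glueNE {k : ℕ} (F H : Fragment k) : ℕ :=
  Nat.card (Quotient (glueSetoid F H))

noncomputable def glueEquiv {k : ℕ} (F H : Fragment k) :
    Fin (glueNE F H) ≃ Quotient (glueSetoid F H) :=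
  (Finite.equivFin _).symm

/-- The internal (non-open-end) endpoints of an edge of the disjoint union,
re-indexed in `Fin (F.nv + H.nv)`. -/
def intEnds {k : ℕ} (F H : Fragment k) :
    Fin F.ne ⊕ Fin H.ne → Multiset (Fin (F.nv + H.nv) ⊕ Fin 0)
  | .inl e => (F.inc e).filterMap fun x =>
      match x with
      | .inl v => some (Sum.inl (Fin.castAdd H.nv v))
      | .inr _ => none
  | .inr e => (H.inc e).filterMap fun x =>
      match x with
      | .inl v => some (Sum.inl (Fin.natAdd F.nv v))
      | .inr _ => none

/-- Endpoints of an edge of the glued graph: the internal endpoints of all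
edges merged into it. -/
noncomputable def glueInc {k : ℕ} (F H : Fragment k) (c : Fin (glueNE F H)) :
    Multiset (Fin (F.nv + H.nv) ⊕ Fin 0) := by
  classical
  exact ∑ a ∈ Finset.univ.filter
    (fun a => Quotient.mk (glueSetoid F H) a = glueEquiv F H c), intEnds F H a

/-- The glued graph `F * H` of two `k`-fragments: connect the half edges
with equally labelled open ends into single edges (chains of half edges
closing up produce circles).  (The impossible degenerate branch is never
taken.) -/
noncomputable def glue {k : ℕ} (F H : Fragment k) : Graph := by
  classical
  exact if hc : ∀ c, Multiset.card (glueInc F H c) = 2 ∨ Multiset.card (glueInc F H c) = 0 then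
    { nv := F.nv + H.nv
      ne := glueNE F H
      inc := glueInc F H
      card_inc := hc
      openEnd := fun j => j.elim0 }
  else basicFragment 0

/-- The rank of the edge connection matrix `M_{f_h,k}` : the dimension of the
span of its rows. -/
noncomputable def connectionRank (h : VertexModel 𝔽 n) (k : ℕ) : ℕ :=
  Module.finrank 𝔽 (Submodule.span 𝔽
    (Set.range fun F : Fragment k => fun H : Fragment k => partitionFun h (glue F H)))

/-! ### The algebra `𝒜` of formal linear combinations of fragments -/

/-- `p_h` on formal linear combinations `𝔽ℱ_k` of `k`-fragments. -/
noncomputable def phL (h : VertexModel 𝔽 n) (k : ℕ) :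
    (Fragment k →₀ 𝔽) →ₗ[𝔽] Tensor 𝔽 n k :=
  Finsupp.linearCombination 𝔽 (fun F : Fragment k => ph h F)

/-- `γ ↦ (F ↦ f_h(γ * F))`: the bilinear extension of gluing followed by the
partition function.  Its kernel is `I_k`. -/
noncomputable def glueRow (h : VertexModel 𝔽 n) (k : ℕ) :
    (Fragment k →₀ 𝔽) →ₗ[𝔽] (Fragment k → 𝔽) :=
  Finsupp.linearCombination 𝔽
    (fun F : Fragment k => fun H : Fragment k => partitionFun h (glue F H))

/-- A vertex model is nondegenerate if `ker p_h = I`. -/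
def Nondeg (h : VertexModel 𝔽 n) : Prop :=
  ∀ (k : ℕ) (γ : Fragment k →₀ 𝔽), phL h k γ = 0 ↔ glueRow h k γ = 0

/-! ### The product of fragments and the contraction of fragments -/

/-- Endpoint multisets of the disjoint union `F H` of fragments (`H`'s open
ends relabelled by `i ↦ k + i`). -/
def mulInc {k l : ℕ} (F : Fragment k) (H : Fragment l) :
    Fin (F.ne + H.ne) → Multiset (Fin (F.nv + H.nv) ⊕ Fin (k + l)) :=
  Fin.addCases
    (fun e => (F.inc e).map (Sum.map (Fin.castAdd H.nv) (Fin.castAdd l)))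
    (fun e => (H.inc e).map (Sum.map (Fin.natAdd F.nv) (Fin.natAdd k)))

/-- The product `F H` in the fragment algebra `𝒜`: disjoint union, with the
open ends of `H` relabelled `i ↦ k + i`.  (The impossible degenerate branch
is never taken.) -/
noncomputable def fragMul {k l : ℕ} (F : Fragment k) (H : Fragment l) :
    Fragment (k + l) := by
  classical
  exact if hc : (∀ e, Multiset.card (mulInc F H e) = 2 ∨ Multiset.card (mulInc F H e) = 0)
      ∧ (∀ j : Fin (k + l), (∑ e, (mulInc F H e).count (Sum.inr j)) = 1) then
    { nv := F.nv + H.nv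
      ne := F.ne + H.ne
      inc := mulInc F H
      card_inc := hc.1
      openEnd := hc.2 }
  else basicFragment (k + l)

/-- Relabelling map for labels after removing labels `i` and `j` (`i < j`),
preserving the order of the remaining labels. -/
def downLabel {m : ℕ} (i j l : Fin (m + 2)) (hij : i < j) (h : ¬(l = i ∨ l = j)) : Fin m :=
  ⟨l.1 - (if i.1 < l.1 then 1 else 0) - (if j.1 < l.1 then 1 else 0), by
    push_neg at h
    have h1 : l.1 ≠ i.1 := fun hh => h.1 (Fin.ext hh)
    have h2 : l.1 ≠ j.1 := fun hh => h.2 (Fin.ext hh)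
    have h3 : i.1 < j.1 := hij
    have h4 := l.isLt
    have h6 := j.isLt
    split_ifs <;> omega⟩

/-- Removing the open ends `i` and `j` from an endpoint multiset and
relabelling the remaining open ends. -/
def removeEnd {m nv : ℕ} (i j : Fin (m + 2)) (hij : i < j) :
    Fin nv ⊕ Fin (m + 2) → Option (Fin nv ⊕ Fin m)
  | .inl v => some (.inl v)
  | .inr l => if h : l = i ∨ l = j then none else some (.inr (downLabel i j l hij h))

/-- Edges merged by the contraction `Γ^k_{i,j}`: those incident with the open
end `i` or the open end `j`. -/
def contractSetoid {m : ℕ} (F : Fragment (m + 2)) (i j : Fin (m + 2)) :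
    Setoid (Fin F.ne) :=
  Relation.EqvGen.setoid (fun e e' =>
    (Sum.inr i ∈ F.inc e ∨ Sum.inr j ∈ F.inc e) ∧
    (Sum.inr i ∈ F.inc e' ∨ Sum.inr j ∈ F.inc e'))

noncomputable def contractNE {m : ℕ} (F : Fragment (m + 2)) (i j : Fin (m + 2)) : ℕ :=
  Nat.card (Quotient (contractSetoid F i j))

noncomputable def contractEquiv {m : ℕ} (F : Fragment (m + 2)) (i j : Fin (m + 2)) :
    Fin (contractNE F i j) ≃ Quotient (contractSetoid F i j) :=
  (Finite.equivFin _).symm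

noncomputable def contractInc {m : ℕ} (F : Fragment (m + 2)) (i j : Fin (m + 2))
    (hij : i < j) (c : Fin (contractNE F i j)) : Multiset (Fin F.nv ⊕ Fin m) := by
  classical
  exact ∑ e ∈ Finset.univ.filter
    (fun e => Quotient.mk (contractSetoid F i j) e = contractEquiv F i j c),
    (F.inc e).filterMap (removeEnd i j hij)

/-- The contraction `Γ^k_{i,j}(F)` of a `(m+2)`-fragment: join the half edges
at the open ends labelled `i` and `j` into a single edge (possibly a circle)
and relabel the remaining open ends preserving their order.  (The impossible
degenerate branch is never taken.) -/
noncomputable def fragContract {m : ℕ} (i j : Fin (m + 2)) (hij : i < j)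
    (F : Fragment (m + 2)) : Fragment m := by
  classical
  exact if hc : (∀ c, Multiset.card (contractInc F i j hij c) = 2 ∨
        Multiset.card (contractInc F i j hij c) = 0)
      ∧ (∀ jj : Fin m, (∑ c, (contractInc F i j hij c).count (Sum.inr jj)) = 1) then
    { nv := F.nv
      ne := contractNE F i j
      inc := contractInc F i j hij
      card_inc := hc.1
      openEnd := hc.2 }
  else basicFragment m

/-! ### Zariski closedness, spin models, reductivity -/

/-- A subset of a coordinate space `ι → 𝔽` is Zariski closed if it is the
common zero locus of a set of polynomials. -/
def IsZarClosed {ι : Type} (S : Set (ι → 𝔽)) : Prop :=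
  ∃ P : Set (MvPolynomial ι 𝔽), S = {x | ∀ p ∈ P, MvPolynomial.eval x p = 0}

/-- The vertex model `h(p) = ∑ i, a i • p (u i)` attached to points
`u_1, …, u_m` and coefficients `a_1, …, a_m`. -/
noncomputable def spinModel {m : ℕ} (u : Fin m → (Fin n → 𝔽)) (a : Fin m → 𝔽) :
    VertexModel 𝔽 n :=
  ∑ i, a i • (MvPolynomial.aeval (u i) : MvPolynomial (Fin n) 𝔽 →ₐ[𝔽] 𝔽).toLinearMap

/-- Multi-degrees of total degree at most `e`: coordinates for the space
`(R_{≤ e})^*`. -/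
def LowDeg (n e : ℕ) : Type := {d : Fin n →₀ ℕ // (d.sum fun _ c => c) ≤ e}

/-- The `O_n`-orbit of `h_e` (the restriction of `h` to polynomials of degree
at most `e`), in coordinates. -/
noncomputable def restOrbit (h : VertexModel 𝔽 n) (e : ℕ) : Set (LowDeg n e → 𝔽) :=
  {y | ∃ g ∈ orthSet 𝔽 n, ∀ d : LowDeg n e,
    y d = dualAct g h (MvPolynomial.monomial d.1 (1 : 𝔽))}

/-- The `O_n`-orbit of an `m`-tuple of vectors, in coordinates. -/
def vecOrbit {m : ℕ} (u : Fin m → (Fin n → 𝔽)) : Set (Fin m × Fin n → 𝔽) :=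
  {y | ∃ g ∈ orthSet 𝔽 n, ∀ p : Fin m × Fin n, y p = g.mulVec (u p.1) p.2}

/-- The `O_n`-orbit of an element `w` of `⊕_{k ≤ e} V^{⊗ k}`, in
coordinates. -/
def tensorTupleOrbit (e : ℕ) (w : ∀ k : ℕ, Tensor 𝔽 n k) :
    Set ((Σ p : Fin (e + 1), (Fin p.1 → Fin n)) → 𝔽) :=
  {y | ∃ g ∈ orthSet 𝔽 n, ∀ q : Σ p : Fin (e + 1), (Fin p.1 → Fin n),
    y q = tact g q.1 (w q.1) q.2}

/-- Linear reductivity of a set `H` of `n × n` matrices: in every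
polynomial representation of `H`, every `H`-invariant subspace admits an
`H`-invariant complement. -/
def IsLinRed (H : Set (Matrix (Fin n) (Fin n) 𝔽)) : Prop :=
  ∀ (m : ℕ) (ρ : Matrix (Fin n) (Fin n) 𝔽 → Matrix (Fin m) (Fin m) 𝔽),
    (∀ a b : Fin m, ∃ p : MvPolynomial (Fin n × Fin n) 𝔽,
      ∀ g, ρ g a b = MvPolynomial.eval (fun q => g q.1 q.2) p) →
    (∀ g ∈ H, ∀ g' ∈ H, ρ (g * g') = ρ g * ρ g') → ρ 1 = 1 →
    ∀ W : Submodule 𝔽 (Fin m → 𝔽),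
      (∀ g ∈ H, ∀ w ∈ W, (ρ g).mulVec w ∈ W) →
      ∃ W' : Submodule 𝔽 (Fin m → 𝔽), IsCompl W W' ∧
        (∀ g ∈ H, ∀ w ∈ W', (ρ g).mulVec w ∈ W')

/-- The pointwise stabilizer in `O_n` of a graded family of subspaces of the
tensor algebra. -/
def setStab (A : ∀ k : ℕ, Submodule 𝔽 (Tensor 𝔽 n k)) :
    Set (Matrix (Fin n) (Fin n) 𝔽) :=
  {g | g ∈ orthSet 𝔽 n ∧ ∀ (k : ℕ), ∀ a ∈ A k, tact g k a = a}

/-- The sum of the nontrivial `H`-isotypic components of `V^{⊗ k}`: the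
largest `H`-stable subspace meeting the invariants trivially. -/
def nontrivialPart (H : Set (Matrix (Fin n) (Fin n) 𝔽)) (k : ℕ) :
    Submodule 𝔽 (Tensor 𝔽 n k) :=
  sSup {W | (∀ g ∈ H, ∀ w ∈ W, tact g k w ∈ W) ∧ W ⊓ invSub H k = ⊥}

end

end VertexModels

namespace VertexModels

noncomputable section

/-! ### A counting lemma for gluing edges -/

/-- A finite type connected by a family of links indexed by `κ` has at most `|κ| + 1` elements. -/
theorem card_le_of_eqvGen {X κ : Type} [Finite X] [Finite κ] (s t : κ → X)
    (hconn : ∀ x y, Relation.EqvGen (fun a b => ∃ k, s k = a ∧ t k = b) x y) :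
    Nat.card X ≤ Nat.card κ + 1 := by
  classical
  rcases isEmpty_or_nonempty X with hX | hX
  · simp
  let G : SimpleGraph X := SimpleGraph.fromRel (fun a b => ∃ k, s k = a ∧ t k = b)
  have hG : G.Connected := by
    refine ⟨fun x y => ?_⟩
    induction hconn x y with
    | rel x y h =>
      by_cases hxy : x = y
      · subst hxy; exact SimpleGraph.Reachable.refl _
      · exact SimpleGraph.Adj.reachable (by
          rw [SimpleGraph.fromRel_adj]; exact ⟨hxy, Or.inl h⟩)
    | refl x => exact SimpleGraph.Reachable.refl _
    | symm x y _ ih => exact ih.symm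
    | trans x y z _ _ ih1 ih2 => exact ih1.trans ih2
  have h1 := hG.card_vert_le_card_edgeSet_add_one
  have h2 : Nat.card G.edgeSet ≤ Nat.card κ := by
    have hsub : G.edgeSet ⊆ Set.range fun k => s(s k, t k) := by
      intro e
      induction e with
      | h a b =>
        intro hab
        rw [SimpleGraph.mem_edgeSet, SimpleGraph.fromRel_adj] at hab
        rcases hab with ⟨_, ⟨k, rfl, rfl⟩ | ⟨k, rfl, rfl⟩⟩
        · exact ⟨k, rfl⟩
        · exact ⟨k, Sym2.eq_swap⟩
    calc Nat.card G.edgeSet ≤ Nat.card (Set.range fun k => s(s k, t k)) :=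
          Nat.card_mono (Set.finite_range _) hsub
      _ ≤ Nat.card κ := Finite.card_range_le _
  omega

/-- If every element `x` carries `d x` free ends and the links `k` have ends at `s k` and `t k`,
so that every element has `0` or `2` ends in total, then every connected class has `0` or `2`
free ends. -/
theorem sum_class_eq_two_or_zero {X κ : Type} [Fintype X] [Fintype κ] [DecidableEq X]
    (d : X → ℕ) (s t : κ → X)
    (hd : ∀ x, d x + (Finset.univ.filter fun k => s k = x).card
      + (Finset.univ.filter fun k => t k = x).card = 2 ∨
      d x + (Finset.univ.filter fun k => s k = x).card
      + (Finset.univ.filter fun k => t k = x).card = 0)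
    (R : Setoid X) (h1 : ∀ k, R (s k) (t k))
    (h2 : ∀ x y, R x y → Relation.EqvGen (fun a b => ∃ k, s k = a ∧ t k = b) x y)
    (c : Quotient R) [DecidablePred fun x => Quotient.mk R x = c] :
    ∑ x ∈ Finset.univ.filter (fun x => Quotient.mk R x = c), d x = 2 ∨
    ∑ x ∈ Finset.univ.filter (fun x => Quotient.mk R x = c), d x = 0 := by
  classical
  set C := Finset.univ.filter (fun x => Quotient.mk R x = c) with hC
  set K := Finset.univ.filter (fun k => Quotient.mk R (s k) = c) with hK
  have hst : ∀ k, Quotient.mk R (s k) = Quotient.mk R (t k) := fun k => Quotient.sound (h1 k)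
  have hs : ∑ x ∈ C, (Finset.univ.filter fun k => s k = x).card = K.card := by
    rw [Finset.card_eq_sum_card_fiberwise (f := s) (t := C)]
    · refine Finset.sum_congr rfl fun x hx => congrArg _ ?_
      ext k
      simp only [hC, Finset.mem_filter, Finset.mem_univ, true_and, hK] at hx ⊢
      constructor
      · rintro rfl; exact ⟨hx, rfl⟩
      · exact fun h => h.2
    · intro k hk
      simpa [hC, hK] using hk
  have ht : ∑ x ∈ C, (Finset.univ.filter fun k => t k = x).card = K.card := by
    rw [Finset.card_eq_sum_card_fiberwise (f := t) (t := C)]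
    · refine Finset.sum_congr rfl fun x hx => congrArg _ ?_
      ext k
      simp only [hC, Finset.mem_filter, Finset.mem_univ, true_and, hK] at hx ⊢
      constructor
      · rintro rfl; exact ⟨(hst k).trans hx, rfl⟩
      · exact fun h => h.2
    · intro k hk
      simpa [hC, hK, hst] using hk
  have hsC : ∀ k : K, s k ∈ C := fun k =>
    Finset.mem_filter.2 ⟨Finset.mem_univ _, (Finset.mem_filter.1 k.2).2⟩
  have htC : ∀ k : K, t k ∈ C := fun k =>
    Finset.mem_filter.2 ⟨Finset.mem_univ _, (hst k).symm.trans (Finset.mem_filter.1 k.2).2⟩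
  have hconn : ∀ x y, Relation.EqvGen (fun a b => ∃ k, s k = a ∧ t k = b) x y →
      ∀ (hx : x ∈ C) (hy : y ∈ C),
      Relation.EqvGen (fun a b : C => ∃ k : K, (⟨s k, hsC k⟩ : C) = a ∧
        (⟨t k, htC k⟩ : C) = b) ⟨x, hx⟩ ⟨y, hy⟩ := by
    intro x y h
    have hR : ∀ x y, Relation.EqvGen (fun a b => ∃ k, s k = a ∧ t k = b) x y →
        Quotient.mk R x = Quotient.mk R y := by
      intro x y h
      induction h with
      | rel x y h => obtain ⟨k, rfl, rfl⟩ := h; exact hst k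
      | refl x => rfl
      | symm x y _ ih => exact ih.symm
      | trans x y z _ _ ih1 ih2 => exact ih1.trans ih2
    induction h with
    | rel x y h =>
      intro hx hy
      obtain ⟨k, rfl, rfl⟩ := h
      exact Relation.EqvGen.rel _ _ ⟨⟨k, by simpa [hC, hK] using hx⟩, rfl, rfl⟩
    | refl x => intro _ _; exact Relation.EqvGen.refl _
    | symm x y _ ih => intro hx hy; exact Relation.EqvGen.symm _ _ (ih hy hx)
    | trans x y z hxy hyz ih1 ih2 =>
      intro hx hz
      have hy : y ∈ C := by
        have := hR x y hxy
        simp only [hC, Finset.mem_filter, Finset.mem_univ, true_and] at hx ⊢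
        rw [← this, hx]
      exact Relation.EqvGen.trans _ _ _ (ih1 hx hy) (ih2 hy hz)
  have hcard : C.card ≤ K.card + 1 := by
    have := card_le_of_eqvGen (X := C) (κ := K) (fun k => ⟨s k, hsC k⟩)
      (fun k => ⟨t k, htC k⟩) (fun x y => hconn x y
        (h2 x y (Quotient.exact (by
          have hx := x.2; have hy := y.2
          simp only [hC, Finset.mem_filter, Finset.mem_univ, true_and] at hx hy
          rw [hx, hy]))) x.2 y.2)
    simpa using this
  have hsum : ∑ x ∈ C, (d x + (Finset.univ.filter fun k => s k = x).card
      + (Finset.univ.filter fun k => t k = x).card) = ∑ x ∈ C, d x + K.card + K.card := by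
    rw [Finset.sum_add_distrib, Finset.sum_add_distrib, hs, ht]
  by_cases h0 : ∃ x ∈ C, d x + (Finset.univ.filter fun k => s k = x).card
      + (Finset.univ.filter fun k => t k = x).card = 0
  · obtain ⟨x, hx, hx0⟩ := h0
    have hiso : ∀ a b, Relation.EqvGen (fun a b => ∃ k, s k = a ∧ t k = b) a b →
        (a = x ↔ b = x) := by
      intro a b h
      induction h with
      | rel a b h =>
        obtain ⟨k, rfl, rfl⟩ := h
        have e1 : (Finset.univ.filter fun k => s k = x) = ∅ := Finset.card_eq_zero.1 (by omega)
        have e2 : (Finset.univ.filter fun k => t k = x) = ∅ := Finset.card_eq_zero.1 (by omega)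
        have e1' : s k ≠ x := fun h => by
          have : k ∈ (Finset.univ.filter fun k => s k = x) := by simp [h]
          rw [e1] at this; simp at this
        have e2' : t k ≠ x := fun h => by
          have : k ∈ (Finset.univ.filter fun k => t k = x) := by simp [h]
          rw [e2] at this; simp at this
        tauto
      | refl a => rfl
      | symm a b _ ih => exact ih.symm
      | trans a b c _ _ ih1 ih2 => exact ih1.trans ih2
    right
    refine Finset.sum_eq_zero fun y hy => ?_
    have : y = x := by
      refine (hiso x y (h2 x y (Quotient.exact ?_))).1 rfl
      simp only [hC, Finset.mem_filter, Finset.mem_univ, true_and] at hx hy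
      rw [hx, hy]
    subst this
    omega
  · push Not at h0
    have : ∑ x ∈ C, (d x + (Finset.univ.filter fun k => s k = x).card
      + (Finset.univ.filter fun k => t k = x).card) = ∑ x ∈ C, 2 :=
      Finset.sum_congr rfl fun x hx => (hd x).resolve_right (h0 x hx)
    rw [hsum, Finset.sum_const, smul_eq_mul] at this
    omega

end

noncomputable section

open scoped Classical

/-! ### Tensor networks -/

/-- The multiset of values of a finite family. -/
def values {H α : Type} [Fintype H] (c : H → α) : Multiset α := Finset.univ.val.map c

theorem values_comp_equiv {H H' α : Type} [Fintype H] [Fintype H'] (e : H ≃ H') (c : H' → α) :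
    values (c ∘ e) = values c := by
  unfold values
  rw [← Multiset.map_map]
  congr 1
  exact congrArg Finset.val (Finset.map_univ_equiv e)

theorem card_values {H α : Type} [Fintype H] (c : H → α) :
    Multiset.card (values c) = Fintype.card H := by
  simp [values]

theorem prod_values {H α S : Type} [Fintype H] [CommMonoid S] (c : H → α) (f : α → S) :
    ((values c).map f).prod = ∏ x, f (c x) := by
  unfold values
  rw [Multiset.map_map]
  rfl

theorem count_values {H α : Type} [Fintype H] [DecidableEq α] (c : H → α) (a : α) :
    (values c).count a = Fintype.card {x // c x = a} := by
  rw [values, Multiset.count_map, Fintype.card_subtype, Finset.card_def, Finset.filter_val]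
  congr 2
  ext x
  exact eq_comm

/-- Families with the same multiset of values differ by a bijection of the index types. -/
theorem exists_equiv_of_values_eq {H H' α : Type} [Fintype H] [Fintype H'] {c : H → α}
    {c' : H' → α} (h : values c = values c') : ∃ e : H ≃ H', ∀ x, c' (e x) = c x := by
  have hfib : ∀ a, Nonempty ({x // c x = a} ≃ {x // c' x = a}) := by
    intro a
    refine ⟨Fintype.equivOfCardEq ?_⟩
    have h1 := congrArg (Multiset.count a) h
    rw [count_values, count_values] at h1
    convert h1
  let F := fun a => (hfib a).some
  refine ⟨(Equiv.sigmaFiberEquiv c).symm.trans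
    ((Equiv.sigmaCongrRight F).trans (Equiv.sigmaFiberEquiv c')), fun x => ?_⟩
  simp only [Equiv.trans_apply]
  exact (F (c x) ⟨x, rfl⟩).2

theorem exists_values_eq {α : Type} (s : Multiset α) :
    ∃ c : Fin (Multiset.card s) → α, values c = s := by
  obtain ⟨l, rfl⟩ := Quot.exists_rep s
  exact ⟨l.get, (Fin.univ_val_map l.get).trans (congrArg _ (List.ofFn_get l))⟩

/-- Sums over functions on a quotient are sums over functions constant on the classes. -/
theorem sum_quotient_fun {X α S : Type} [Fintype X] [Fintype α] [AddCommMonoid S] (R : Setoid X)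
    [Fintype (Quotient R)] (f : (X → α) → S) :
    ∑ ψ : Quotient R → α, f (fun x => ψ (Quotient.mk R x))
      = ∑ ψ : X → α, if ∀ a b, R a b → ψ a = ψ b then f ψ else 0 := by
  rw [← Finset.sum_filter]
  symm
  refine Finset.sum_bij' (fun ψ hψ => Quotient.lift ψ (fun a b hab =>
      (Finset.mem_filter.1 hψ).2 a b hab)) (fun ψ _ e => ψ (Quotient.mk _ e)) ?_ ?_ ?_ ?_ ?_
  · intros; exact Finset.mem_univ _
  · intro ψ _
    exact Finset.mem_filter.2 ⟨Finset.mem_univ _, fun a b hab =>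
      congrArg ψ (Quotient.sound hab)⟩
  · intros; rfl
  · intro ψ _
    funext e
    induction e using Quotient.inductionOn with
    | h e => rfl
  · intro ψ hψ
    rfl

/-- A tensor network with open ends indexed by `ι`: half edges `H` attached to vertices `V`,
each edge in `E` joining two ends (half edges or open ends) or being a circle. -/
structure Net (ι : Type) where
  V : Type
  H : Type
  E : Type
  fintypeV : Fintype V
  fintypeH : Fintype H
  fintypeE : Fintype E
  vtx : H → V
  link : H ⊕ ι → E
  card_link : ∀ e, Nat.card {x // link x = e} = 2 ∨ Nat.card {x // link x = e} = 0

attribute [instance] Net.fintypeV Net.fintypeH Net.fintypeE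

namespace Net

variable {ι κ : Type} {n : ℕ} {S : Type} [CommSemiring S]

/-- The degree of a vertex. -/
def deg (N : Net ι) (v : N.V) : ℕ := Fintype.card {x // N.vtx x = v}

/-- The multiset of colours seen by a vertex. -/
def col (N : Net ι) (ψ : N.E → Fin n) (v : N.V) : Multiset (Fin n) :=
  values fun x : {x // N.vtx x = v} => ψ (N.link (Sum.inl x.1))

/-- The tensor of a network for the vertex weights `w`. -/
def val (N : Net ι) (w : Multiset (Fin n) → S) (φ : ι → Fin n) : S :=
  ∑ ψ : N.E → Fin n, if ∀ j, ψ (N.link (Sum.inr j)) = φ j then ∏ v, w (N.col ψ v) else 0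

theorem card_col (N : Net ι) (ψ : N.E → Fin n) (v : N.V) :
    Multiset.card (N.col ψ v) = N.deg v := card_values _

/-- Relabelling of the open ends. -/
def reindex (N : Net ι) (e : ι ≃ κ) : Net κ where
  V := N.V
  H := N.H
  E := N.E
  fintypeV := N.fintypeV
  fintypeH := N.fintypeH
  fintypeE := N.fintypeE
  vtx := N.vtx
  link := fun x => N.link (Equiv.sumCongr (Equiv.refl _) e.symm x)
  card_link := fun a => by
    have : Nat.card {x // N.link (Equiv.sumCongr (Equiv.refl _) e.symm x) = a}
        = Nat.card {x // N.link x = a} :=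
      Nat.card_congr ((Equiv.sumCongr (Equiv.refl _) e.symm).subtypeEquiv fun x => Iff.rfl)
    rw [this]
    exact N.card_link a

theorem val_reindex (N : Net ι) (e : ι ≃ κ) (w : Multiset (Fin n) → S) (φ : κ → Fin n) :
    (N.reindex e).val w φ = N.val w (φ ∘ e) := by
  unfold val
  refine Finset.sum_congr rfl fun ψ _ => ?_
  congr 1
  refine propext ⟨fun h j => ?_, fun h j => ?_⟩
  · simpa [reindex] using h (e j)
  · simpa [reindex] using h (e.symm j)

/-- Disjoint union of networks. -/
def mul (N : Net ι) (M : Net κ) : Net (ι ⊕ κ) where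
  V := N.V ⊕ M.V
  H := N.H ⊕ M.H
  E := N.E ⊕ M.E
  fintypeV := inferInstance
  fintypeH := inferInstance
  fintypeE := inferInstance
  vtx := Sum.map N.vtx M.vtx
  link := fun x => Sum.map N.link M.link (Equiv.sumSumSumComm N.H M.H ι κ x)
  card_link := fun a => by
    have h1 : Nat.card {x // Sum.map N.link M.link (Equiv.sumSumSumComm N.H M.H ι κ x) = a}
        = Nat.card {x // Sum.map N.link M.link x = a} :=
      Nat.card_congr ((Equiv.sumSumSumComm N.H M.H ι κ).subtypeEquiv fun x => Iff.rfl)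
    rw [h1]
    rcases a with a | a
    · have : Nat.card {x // N.link x = a}
          = Nat.card {x // Sum.map N.link M.link x = Sum.inl a} := by
        refine Nat.card_eq_of_bijective (fun x => ⟨Sum.inl x.1, by simp [x.2]⟩) ⟨?_, ?_⟩
        · intro x y h
          simpa [Subtype.ext_iff] using h
        · rintro ⟨x | x, hx⟩
          · exact ⟨⟨x, by simpa using hx⟩, rfl⟩
          · simp at hx
      rw [← this]
      exact N.card_link a
    · have : Nat.card {x // M.link x = a}
          = Nat.card {x // Sum.map N.link M.link x = Sum.inr a} := by
        refine Nat.card_eq_of_bijective (fun x => ⟨Sum.inr x.1, by simp [x.2]⟩) ⟨?_, ?_⟩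
        · intro x y h
          simpa [Subtype.ext_iff] using h
        · rintro ⟨x | x, hx⟩
          · simp at hx
          · exact ⟨⟨x, by simpa using hx⟩, rfl⟩
      rw [← this]
      exact M.card_link a

/-- Half edges at a vertex of the left part of a disjoint union. -/
def mulVtxInl (N : Net ι) (M : Net κ) (v : N.V) :
    {x // N.vtx x = v} ≃ {x // (N.mul M).vtx x = Sum.inl v} where
  toFun x := ⟨Sum.inl x.1, congrArg Sum.inl x.2⟩
  invFun
    | ⟨Sum.inl x, hx⟩ => ⟨x, Sum.inl_injective hx⟩
    | ⟨Sum.inr _, hx⟩ => absurd hx Sum.inr_ne_inl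
  left_inv _ := rfl
  right_inv
    | ⟨Sum.inl _, _⟩ => rfl
    | ⟨Sum.inr _, hx⟩ => absurd hx Sum.inr_ne_inl

/-- Half edges at a vertex of the right part of a disjoint union. -/
def mulVtxInr (N : Net ι) (M : Net κ) (v : M.V) :
    {x // M.vtx x = v} ≃ {x // (N.mul M).vtx x = Sum.inr v} where
  toFun x := ⟨Sum.inr x.1, congrArg Sum.inr x.2⟩
  invFun
    | ⟨Sum.inr x, hx⟩ => ⟨x, Sum.inr_injective hx⟩
    | ⟨Sum.inl _, hx⟩ => absurd hx Sum.inl_ne_inr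
  left_inv _ := rfl
  right_inv
    | ⟨Sum.inr _, _⟩ => rfl
    | ⟨Sum.inl _, hx⟩ => absurd hx Sum.inl_ne_inr

theorem deg_mul_inl (N : Net ι) (M : Net κ) (v : N.V) :
    (N.mul M).deg (Sum.inl v) = N.deg v :=
  (Fintype.card_congr (mulVtxInl N M v)).symm

theorem deg_mul_inr (N : Net ι) (M : Net κ) (v : M.V) :
    (N.mul M).deg (Sum.inr v) = M.deg v :=
  (Fintype.card_congr (mulVtxInr N M v)).symm

theorem col_mul_inl (N : Net ι) (M : Net κ) (ψ : N.E ⊕ M.E → Fin n) (v : N.V) :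
    (N.mul M).col ψ (Sum.inl v) = N.col (fun e => ψ (Sum.inl e)) v :=
  (values_comp_equiv (mulVtxInl N M v)
    (fun x => ψ ((N.mul M).link (Sum.inl x.1)))).symm

theorem col_mul_inr (N : Net ι) (M : Net κ) (ψ : N.E ⊕ M.E → Fin n) (v : M.V) :
    (N.mul M).col ψ (Sum.inr v) = M.col (fun e => ψ (Sum.inr e)) v :=
  (values_comp_equiv (mulVtxInr N M v)
    (fun x => ψ ((N.mul M).link (Sum.inl x.1)))).symm

theorem val_mul (N : Net ι) (M : Net κ) (w : Multiset (Fin n) → S) (φ : ι ⊕ κ → Fin n) :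
    (N.mul M).val w φ
      = N.val w (fun i => φ (Sum.inl i)) * M.val w (fun i => φ (Sum.inr i)) := by
  unfold val
  rw [Finset.sum_mul_sum]
  refine (Fintype.sum_equiv (ι := (N.mul M).E → Fin n)
    (Equiv.sumArrowEquivProdArrow N.E M.E (Fin n)) _
    (fun p : (N.E → Fin n) × (M.E → Fin n) =>
    (if ∀ j, p.1 (N.link (Sum.inr j)) = φ (Sum.inl j) then ∏ v, w (N.col p.1 v) else 0) *
      if ∀ j, p.2 (M.link (Sum.inr j)) = φ (Sum.inr j) then ∏ v, w (M.col p.2 v) else 0)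
    fun ψ => ?_).trans (Fintype.sum_prod_type _)
  have hc : (∀ j, ψ ((N.mul M).link (Sum.inr j)) = φ j) ↔
      (∀ j, ψ (Sum.inl (N.link (Sum.inr j))) = φ (Sum.inl j)) ∧
      (∀ j, ψ (Sum.inr (M.link (Sum.inr j))) = φ (Sum.inr j)) :=
    ⟨fun h => ⟨fun j => h (Sum.inl j), fun j => h (Sum.inr j)⟩,
      fun h j => j.casesOn h.1 h.2⟩
  have hp : ∏ v, w ((N.mul M).col ψ v)
      = (∏ v, w (N.col (fun e => ψ (Sum.inl e)) v)) *
        ∏ v, w (M.col (fun e => ψ (Sum.inr e)) v) := by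
    refine (Fintype.prod_sum_type (fun v : N.V ⊕ M.V => w ((N.mul M).col ψ v))).trans ?_
    exact congrArg₂ _ (Fintype.prod_congr _ _ fun v => congrArg w (col_mul_inl N M ψ v))
      (Fintype.prod_congr _ _ fun v => congrArg w (col_mul_inr N M ψ v))
  change _ = (if ∀ j, ψ (Sum.inl (N.link (Sum.inr j))) = φ (Sum.inl j) then
      ∏ v, w (N.col (fun e => ψ (Sum.inl e)) v) else 0) *
    if ∀ j, ψ (Sum.inr (M.link (Sum.inr j))) = φ (Sum.inr j) then
      ∏ v, w (M.col (fun e => ψ (Sum.inr e)) v) else 0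
  by_cases h1 : ∀ j, ψ (Sum.inl (N.link (Sum.inr j))) = φ (Sum.inl j)
  · by_cases h2 : ∀ j, ψ (Sum.inr (M.link (Sum.inr j))) = φ (Sum.inr j)
    · rw [if_pos (hc.2 ⟨h1, h2⟩), if_pos h1, if_pos h2, hp]
    · rw [if_neg (fun h => h2 (hc.1 h).2), if_neg h2, mul_zero]
  · rw [if_neg (fun h => h1 (hc.1 h).1), if_neg h1, zero_mul]

/-- The equivalence relation on edges generated by gluing open ends in pairs. -/
def contractRel (N : Net (ι ⊕ (κ ⊕ κ))) : Setoid N.E :=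
  Relation.EqvGen.setoid fun a b => ∃ k, N.link (Sum.inr (Sum.inr (Sum.inl k))) = a ∧
    N.link (Sum.inr (Sum.inr (Sum.inr k))) = b

theorem natCard_subtype_eq {α : Type} [Fintype α] (p : α → Prop) :
    Nat.card {x // p x} = ∑ x, if p x then 1 else 0 := by
  rw [Nat.card_eq_fintype_card, Fintype.card_subtype, Finset.card_filter]

/-- Contraction of pairs of open ends. -/
def contract [Fintype ι] [Fintype κ] (N : Net (ι ⊕ (κ ⊕ κ))) : Net ι where
  V := N.V
  H := N.H
  E := Quotient N.contractRel
  fintypeV := N.fintypeV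
  fintypeH := N.fintypeH
  fintypeE := inferInstance
  vtx := N.vtx
  link := fun x => Quotient.mk _ (N.link (Sum.map id Sum.inl x))
  card_link := fun c => by
    have key := sum_class_eq_two_or_zero
      (fun e => ∑ x : N.H ⊕ ι, if N.link (Sum.map id Sum.inl x) = e then 1 else 0)
      (fun k => N.link (Sum.inr (Sum.inr (Sum.inl k))))
      (fun k => N.link (Sum.inr (Sum.inr (Sum.inr k)))) (fun e => by
        have := N.card_link e
        rw [natCard_subtype_eq] at this
        simp only [Fintype.sum_sum_type, Finset.card_filter, Sum.map_inl, Sum.map_inr, id]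
          at this ⊢
        rw [add_assoc, add_assoc]
        convert this <;> congr)
      N.contractRel (fun k => Relation.EqvGen.rel _ _ ⟨k, rfl, rfl⟩) (fun _ _ h => h) c
    rw [natCard_subtype_eq]
    convert key using 2
    all_goals
      rw [Finset.sum_comm]
      refine Finset.sum_congr rfl fun x _ => ?_
      rw [Finset.sum_ite_eq]
      simp

theorem sum_val_glue [Fintype ι] [Fintype κ] (N : Net (ι ⊕ (κ ⊕ κ)))
    (w : Multiset (Fin n) → S) (φ : ι → Fin n) :
    ∑ c : κ → Fin n, N.val w (Sum.elim φ (Sum.elim c c))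
      = ∑ ψ : N.E → Fin n, if ∀ a b, N.contractRel a b → ψ a = ψ b then
        if ∀ j, ψ (N.link (Sum.inr (Sum.inl j))) = φ j then ∏ v, w (N.col ψ v) else 0 else 0 := by
  have h1 : ∀ ψ : N.E → Fin n,
      (∑ c : κ → Fin n, if ∀ j, ψ (N.link (Sum.inr j)) = (Sum.elim φ (Sum.elim c c)) j then
        ∏ v, w (N.col ψ v) else 0)
      = if (∀ a b, N.contractRel a b → ψ a = ψ b) ∧
          (∀ j, ψ (N.link (Sum.inr (Sum.inl j))) = φ j) then
        ∏ v, w (N.col ψ v) else 0 := by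
    intro ψ
    have hiff : ∀ c : κ → Fin n,
        (∀ j, ψ (N.link (Sum.inr j)) = (Sum.elim φ (Sum.elim c c)) j) ↔
        ((fun k => ψ (N.link (Sum.inr (Sum.inr (Sum.inl k))))) = c ∧
        ((∀ a b, N.contractRel a b → ψ a = ψ b) ∧
          (∀ j, ψ (N.link (Sum.inr (Sum.inl j))) = φ j))) := by
      intro c
      constructor
      · intro h
        have hl : ∀ k, ψ (N.link (Sum.inr (Sum.inr (Sum.inl k)))) = c k :=
          fun k => h (Sum.inr (Sum.inl k))
        have hr : ∀ k, ψ (N.link (Sum.inr (Sum.inr (Sum.inr k)))) = c k :=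
          fun k => h (Sum.inr (Sum.inr k))
        refine ⟨funext hl, ?_, fun j => h (Sum.inl j)⟩
        intro a b hab
        induction hab with
        | rel a b h => obtain ⟨k, rfl, rfl⟩ := h; rw [hl, hr]
        | refl a => rfl
        | symm a b _ ih => exact ih.symm
        | trans a b c _ _ ih1 ih2 => exact ih1.trans ih2
      · rintro ⟨rfl, hab, hφ⟩ (j | j | j)
        · exact hφ j
        · rfl
        · exact (hab _ _ (Relation.EqvGen.rel _ _ ⟨j, rfl, rfl⟩)).symm
    simp only [hiff, ite_and]
    rw [Finset.sum_ite_eq]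
    simp
  unfold val
  rw [Finset.sum_comm]
  refine Finset.sum_congr rfl fun ψ _ => ?_
  have h2 := h1 ψ
  rw [ite_and] at h2
  rw [← h2]
  refine Finset.sum_congr rfl fun c _ => ?_
  congr!

theorem val_contract [Fintype ι] [Fintype κ] (N : Net (ι ⊕ (κ ⊕ κ)))
    (w : Multiset (Fin n) → S) (φ : ι → Fin n) :
    N.contract.val w φ
      = ∑ c : κ → Fin n, N.val w (Sum.elim φ (Sum.elim c c)) := by
  rw [sum_val_glue]
  have h3 := @sum_quotient_fun _ _ _ _ _ _ N.contractRel N.contract.fintypeE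
    (fun ψ : N.E → Fin n =>
    if ∀ j, ψ (N.link (Sum.inr (Sum.inl j))) = φ j then ∏ v, w (N.col ψ v) else 0)
  refine Eq.trans ?_ (Eq.trans h3 ?_)
  swap
  · refine Finset.sum_congr rfl fun ψ _ => ?_
    congr!
  unfold val
  refine Finset.sum_congr (Finset.ext fun _ =>
    iff_of_true (@Finset.mem_univ _ (_) _) (@Finset.mem_univ _ (_) _)) fun ψ _ => ?_
  by_cases hψ : ∀ j, ψ (Quotient.mk _ (N.link (Sum.inr (Sum.inl j)))) = φ j
  · exact (@if_pos _ (_) hψ _ _ _).trans (@if_pos _ (_) hψ _ _ _).symm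
  · exact (@if_neg _ (_) hψ _ _ _).trans (@if_neg _ (_) hψ _ _ _).symm

end Net

end

noncomputable section

/-! ### Fragments as tensor networks -/

theorem ite_decidable_irrel {α : Type} {p : Prop} {i j : Decidable p} {a b : α} :
    @ite α p i a b = @ite α p j a b := by
  congr

theorem ite_congr_of_iff {α : Type} {p q : Prop} {i : Decidable p} {j : Decidable q} {a b c : α}
    (h : p ↔ q) (hab : a = b) : @ite α p i a c = @ite α q j b c := by
  subst hab
  by_cases hp : p
  · rw [if_pos hp, if_pos (h.1 hp)]
  · rw [if_neg hp, if_neg fun hq => hp (h.2 hq)]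

/-- The tensor of a fragment for arbitrary vertex weights. -/
def fph {n k : ℕ} {S : Type} [CommSemiring S] (w : Multiset (Fin n) → S) (F : Fragment k)
    (φ : Fin k → Fin n) : S :=
  ∑ ψ ∈ Finset.univ.filter
      (fun ψ : Fin F.ne → Fin n => ∀ (e : Fin F.ne) (j : Fin k),
        Sum.inr j ∈ F.inc e → ψ e = φ j),
    ∏ v, w (∑ e, (F.inc e).count (Sum.inl v) • {ψ e})

/-- The vertex weights of a vertex model. -/
def weight {𝔽 : Type} [Field 𝔽] {n : ℕ} (h : VertexModel 𝔽 n) (s : Multiset (Fin n)) : 𝔽 :=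
  h ((s.map X).prod)

theorem apply_monomialAt {𝔽 : Type} [Field 𝔽] {n k : ℕ} (h : VertexModel 𝔽 n) (F : Fragment k)
    (ψ : Fin F.ne → Fin n) (v : Fin F.nv) :
    h (monomialAt F ψ v) = weight h (∑ e, (F.inc e).count (Sum.inl v) • {ψ e}) := by
  unfold weight monomialAt
  congr 1
  have h1 := map_sum (Multiset.mapAddMonoidHom (X : Fin n → MvPolynomial (Fin n) 𝔽))
    (fun e => (F.inc e).count (Sum.inl v) • ({ψ e} : Multiset (Fin n))) Finset.univ
  simp only [Multiset.coe_mapAddMonoidHom, Multiset.map_nsmul, Multiset.map_singleton] at h1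
  rw [h1, Multiset.prod_sum]
  refine Finset.prod_congr rfl fun e _ => ?_
  rw [Multiset.prod_nsmul, Multiset.prod_singleton]

theorem ph_eq_fph {𝔽 : Type} [Field 𝔽] {n k : ℕ} (h : VertexModel 𝔽 n) (F : Fragment k) :
    ph h F = fph (weight h) F := by
  funext φ
  unfold ph hphi fph
  refine Finset.sum_congr rfl fun ψ _ => Finset.prod_congr rfl fun v _ => ?_
  exact apply_monomialAt h F ψ v

theorem partitionFun_eq_fph {𝔽 : Type} [Field 𝔽] {n : ℕ} (h : VertexModel 𝔽 n) (G : Graph)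
    (φ : Fin 0 → Fin n) : partitionFun h G = fph (weight h) G φ := by
  unfold partitionFun fph
  rw [Finset.filter_true_of_mem fun ψ _ e j => j.elim0]
  refine Finset.sum_congr rfl fun ψ _ => Finset.prod_congr rfl fun v _ => ?_
  exact apply_monomialAt h G ψ v

theorem Fragment.exists_edge {k : ℕ} (F : Fragment k) (j : Fin k) :
    ∃ e, ∀ e', (F.inc e').count (Sum.inr j) = if e = e' then 1 else 0 := by
  obtain ⟨e, -, he⟩ : ∃ e ∈ Finset.univ, (F.inc e).count (Sum.inr j) ≠ 0 := by
    apply Finset.exists_ne_zero_of_sum_ne_zero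
    rw [F.openEnd j]
    exact one_ne_zero
  refine ⟨e, fun e' => ?_⟩
  have h1 := F.openEnd j
  rw [← Finset.add_sum_erase _ _ (Finset.mem_univ e)] at h1
  have h2 : ∑ x ∈ Finset.univ.erase e, (F.inc x).count (Sum.inr j) = 0 := by omega
  split_ifs with h
  · subst h; omega
  · exact Finset.sum_eq_zero_iff.1 h2 e'
      (Finset.mem_erase.2 ⟨fun h' => h h'.symm, Finset.mem_univ _⟩)

/-- The edge carrying an open end. -/
def Fragment.edge {k : ℕ} (F : Fragment k) (j : Fin k) : Fin F.ne := (F.exists_edge j).choose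

theorem Fragment.count_inr {k : ℕ} (F : Fragment k) (j : Fin k) (e : Fin F.ne) :
    (F.inc e).count (Sum.inr j) = if F.edge j = e then 1 else 0 :=
  (F.exists_edge j).choose_spec e

theorem Fragment.inr_mem {k : ℕ} (F : Fragment k) (j : Fin k) (e : Fin F.ne) :
    Sum.inr j ∈ F.inc e ↔ F.edge j = e := by
  rw [← Multiset.one_le_count_iff_mem, F.count_inr]
  split_ifs with h <;> simp [h]

theorem Fragment.sum_count {k : ℕ} (F : Fragment k) (e : Fin F.ne) :
    ∑ v, (F.inc e).count (Sum.inl v) + ∑ j, (if F.edge j = e then 1 else 0)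
      = Multiset.card (F.inc e) := by
  rw [← Multiset.sum_count_eq_card (s := Finset.univ) fun a _ => Finset.mem_univ a,
    Fintype.sum_sum_type]
  simp only [F.count_inr]

theorem fph_eq_sum {n k : ℕ} {S : Type} [CommSemiring S] (w : Multiset (Fin n) → S)
    (F : Fragment k) (φ : Fin k → Fin n) :
    fph w F φ = ∑ ψ : Fin F.ne → Fin n, if ∀ j, ψ (F.edge j) = φ j then
      ∏ v, w (∑ e, (F.inc e).count (Sum.inl v) • {ψ e}) else 0 := by
  unfold fph
  rw [Finset.sum_filter]
  refine Finset.sum_congr rfl fun ψ _ => if_congr ?_ rfl rfl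
  simp only [F.inr_mem]
  exact ⟨fun h j => h _ j rfl, by rintro h e j rfl; exact h j⟩

theorem values_eq_sum {H α : Type} [Fintype H] (c : H → α) : values c = ∑ x, {c x} := by
  refine (Multiset.sum_map_singleton _).symm.trans ?_
  rw [values, Multiset.map_map]
  rfl

open scoped Classical in
theorem Net.col_eq_sum {ι : Type} {n : ℕ} (N : Net ι) (ψ : N.E → Fin n) (v : N.V) :
    N.col ψ v = ∑ x : N.H, if N.vtx x = v then {ψ (N.link (Sum.inl x))} else 0 := by
  unfold col
  rw [values_eq_sum, ← Finset.sum_filter]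
  exact (Finset.sum_subtype _ (by simp)
    (fun x => ({ψ (N.link (Sum.inl x))} : Multiset (Fin n)))).symm

/-- The tensor network of a fragment. -/
def Fragment.toNet {k : ℕ} (F : Fragment k) : Net (Fin k) where
  V := Fin F.nv
  H := Σ e : Fin F.ne, Σ v : Fin F.nv, Fin ((F.inc e).count (Sum.inl v))
  E := Fin F.ne
  fintypeV := inferInstance
  fintypeH := inferInstance
  fintypeE := inferInstance
  vtx := fun x => x.2.1
  link := Sum.elim (fun x => x.1) F.edge
  card_link := fun e => by
    have h1 := F.card_inc e
    rw [← F.sum_count e] at h1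
    classical
    rw [Net.natCard_subtype_eq]
    simp only [Fintype.sum_sum_type, Sum.elim_inl, Sum.elim_inr, Fintype.sum_sigma]
    convert h1 using 3
    all_goals first
      | (rw [Finset.sum_eq_single e]
         · simp
         · intro b _ hb
           simp [hb]
         · simp)
      | exact Finset.sum_congr rfl fun _ _ => ite_decidable_irrel

theorem Fragment.val_toNet {n k : ℕ} {S : Type} [CommSemiring S] (w : Multiset (Fin n) → S)
    (F : Fragment k) : F.toNet.val w = fph w F := by
  classical
  funext φ
  rw [fph_eq_sum]
  unfold Net.val
  refine Finset.sum_congr (Finset.ext fun _ =>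
    iff_of_true (@Finset.mem_univ _ (_) _) (@Finset.mem_univ _ (_) _)) fun ψ _ => ?_
  have h1 : ∀ v : Fin F.nv, F.toNet.col ψ v
      = ∑ e, (F.inc e).count (Sum.inl v) • ({ψ e} : Multiset (Fin n)) := by
    intro v
    refine (Net.col_eq_sum F.toNet ψ v).trans ?_
    refine (Fintype.sum_sigma _).trans (Fintype.sum_congr _ _ fun e => ?_)
    refine (Fintype.sum_sigma _).trans ?_
    rw [Finset.sum_eq_single v]
    · simp [toNet]
    · intro b _ hb
      simp [toNet, hb]
    · simp
  have h2 : ∏ v, w (F.toNet.col ψ v)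
      = ∏ v, w (∑ e, (F.inc e).count (Sum.inl v) • ({ψ e} : Multiset (Fin n))) :=
    Finset.prod_congr rfl fun v _ => congrArg w (h1 v)
  rw [h2]
  congr!

end

noncomputable section

namespace Net

variable {k : ℕ} (N : Net (Fin k))

/-- The endpoint of an end of an edge, with vertices numbered. -/
def endpoint : N.H ⊕ Fin k → Fin (Fintype.card N.V) ⊕ Fin k :=
  Sum.map (fun x => Fintype.equivFin N.V (N.vtx x)) id

open scoped Classical in
/-- The endpoints of the edges of a network, with edges numbered. -/
def endpoints (e : Fin (Fintype.card N.E)) : Multiset (Fin (Fintype.card N.V) ⊕ Fin k) :=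
  ∑ x : N.H ⊕ Fin k, if Fintype.equivFin N.E (N.link x) = e then {N.endpoint x} else 0

theorem sum_count_smul_endpoints {M : Type} [AddCommMonoid M]
    (a : Fin (Fintype.card N.V) ⊕ Fin k) (f : Fin (Fintype.card N.E) → M) :
    ∑ e, (N.endpoints e).count a • f e
      = ∑ x, ({N.endpoint x} : Multiset _).count a • f (Fintype.equivFin N.E (N.link x)) := by
  classical
  have h1 : ∀ e, (N.endpoints e).count a • f e = ∑ x, if Fintype.equivFin N.E (N.link x) = e then
      ({N.endpoint x} : Multiset _).count a • f e else 0 := by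
    intro e
    rw [endpoints, Multiset.count_sum', Finset.sum_smul]
    refine Finset.sum_congr rfl fun x _ => ?_
    split_ifs <;> simp
  rw [Finset.sum_congr rfl fun e _ => h1 e, Finset.sum_comm]
  refine Finset.sum_congr rfl fun x _ => ?_
  rw [Finset.sum_ite_eq]
  simp

/-- The fragment of a tensor network. -/
def toFragment : Fragment k where
  nv := Fintype.card N.V
  ne := Fintype.card N.E
  inc := N.endpoints
  card_inc := fun e => by
    classical
    have h1 := N.card_link ((Fintype.equivFin N.E).symm e)
    rw [natCard_subtype_eq] at h1
    have h2 : Multiset.card (N.endpoints e)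
        = ∑ x, if N.link x = (Fintype.equivFin N.E).symm e then 1 else 0 := by
      rw [endpoints, Multiset.card_sum]
      refine Finset.sum_congr rfl fun x _ => ?_
      rw [apply_ite Multiset.card]
      by_cases hx : N.link x = (Fintype.equivFin N.E).symm e
      · rw [if_pos hx, if_pos ((Equiv.eq_symm_apply _).1 hx), Multiset.card_singleton]
      · rw [if_neg hx, if_neg fun h => hx ((Equiv.eq_symm_apply _).2 h), Multiset.card_zero]
    rw [h2]
    exact h1
  openEnd := fun j => by
    have h1 := N.sum_count_smul_endpoints (Sum.inr j) (fun _ => 1)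
    simp only [smul_eq_mul, mul_one] at h1
    rw [h1, Fintype.sum_sum_type]
    simp [endpoint, Multiset.count_singleton]

theorem edge_toFragment (j : Fin k) :
    N.toFragment.edge j = Fintype.equivFin N.E (N.link (Sum.inr j)) := by
  classical
  refine (N.toFragment.inr_mem j _).1 ?_
  refine Multiset.mem_of_le
    (Finset.single_le_sum (fun x _ => Multiset.zero_le _) (Finset.mem_univ (Sum.inr j))) ?_
  simp [endpoint]
  exact Multiset.mem_singleton_self _

theorem fph_toFragment {n : ℕ} {S : Type} [CommSemiring S] (w : Multiset (Fin n) → S) :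
    fph w N.toFragment = N.val w := by
  classical
  funext φ
  rw [fph_eq_sum]
  refine Fintype.sum_equiv ((Fintype.equivFin N.E).symm.arrowCongr (Equiv.refl (Fin n))) _ _
    fun ψ => ?_
  refine ite_congr_of_iff ?_ ?_
  · simp [edge_toFragment]
  · refine Fintype.prod_equiv (Fintype.equivFin N.V).symm _ _ fun v => congrArg w ?_
    refine (N.sum_count_smul_endpoints (Sum.inl v) (fun e => ({ψ e} : Multiset (Fin n)))).trans ?_
    rw [Fintype.sum_sum_type, col_eq_sum]
    simp only [endpoint, Multiset.count_singleton, Sum.map_inl, Sum.map_inr]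
    simp only [Sum.inl.injEq, reduceCtorEq, if_false, zero_smul, Finset.sum_const_zero, add_zero]
    refine Finset.sum_congr rfl fun x _ => ?_
    by_cases hx : N.vtx x = (Fintype.equivFin N.V).symm v
    · rw [if_pos hx, if_pos ((Equiv.eq_symm_apply _).1 hx).symm, one_smul]
      simp
    · rw [if_neg hx, if_neg fun h => hx ((Equiv.eq_symm_apply _).2 h.symm), zero_smul]

end Net

/-! ### Gluing -/

section Glue

variable {n k : ℕ} (F H : Fragment k)

theorem card_filterMap_inl {V W Z : Type} [Fintype V] [DecidableEq V] [DecidableEq W]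
    (s : Multiset (V ⊕ W)) (f : V → Z) (g : V ⊕ W → Option Z)
    (hl : ∀ v, g (Sum.inl v) = some (f v)) (hr : ∀ w, g (Sum.inr w) = none) :
    Multiset.card (s.filterMap g) = ∑ v, s.count (Sum.inl v) := by
  induction s using Multiset.induction with
  | empty => simp
  | cons a s ih =>
    rcases a with a | a
    · rw [Multiset.filterMap_cons_some _ _ _ (hl a)]
      simp [Multiset.count_cons, ih, Finset.sum_add_distrib]
    · rw [Multiset.filterMap_cons_none _ _ (hr a)]
      simp [ih]

theorem count_filterMap_inl {V W Z : Type} [DecidableEq V] [DecidableEq W] [DecidableEq Z]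
    (s : Multiset (V ⊕ W)) (f : V → Z) (hf : Function.Injective f) (g : V ⊕ W → Option Z)
    (hl : ∀ v, g (Sum.inl v) = some (f v)) (hr : ∀ w, g (Sum.inr w) = none) (v : V) :
    (s.filterMap g).count (f v) = s.count (Sum.inl v) := by
  induction s using Multiset.induction with
  | empty => simp
  | cons a s ih =>
    rcases a with a | a
    · rw [Multiset.filterMap_cons_some _ _ _ (hl a)]
      simp [Multiset.count_cons, ih, hf.eq_iff]
    · rw [Multiset.filterMap_cons_none _ _ (hr a)]
      simp [ih]

theorem count_filterMap_inl_of_ne {V W Z : Type} [DecidableEq Z]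
    (s : Multiset (V ⊕ W)) (f : V → Z) (g : V ⊕ W → Option Z)
    (hl : ∀ v, g (Sum.inl v) = some (f v)) (hr : ∀ w, g (Sum.inr w) = none)
    (z : Z) (hz : ∀ v, f v ≠ z) : (s.filterMap g).count z = 0 := by
  rw [Multiset.count_eq_zero, Multiset.mem_filterMap]
  rintro ⟨a | a, -, h⟩
  · rw [hl] at h
    exact hz a (Option.some_injective _ h)
  · rw [hr] at h
    cases h

theorem card_intEnds_inl (e : Fin F.ne) :
    Multiset.card (intEnds F H (Sum.inl e)) = ∑ v, (F.inc e).count (Sum.inl v) :=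
  card_filterMap_inl _ _ _ (fun _ => rfl) (fun _ => rfl)

theorem card_intEnds_inr (e : Fin H.ne) :
    Multiset.card (intEnds F H (Sum.inr e)) = ∑ v, (H.inc e).count (Sum.inl v) :=
  card_filterMap_inl _ _ _ (fun _ => rfl) (fun _ => rfl)

theorem count_intEnds_inl_castAdd (e : Fin F.ne) (v : Fin F.nv) :
    (intEnds F H (Sum.inl e)).count (Sum.inl (Fin.castAdd H.nv v))
      = (F.inc e).count (Sum.inl v) :=
  count_filterMap_inl _ (fun v => (Sum.inl (Fin.castAdd H.nv v) : _ ⊕ Fin 0))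
    (fun _ _ h => Fin.castAdd_injective _ _ (Sum.inl_injective h)) _ (fun _ => rfl)
    (fun _ => rfl) v

theorem count_intEnds_inl_natAdd (e : Fin F.ne) (v : Fin H.nv) :
    (intEnds F H (Sum.inl e)).count (Sum.inl (Fin.natAdd F.nv v)) = 0 :=
  count_filterMap_inl_of_ne _ (fun v => (Sum.inl (Fin.castAdd H.nv v) : _ ⊕ Fin 0)) _
    (fun _ => rfl) (fun _ => rfl) _ fun u h => by
      have h1 := congrArg Fin.val (Sum.inl_injective h)
      simp at h1
      omega

theorem count_intEnds_inr_natAdd (e : Fin H.ne) (v : Fin H.nv) :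
    (intEnds F H (Sum.inr e)).count (Sum.inl (Fin.natAdd F.nv v))
      = (H.inc e).count (Sum.inl v) :=
  count_filterMap_inl _ (fun v => (Sum.inl (Fin.natAdd F.nv v) : _ ⊕ Fin 0))
    (fun _ _ h => Fin.natAdd_injective _ _ (Sum.inl_injective h)) _ (fun _ => rfl)
    (fun _ => rfl) v

theorem count_intEnds_inr_castAdd (e : Fin H.ne) (v : Fin F.nv) :
    (intEnds F H (Sum.inr e)).count (Sum.inl (Fin.castAdd H.nv v)) = 0 :=
  count_filterMap_inl_of_ne _ (fun v => (Sum.inl (Fin.natAdd F.nv v) : _ ⊕ Fin 0)) _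
    (fun _ => rfl) (fun _ => rfl) _ fun u h => by
      have h1 := congrArg Fin.val (Sum.inl_injective h)
      simp at h1
      omega

theorem touches_iff (j : Fin k) (a : Fin F.ne ⊕ Fin H.ne) :
    touches F H j a ↔ Sum.inl (F.edge j) = a ∨ Sum.inr (H.edge j) = a := by
  rcases a with e | e <;> simp [touches, Fragment.inr_mem]

theorem glueSetoid_eqvGen {x y : Fin F.ne ⊕ Fin H.ne} (h : glueSetoid F H x y) :
    Relation.EqvGen (fun a b => ∃ j : Fin k, Sum.inl (F.edge j) = a ∧ Sum.inr (H.edge j) = b)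
      x y := by
  induction h with
  | rel a b h =>
    obtain ⟨j, ha, hb⟩ := h
    rw [touches_iff] at ha hb
    have h0 : Relation.EqvGen (fun a b => ∃ j : Fin k,
        (Sum.inl (F.edge j) : Fin F.ne ⊕ Fin H.ne) = a ∧ Sum.inr (H.edge j) = b)
        (Sum.inl (F.edge j)) (Sum.inr (H.edge j)) := .rel _ _ ⟨j, rfl, rfl⟩
    rcases ha with rfl | rfl <;> rcases hb with rfl | rfl
    · exact .refl _
    · exact h0
    · exact .symm _ _ h0
    · exact .refl _
  | refl a => exact .refl _
  | symm a b _ ih => exact .symm _ _ ih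
  | trans a b c _ _ ih1 ih2 => exact .trans _ _ _ ih1 ih2

theorem glueSetoid_edge (j : Fin k) :
    glueSetoid F H (Sum.inl (F.edge j)) (Sum.inr (H.edge j)) :=
  .rel _ _ ⟨j, (touches_iff F H j _).2 (Or.inl rfl), (touches_iff F H j _).2 (Or.inr rfl)⟩

theorem card_glueInc (c : Fin (glueNE F H)) :
    Multiset.card (glueInc F H c) = 2 ∨ Multiset.card (glueInc F H c) = 0 := by
  classical
  have key := sum_class_eq_two_or_zero (fun a => Multiset.card (intEnds F H a))
    (fun j : Fin k => Sum.inl (F.edge j)) (fun j : Fin k => Sum.inr (H.edge j)) (fun a => by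
      rcases a with e | e
      · have h1 := F.card_inc e
        rw [← F.sum_count e] at h1
        simp only [card_intEnds_inl, Finset.card_filter, Sum.inl.injEq, reduceCtorEq, if_false,
          Finset.sum_const_zero, add_zero]
        exact h1
      · have h1 := H.card_inc e
        rw [← H.sum_count e] at h1
        simp only [card_intEnds_inr, Finset.card_filter, Sum.inr.injEq, reduceCtorEq, if_false,
          Finset.sum_const_zero, add_zero]
        exact h1)
    (glueSetoid F H) (glueSetoid_edge F H) (fun _ _ h => glueSetoid_eqvGen F H h)
    (glueEquiv F H c)
  have h2 : Multiset.card (glueInc F H c) = ∑ x ∈ Finset.univ.filter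
      (fun x => Quotient.mk (glueSetoid F H) x = glueEquiv F H c),
        Multiset.card (intEnds F H x) := by
    unfold glueInc
    rw [Multiset.card_sum]
  rw [h2]
  exact key

theorem const_on_glueSetoid_iff (ψ : Fin F.ne ⊕ Fin H.ne → Fin n) :
    (∀ a b, glueSetoid F H a b → ψ a = ψ b) ↔
      ∀ j, ψ (Sum.inr (H.edge j)) = ψ (Sum.inl (F.edge j)) := by
  constructor
  · exact fun h j => (h _ _ (glueSetoid_edge F H j)).symm
  · intro h a b hab
    have h1 := glueSetoid_eqvGen F H hab
    clear hab
    induction h1 with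
    | rel a b h' => obtain ⟨j, rfl, rfl⟩ := h'; exact (h j).symm
    | refl a => rfl
    | symm a b _ ih => exact ih.symm
    | trans a b c _ _ ih1 ih2 => exact ih1.trans ih2

theorem fph_glue {S : Type} [CommSemiring S] (w : Multiset (Fin n) → S) (φ₀ : Fin 0 → Fin n) :
    fph w (glue F H) φ₀ = ∑ φ, fph w F φ * fph w H φ := by
  classical
  have hc := card_glueInc F H
  have h1 : glue F H = 
    { nv := F.nv + H.nv
      ne := glueNE F H
      inc := glueInc F H
      card_inc := hc
      openEnd := fun j => j.elim0 } := dif_pos hc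
  rw [h1]
  have h2 : ∀ (ψ : Quotient (glueSetoid F H) → Fin n) (v : Fin (F.nv + H.nv)),
      ∑ c, (glueInc F H c).count (Sum.inl v) • ({ψ (glueEquiv F H c)} : Multiset (Fin n))
      = ∑ a, (intEnds F H a).count (Sum.inl v) • {ψ (Quotient.mk _ a)} := by
    intro ψ v
    have h3 : ∀ c, (glueInc F H c).count (Sum.inl v) •
        ({ψ (glueEquiv F H c)} : Multiset (Fin n))
        = ∑ a, if (glueEquiv F H).symm (Quotient.mk _ a) = c then
          (intEnds F H a).count (Sum.inl v) • {ψ (Quotient.mk _ a)} else 0 := by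
      intro c
      unfold glueInc
      rw [Multiset.count_sum', Finset.sum_smul, Finset.sum_filter]
      refine Finset.sum_congr rfl fun a _ => ?_
      by_cases ha : Quotient.mk (glueSetoid F H) a = glueEquiv F H c
      · rw [if_pos ha, if_pos ((Equiv.symm_apply_eq _).2 ha), ha]
      · rw [if_neg ha, if_neg fun h => ha ((Equiv.symm_apply_eq _).1 h)]
    rw [Finset.sum_congr rfl fun c _ => h3 c, Finset.sum_comm]
    refine Finset.sum_congr rfl fun a _ => ?_
    rw [Finset.sum_ite_eq]
    simp
  let f : (Fin F.ne ⊕ Fin H.ne → Fin n) → S := fun ψ =>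
    ∏ v, w (∑ a, (intEnds F H a).count (Sum.inl v) • {ψ a})
  have hf : ∀ ψ, f ψ = (∏ v, w (∑ e, (F.inc e).count (Sum.inl v) • {ψ (Sum.inl e)})) *
      ∏ v, w (∑ e, (H.inc e).count (Sum.inl v) • {ψ (Sum.inr e)}) := by
    intro ψ
    simp only [f, Fin.prod_univ_add, Fintype.sum_sum_type, count_intEnds_inl_castAdd,
      count_intEnds_inl_natAdd, count_intEnds_inr_castAdd, count_intEnds_inr_natAdd, zero_smul,
      Finset.sum_const_zero, add_zero, zero_add]
  trans ∑ ψ : Quotient (glueSetoid F H) → Fin n, f fun a => ψ (Quotient.mk _ a)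
  · rw [fph_eq_sum]
    refine Fintype.sum_equiv ((glueEquiv F H).arrowCongr (Equiv.refl (Fin n))) _ _ fun ψ => ?_
    rw [if_pos fun j => j.elim0]
    refine Finset.prod_congr rfl fun v _ => congrArg w ?_
    refine Eq.trans ?_ (h2 _ v)
    refine Finset.sum_congr rfl fun c _ => ?_
    simp
  rw [sum_quotient_fun]
  have h4 : ∀ φ, fph w F φ * fph w H φ = ∑ ψ : Fin F.ne ⊕ Fin H.ne → Fin n,
      if (fun j => ψ (Sum.inl (F.edge j))) = φ then
        if ∀ a b, glueSetoid F H a b → ψ a = ψ b then f ψ else 0 else 0 := by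
    intro φ
    rw [fph_eq_sum, fph_eq_sum, Finset.sum_mul_sum]
    refine (Fintype.sum_prod_type fun p : (Fin F.ne → Fin n) × (Fin H.ne → Fin n) =>
      (if ∀ j, p.1 (F.edge j) = φ j then
        ∏ v, w (∑ e, (F.inc e).count (Sum.inl v) • {p.1 e}) else 0) *
      if ∀ j, p.2 (H.edge j) = φ j then
        ∏ v, w (∑ e, (H.inc e).count (Sum.inl v) • {p.2 e}) else 0).symm.trans
      (Fintype.sum_equiv (Equiv.sumArrowEquivProdArrow _ _ (Fin n)).symm _ _ fun p => ?_)
    obtain ⟨ψ₁, ψ₂⟩ := p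
    have hcst := const_on_glueSetoid_iff F H (Sum.elim ψ₁ ψ₂)
    have hf' := hf (Sum.elim ψ₁ ψ₂)
    change _ = if (fun j => ψ₁ (F.edge j)) = φ then
      (if ∀ a b, glueSetoid F H a b → Sum.elim ψ₁ ψ₂ a = Sum.elim ψ₁ ψ₂ b then
        f (Sum.elim ψ₁ ψ₂) else 0) else 0
    rw [hf']
    simp only [Sum.elim_inl, Sum.elim_inr] at hcst ⊢
    by_cases h5 : ∀ j, ψ₁ (F.edge j) = φ j
    · obtain rfl : (fun j => ψ₁ (F.edge j)) = φ := funext h5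
      by_cases h6 : ∀ j, ψ₂ (H.edge j) = ψ₁ (F.edge j)
      · rw [if_pos fun _ => rfl, if_pos h6, if_pos rfl]
        exact (@if_pos _ (_) (hcst.2 h6) _ _ _).symm
      · rw [if_neg h6, mul_zero, if_pos rfl]
        exact (@if_neg _ (_) (fun h7 => h6 (hcst.1 h7)) _ _ _).symm
    · rw [if_neg h5, zero_mul, if_neg]
      exact fun h => h5 (congrFun h)
  refine Eq.trans ?_ ((Fintype.sum_congr _ _ h4).trans Finset.sum_comm).symm
  refine Finset.sum_congr (Finset.ext fun _ => iff_of_true (@Finset.mem_univ _ (_) _)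
    (@Finset.mem_univ _ (_) _)) fun ψ _ => ?_
  rw [Finset.sum_ite_eq, if_pos (Finset.mem_univ _)]
  congr!

theorem partitionFun_glue {𝔽 : Type} [Field 𝔽] (h : VertexModel 𝔽 n) :
    partitionFun h (glue F H) = tpair (ph h F) (ph h H) := by
  rw [partitionFun_eq_fph h _ Fin.elim0, fph_glue, ph_eq_fph, ph_eq_fph]
  rfl

end Glue

end

noncomputable section

open scoped Classical

/-! ### Tensors indexed by finite types -/

section Tensors

variable {n : ℕ} {S : Type} [CommRing S] {ι κ μ : Type} [Fintype ι] [Fintype κ] [Fintype μ]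

/-- The standard bilinear pairing of tensors. -/
def pairing (t u : (ι → Fin n) → S) : S := ∑ φ, t φ * u φ

theorem pairing_eq [Fintype (ι → Fin n)] (t u : (ι → Fin n) → S) :
    pairing t u = ∑ φ, t φ * u φ := by
  unfold pairing
  congr!

/-- Tensor product. -/
def otimes {ι κ : Type} (t : (ι → Fin n) → S) (u : (κ → Fin n) → S) : (ι ⊕ κ → Fin n) → S :=
  fun φ => t (fun i => φ (Sum.inl i)) * u fun i => φ (Sum.inr i)

/-- Relabelling of tensor factors. -/
def relabel {ι κ : Type} (e : ι ≃ κ) : ((ι → Fin n) → S) →ₗ[S] ((κ → Fin n) → S) where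
  toFun t := fun φ => t (φ ∘ e)
  map_add' _ _ := rfl
  map_smul' _ _ := rfl

theorem relabel_apply {ι κ : Type} (e : ι ≃ κ) (t : (ι → Fin n) → S) (φ : κ → Fin n) :
    relabel e t φ = t (φ ∘ e) := rfl

/-- Contraction of a tensor against another one. -/
def plug {ι : Type} (a : (ι ⊕ κ → Fin n) → S) (t : (κ → Fin n) → S) : (ι → Fin n) → S :=
  fun φ => pairing (fun c => a (Sum.elim φ c)) t

/-- The diagonal action of a matrix on tensors. -/
def act (g : Matrix (Fin n) (Fin n) S) (t : (ι → Fin n) → S) : (ι → Fin n) → S :=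
  fun φ => pairing (fun ψ => ∏ i, g (φ i) (ψ i)) t

theorem act_eq [Fintype (ι → Fin n)] (g : Matrix (Fin n) (Fin n) S) (t : (ι → Fin n) → S)
    (φ : ι → Fin n) : act g t φ = ∑ ψ, (∏ i, g (φ i) (ψ i)) * t ψ := pairing_eq _ _

theorem pairing_comm (t u : (ι → Fin n) → S) : pairing t u = pairing u t :=
  Finset.sum_congr rfl fun _ _ => mul_comm _ _

theorem pairing_add_left (t t' u : (ι → Fin n) → S) :
    pairing (t + t') u = pairing t u + pairing t' u := by
  simp [pairing, add_mul, Finset.sum_add_distrib]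

theorem pairing_smul_left (a : S) (t u : (ι → Fin n) → S) :
    pairing (a • t) u = a * pairing t u := by
  simp [pairing, Finset.mul_sum, mul_assoc]

theorem pairing_add_right (t u u' : (ι → Fin n) → S) :
    pairing t (u + u') = pairing t u + pairing t u' := by
  simp [pairing, mul_add, Finset.sum_add_distrib]

theorem pairing_smul_right (a : S) (t u : (ι → Fin n) → S) :
    pairing t (a • u) = a * pairing t u := by
  rw [pairing_comm, pairing_smul_left, pairing_comm]

/-- The pairing as a bilinear form. -/
def pairingForm (S : Type) [CommRing S] (n : ℕ) (ι : Type) [Fintype ι] :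
    LinearMap.BilinForm S ((ι → Fin n) → S) :=
  LinearMap.mk₂ S pairing pairing_add_left pairing_smul_left pairing_add_right
    pairing_smul_right

theorem pairingForm_apply (t u : (ι → Fin n) → S) : pairingForm S n ι t u = pairing t u := rfl

theorem pairing_single_left (φ : ι → Fin n) (u : (ι → Fin n) → S) :
    pairing (Pi.single φ 1) u = u φ := by
  unfold pairing
  rw [Finset.sum_eq_single φ]
  · simp
  · intro ψ _ h
    simp [h]
  · simp

theorem sum_fun_sum {ι κ M : Type} [AddCommMonoid M] [Fintype (ι ⊕ κ → Fin n)]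
    [Fintype (ι → Fin n)] [Fintype (κ → Fin n)] (f : (ι ⊕ κ → Fin n) → M) :
    ∑ χ, f χ = ∑ φ : ι → Fin n, ∑ c : κ → Fin n, f (Sum.elim φ c) := by
  rw [← Fintype.sum_prod_type fun p : (ι → Fin n) × (κ → Fin n) => f (Sum.elim p.1 p.2)]
  refine Fintype.sum_equiv (Equiv.sumArrowEquivProdArrow ι κ (Fin n)) _ _ fun χ => ?_
  congr 1
  funext x
  rcases x with x | x <;> rfl

theorem pairing_sum_type (t u : (ι ⊕ κ → Fin n) → S) :
    pairing t u = ∑ φ : ι → Fin n, ∑ c : κ → Fin n, t (Sum.elim φ c) * u (Sum.elim φ c) := by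
  rw [pairing_eq]
  exact sum_fun_sum _

theorem pairing_otimes (t : (ι → Fin n) → S) (u : (κ → Fin n) → S) (a : (ι ⊕ κ → Fin n) → S) :
    pairing (otimes t u) a = pairing t (plug a u) := by
  rw [pairing_sum_type]
  refine Finset.sum_congr rfl fun φ _ => ?_
  unfold plug pairing
  rw [Finset.mul_sum]
  refine Finset.sum_congr rfl fun c _ => ?_
  simp only [otimes, Sum.elim_inl, Sum.elim_inr]
  ring

theorem pairing_relabel (e : ι ≃ κ) (t u : (ι → Fin n) → S) :
    pairing (relabel e t) (relabel e u) = pairing t u := by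
  unfold pairing
  refine Fintype.sum_equiv (Equiv.arrowCongr e.symm (Equiv.refl _)) _ _ fun φ => ?_
  rfl

theorem pairing_relabel_left (e : ι ≃ κ) (t : (ι → Fin n) → S) (u : (κ → Fin n) → S) :
    pairing (relabel e t) u = pairing t (relabel e.symm u) := by
  rw [← pairing_relabel e]
  congr 1
  funext φ
  simp [relabel_apply, Function.comp_assoc]

theorem act_relabel (g : Matrix (Fin n) (Fin n) S) (e : ι ≃ κ) (t : (ι → Fin n) → S) :
    act g (relabel e t) = relabel e (act g t) := by
  funext φ
  rw [relabel_apply]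
  unfold act
  rw [pairing_comm, pairing_relabel_left, pairing_comm]
  congr 1
  funext ψ
  rw [relabel_apply]
  refine (Fintype.prod_equiv e _ _ fun i => ?_).symm
  simp

theorem act_sum_type (g : Matrix (Fin n) (Fin n) S) (t : (ι ⊕ κ → Fin n) → S)
    (φ : ι → Fin n) (c : κ → Fin n) :
    act g t (Sum.elim φ c) = act g (fun d => act g (fun ψ => t (Sum.elim ψ d)) φ) c := by
  unfold act
  rw [pairing_sum_type, Finset.sum_comm]
  unfold pairing
  refine Finset.sum_congr rfl fun d _ => ?_
  rw [Finset.mul_sum]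
  refine Finset.sum_congr rfl fun ψ _ => ?_
  simp only [Fintype.prod_sum_type, Sum.elim_inl, Sum.elim_inr]
  ring

theorem act_add (g : Matrix (Fin n) (Fin n) S) (t u : (ι → Fin n) → S) :
    act g (t + u) = act g t + act g u := funext fun _ => pairing_add_right _ _ _

theorem act_smul (g : Matrix (Fin n) (Fin n) S) (a : S) (t : (ι → Fin n) → S) :
    act g (a • t) = a • act g t := funext fun _ => pairing_smul_right _ _ _

/-- The action of a matrix as a linear map. -/
def actLin (g : Matrix (Fin n) (Fin n) S) : ((ι → Fin n) → S) →ₗ[S] ((ι → Fin n) → S) where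
  toFun := act g
  map_add' := act_add g
  map_smul' := act_smul g

theorem act_otimes (g : Matrix (Fin n) (Fin n) S) (t : (ι → Fin n) → S) (u : (κ → Fin n) → S) :
    act g (otimes t u) = otimes (act g t) (act g u) := by
  funext χ
  obtain ⟨φ, c, rfl⟩ : ∃ φ c, χ = Sum.elim φ c :=
    ⟨fun i => χ (Sum.inl i), fun i => χ (Sum.inr i), by funext x; rcases x with x | x <;> rfl⟩
  rw [act_sum_type]
  have h : (fun d => act g (fun ψ => otimes t u (Sum.elim ψ d)) φ) = act g t φ • u := by
    funext d
    change act g (fun ψ => t ψ * u d) φ = act g t φ * u d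
    unfold act pairing
    rw [Finset.sum_mul]
    exact Finset.sum_congr rfl fun ψ _ => by ring
  rw [h, act_smul]
  rfl

theorem act_mul (g g' : Matrix (Fin n) (Fin n) S) (t : (ι → Fin n) → S) :
    act (g * g') t = act g (act g' t) := by
  funext φ
  unfold act pairing
  simp only [Finset.mul_sum, Matrix.mul_apply]
  rw [Finset.sum_comm]
  refine Finset.sum_congr rfl fun ψ _ => ?_
  rw [Finset.prod_univ_sum, Finset.sum_mul, Fintype.piFinset_univ]
  refine Finset.sum_congr rfl fun χ _ => ?_
  rw [Finset.prod_mul_distrib]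
  ring

theorem act_one (t : (ι → Fin n) → S) : act 1 t = t := by
  funext φ
  have h : (fun ψ : ι → Fin n => ∏ i, (1 : Matrix (Fin n) (Fin n) S) (φ i) (ψ i))
      = Pi.single φ 1 := by
    funext ψ
    by_cases hψ : ψ = φ
    · subst hψ
      simp
    · rw [Pi.single_eq_of_ne hψ]
      obtain ⟨i, hi⟩ := Function.ne_iff.1 hψ
      exact Finset.prod_eq_zero (Finset.mem_univ i) (Matrix.one_apply_ne (Ne.symm hi))
  unfold act
  rw [h, pairing_single_left]

theorem pairing_act (g : Matrix (Fin n) (Fin n) S) (t u : (ι → Fin n) → S) :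
    pairing (act g t) u = pairing t (act g.transpose u) := by
  unfold act pairing
  simp only [Finset.mul_sum, Finset.sum_mul, Matrix.transpose_apply]
  rw [Finset.sum_comm]
  exact Finset.sum_congr rfl fun _ _ => Finset.sum_congr rfl fun _ _ => by ring

theorem pairing_act_act {g : Matrix (Fin n) (Fin n) S} (hg : g.transpose * g = 1)
    (t u : (ι → Fin n) → S) : pairing (act g t) (act g u) = pairing t u := by
  rw [pairing_act, ← act_mul, hg, act_one]

theorem act_plug {g : Matrix (Fin n) (Fin n) S} (hg : g.transpose * g = 1)
    (a : (ι ⊕ κ → Fin n) → S) (t : (κ → Fin n) → S) :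
    plug (act g a) (act g t) = act g (plug a t) := by
  funext φ
  unfold plug
  simp only [act_sum_type]
  refine (pairing_act_act hg (fun d => act g (fun ψ => a (Sum.elim ψ d)) φ) t).trans ?_
  unfold act pairing
  simp only [Finset.mul_sum, Finset.sum_mul]
  rw [Finset.sum_comm]
  exact Finset.sum_congr rfl fun _ _ => Finset.sum_congr rfl fun _ _ => by ring

theorem map_pairing {T : Type} [CommRing T] (f : S →+* T) (t u : (ι → Fin n) → S) :
    f (pairing t u) = pairing (fun φ => f (t φ)) fun φ => f (u φ) := by
  simp [pairing]

theorem map_act {T : Type} [CommRing T] (f : S →+* T) (g : Matrix (Fin n) (Fin n) S)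
    (t : (ι → Fin n) → S) (φ : ι → Fin n) :
    f (act g t φ) = act (g.map f) (fun φ => f (t φ)) φ := by
  unfold act
  rw [map_pairing]
  simp

end Tensors

/-! ### Equivariance of the tensors of networks -/

section Equivariance

variable {n : ℕ} {S : Type} [CommRing S]

theorem prod_univ_sum_univ {E : Type} {Y : E → Type} [Fintype E] [∀ e, Fintype (Y e)]
    [Fintype (∀ e, Y e)] (f : ∀ e, Y e → S) :
    ∏ e, ∑ y, f e y = ∑ x : ∀ e, Y e, ∏ e, f e (x e) := by
  rw [Finset.prod_univ_sum, Fintype.piFinset_univ]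
  congr!

/-- The product of tensors living on the fibres of a map. -/
def fibreProd {X E : Type} [Fintype E] (p : X → E)
    (T : ∀ e, ({x // p x = e} → Fin n) → S) (χ : X → Fin n) : S :=
  ∏ e, T e fun x => χ x.1

theorem act_fibreProd {X E : Type} [Fintype X] [Fintype E] (p : X → E)
    (T : ∀ e, ({x // p x = e} → Fin n) → S) (g : Matrix (Fin n) (Fin n) S) :
    act g (fibreProd p T) = fibreProd p fun e => act g (T e) := by
  funext χ
  have h := prod_univ_sum_univ fun e (y : {x // p x = e} → Fin n) =>
    (∏ i, g (χ i.1) (y i)) * T e y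
  unfold fibreProd
  simp only [act_eq]
  rw [h]
  let σ : (X → Fin n) ≃ ∀ e, {x // p x = e} → Fin n :=
    (Equiv.arrowCongr (Equiv.sigmaFiberEquiv p).symm
      (Equiv.refl (Fin n))).trans (Equiv.piCurry fun _ _ => Fin n)
  refine Fintype.sum_equiv σ _ _ fun ψ => ?_
  rw [Finset.prod_mul_distrib]
  congr 1
  rw [← Equiv.prod_comp (Equiv.sigmaFiberEquiv p), Fintype.prod_sigma]
  rfl

/-- The tensor forcing all tensor factors to be equal. -/
def eqTensor (S : Type) [CommRing S] (n : ℕ) (ι : Type) [Fintype ι] (χ : ι → Fin n) : S :=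
  ∑ a, ∏ i, if χ i = a then 1 else 0

theorem relabel_eqTensor {ι κ : Type} [Fintype ι] [Fintype κ] (e : ι ≃ κ) :
    relabel e (eqTensor S n ι) = eqTensor S n κ := by
  funext χ
  rw [relabel_apply]
  unfold eqTensor
  exact Finset.sum_congr rfl fun a _ => Fintype.prod_equiv e _ _ fun i => rfl

theorem act_eqTensor {ι : Type} [Fintype ι] (hι : Nat.card ι = 2 ∨ Nat.card ι = 0)
    {g : Matrix (Fin n) (Fin n) S} (hg : g * g.transpose = 1) :
    act g (eqTensor S n ι) = eqTensor S n ι := by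
  rcases hι with hι | hι
  · have e : ι ≃ Unit ⊕ Unit := Fintype.equivOfCardEq (by
      rw [← Nat.card_eq_fintype_card, hι]
      simp)
    have h1 : act g (eqTensor S n (Unit ⊕ Unit)) = eqTensor S n (Unit ⊕ Unit) := by
      funext χ
      have h2 := congrFun (congrFun hg (χ (Sum.inl ()))) (χ (Sum.inr ()))
      rw [Matrix.mul_apply] at h2
      have h3 : ∀ χ : Unit ⊕ Unit → Fin n, eqTensor S n (Unit ⊕ Unit) χ
          = (1 : Matrix (Fin n) (Fin n) S) (χ (Sum.inl ())) (χ (Sum.inr ())) := by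
        intro χ
        unfold eqTensor
        simp [Matrix.one_apply, eq_comm]
      rw [h3, ← h2]
      rw [act_eq, sum_fun_sum]
      simp only [h3]
      refine Fintype.sum_equiv (Equiv.funUnique Unit (Fin n)) _
        (fun j => g (χ (Sum.inl ())) j * g.transpose j (χ (Sum.inr ()))) fun x => ?_
      rw [Fintype.sum_eq_single x]
      · rw [Sum.elim_inl, Sum.elim_inr, Matrix.one_apply_eq, mul_one, Fintype.prod_sum_type]
        simp
      · intro y hy
        rw [Sum.elim_inl, Sum.elim_inr, Matrix.one_apply_ne, mul_zero]
        exact fun h => hy (funext fun _ => h.symm)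
    rw [← relabel_eqTensor e.symm, act_relabel, h1]
  · have : IsEmpty ι := by
      rcases Finite.card_eq_zero_iff.1 hι with h
      exact h
    funext χ
    rw [act_eq, Fintype.sum_unique]
    simp [Subsingleton.elim χ default]

namespace Net

variable {ι : Type} [Fintype ι]

/-- The tensor of all vertices of a network. -/
def vertexTensor (N : Net ι) (w : Multiset (Fin n) → S) : (N.H → Fin n) → S :=
  fibreProd N.vtx fun _ c => w (values c)

/-- The tensor of all edges of a network. -/
def edgeTensor (N : Net ι) : (ι ⊕ N.H → Fin n) → S :=
  fibreProd (fun x => N.link (Equiv.sumComm ι N.H x)) fun _ => eqTensor S n _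

theorem val_eq_plug (N : Net ι) (w : Multiset (Fin n) → S) :
    N.val w = plug N.edgeTensor (N.vertexTensor w) := by
  have h1 : ∀ χ : ι ⊕ N.H → Fin n, N.edgeTensor χ
      = ∑ ψ : N.E → Fin n, if χ = fun x => ψ (N.link (Equiv.sumComm ι N.H x)) then (1 : S)
        else 0 := by
    intro χ
    unfold edgeTensor fibreProd eqTensor
    rw [prod_univ_sum_univ]
    refine Finset.sum_congr rfl fun ψ _ => ?_
    rw [← Fintype.prod_sigma fun x : Σ e, {x // N.link (Equiv.sumComm ι N.H x) = e} =>
      if χ x.2.1 = ψ x.1 then (1 : S) else 0]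
    rw [← Equiv.prod_comp (Equiv.sigmaFiberEquiv _).symm]
    rw [Finset.prod_ite_zero]
    simp only [Finset.mem_univ, true_imp_iff, Finset.prod_const_one, funext_iff]
    congr!
  funext φ
  unfold plug
  rw [pairing_eq]
  simp only [h1, Finset.sum_mul]
  rw [Finset.sum_comm]
  refine Finset.sum_congr rfl fun ψ _ => ?_
  rw [Fintype.sum_eq_single fun x => ψ (N.link (Sum.inl x))]
  · by_cases h : ∀ j, ψ (N.link (Sum.inr j)) = φ j
    · rw [if_pos h, if_pos, one_mul]
      · rfl
      · funext x
        rcases x with x | x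
        · exact (h x).symm
        · rfl
    · rw [if_neg h, if_neg, zero_mul]
      exact fun h2 => h fun j => (congrFun h2 (Sum.inl j)).symm
  · intro c hc
    rw [if_neg, zero_mul]
    exact fun h2 => hc (funext fun x => congrFun h2 (Sum.inr x))

theorem act_edgeTensor (N : Net ι) {g : Matrix (Fin n) (Fin n) S} (hg : g * g.transpose = 1) :
    act g (N.edgeTensor : (ι ⊕ N.H → Fin n) → S) = N.edgeTensor := by
  unfold edgeTensor
  rw [act_fibreProd]
  congr 1
  funext e
  refine act_eqTensor ?_ hg
  have : Nat.card {x // N.link (Equiv.sumComm ι N.H x) = e} = Nat.card {x // N.link x = e} :=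
    Nat.card_congr ((Equiv.sumComm ι N.H).subtypeEquiv fun x => Iff.rfl)
  rw [this]
  exact N.card_link e

/-- Transforming the vertex weights by an orthogonal matrix transforms the tensors of all
networks. -/
theorem val_eq_act (N : Net ι) {w w' : Multiset (Fin n) → S} {g : Matrix (Fin n) (Fin n) S}
    (hg : g.transpose * g = 1)
    (hw : ∀ (κ : Type) [Fintype κ], (fun c : κ → Fin n => w' (values c))
      = act g fun c => w (values c)) : N.val w' = act g (N.val w) := by
  have h1 : N.vertexTensor w' = act g (N.vertexTensor w) := by
    unfold vertexTensor
    rw [act_fibreProd]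
    congr 1
    funext v
    exact hw _
  rw [val_eq_plug, val_eq_plug, h1, ← act_plug hg, act_edgeTensor N (mul_eq_one_comm.1 hg)]

theorem val_map {ι T : Type} [CommRing T] (f : S →+* T) (N : Net ι)
    (w : Multiset (Fin n) → S) (φ : ι → Fin n) : f (N.val w φ) = N.val (fun s => f (w s)) φ := by
  unfold val
  rw [map_sum]
  refine Finset.sum_congr rfl fun ψ _ => ?_
  rw [apply_ite f, map_prod, map_zero]

end Net

end Equivariance

end

noncomputable section

open scoped Classical

/-! ### Spans of tensors of networks -/

section NetSpan

variable {n : ℕ} {K : Type} [Field K] {w : Multiset (Fin n) → K} {D : ℕ → Prop} {ι κ : Type}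

/-- The span of the tensors of networks all of whose vertex degrees satisfy `D`. -/
def netSpan (w : Multiset (Fin n) → K) (D : ℕ → Prop) (ι : Type) :
    Submodule K ((ι → Fin n) → K) :=
  Submodule.span K {t | ∃ N : Net ι, (∀ v, D (N.deg v)) ∧ N.val w = t}

theorem Net.val_mem_netSpan (N : Net ι) (hN : ∀ v, D (N.deg v)) : N.val w ∈ netSpan w D ι :=
  Submodule.subset_span ⟨N, hN, rfl⟩

theorem netSpan_mono {D' : ℕ → Prop} (h : ∀ d, D d → D' d) : netSpan w D ι ≤ netSpan w D' ι := by
  refine Submodule.span_mono ?_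
  rintro _ ⟨N, hN, rfl⟩
  exact ⟨N, fun v => h _ (hN v), rfl⟩

/-- A linear map sends the span of networks into a submodule as soon as it does so on networks. -/
theorem netSpan_induction {M : Type} [AddCommGroup M] [Module K M]
    (f : ((ι → Fin n) → K) →ₗ[K] M) (p : Submodule K M)
    (h : ∀ N : Net ι, (∀ v, D (N.deg v)) → f (N.val w) ∈ p) {t : (ι → Fin n) → K}
    (ht : t ∈ netSpan w D ι) : f t ∈ p := by
  have : netSpan w D ι ≤ p.comap f := by
    refine Submodule.span_le.2 ?_
    rintro _ ⟨N, hN, rfl⟩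
    exact h N hN
  exact this ht

theorem relabel_mem_netSpan (e : ι ≃ κ) {t : (ι → Fin n) → K} (ht : t ∈ netSpan w D ι) :
    relabel e t ∈ netSpan w D κ := by
  refine netSpan_induction (relabel e) _ (fun N hN => ?_) ht
  have : relabel e (N.val w) = (N.reindex e).val w := funext fun φ => (N.val_reindex e w φ).symm
  rw [this]
  exact Net.val_mem_netSpan _ hN

/-- The tensor product as a bilinear map. -/
def otimesLin (S : Type) [CommRing S] (n : ℕ) (ι κ : Type) : ((ι → Fin n) → S) →ₗ[S]
    ((κ → Fin n) → S) →ₗ[S] ((ι ⊕ κ → Fin n) → S) :=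
  LinearMap.mk₂ S otimes
    (fun _ _ _ => funext fun _ => add_mul _ _ _) (fun _ _ _ => funext fun _ => mul_assoc _ _ _)
    (fun _ _ _ => funext fun _ => mul_add _ _ _)
    (fun _ _ _ => funext fun _ => mul_left_comm _ _ _)

theorem otimes_mem_netSpan {t : (ι → Fin n) → K} {u : (κ → Fin n) → K}
    (ht : t ∈ netSpan w D ι) (hu : u ∈ netSpan w D κ) :
    otimes t u ∈ netSpan w D (ι ⊕ κ) := by
  refine netSpan_induction ((otimesLin K n ι κ).flip u) _ (fun N hN => ?_) ht
  refine netSpan_induction (otimesLin K n ι κ (N.val w)) _ (fun M hM => ?_) hu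
  have : otimesLin K n ι κ (N.val w) (M.val w) = (N.mul M).val w :=
    funext fun φ => (N.val_mul M w φ).symm
  rw [this]
  refine Net.val_mem_netSpan _ ?_
  rintro (v | v)
  · exact (Net.deg_mul_inl N M v).symm ▸ hN v
  · exact (Net.deg_mul_inr N M v).symm ▸ hM v

variable [Fintype ι] [Fintype κ]

/-- Contraction of tensor factors in pairs. -/
def contr (S : Type) [CommRing S] (n : ℕ) (ι κ : Type) [Fintype κ] :
    ((ι ⊕ (κ ⊕ κ) → Fin n) → S) →ₗ[S] ((ι → Fin n) → S) where
  toFun t := fun φ => ∑ c : κ → Fin n, t (Sum.elim φ (Sum.elim c c))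
  map_add' _ _ := funext fun _ => Finset.sum_add_distrib
  map_smul' _ _ := funext fun _ => (Finset.mul_sum _ _ _).symm

theorem contr_mem_netSpan {t : (ι ⊕ (κ ⊕ κ) → Fin n) → K}
    (ht : t ∈ netSpan w D (ι ⊕ (κ ⊕ κ))) : contr K n ι κ t ∈ netSpan w D ι := by
  refine netSpan_induction (contr K n ι κ) _ (fun N hN => ?_) ht
  have : contr K n ι κ (N.val w) = N.contract.val w :=
    funext fun φ => (N.val_contract w φ).symm
  rw [this]
  exact Net.val_mem_netSpan _ hN

theorem plug_eq_contr {ι : Type} (a : (ι ⊕ κ → Fin n) → K) (t : (κ → Fin n) → K) :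
    plug a t = contr K n ι κ (relabel (Equiv.sumAssoc ι κ κ) (otimes a t)) := by
  funext φ
  unfold plug pairing
  change _ = ∑ c : κ → Fin n, _
  refine Finset.sum_congr rfl fun c _ => ?_
  rw [relabel_apply]
  unfold otimes
  refine congrArg (· * t c) (congrArg a (funext fun x => ?_))
  rcases x with x | x <;> rfl

theorem plug_mem_netSpan {a : (ι ⊕ κ → Fin n) → K} {t : (κ → Fin n) → K}
    (ha : a ∈ netSpan w D (ι ⊕ κ)) (ht : t ∈ netSpan w D κ) : plug a t ∈ netSpan w D ι := by
  rw [plug_eq_contr]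
  exact contr_mem_netSpan (relabel_mem_netSpan _ (otimes_mem_netSpan ha ht))

theorem Net.val_eq {ι : Type} (N : Net ι) (i : Fintype (N.E → Fin n)) (w : Multiset (Fin n) → K)
    (φ : ι → Fin n) : N.val w φ = ∑ ψ : N.E → Fin n,
      if ∀ j, ψ (N.link (Sum.inr j)) = φ j then ∏ v, w (N.col ψ v) else 0 := by
  unfold Net.val
  congr!

theorem one_mem_netSpan {ι : Type} [IsEmpty ι] : (fun _ => 1) ∈ netSpan w D ι := by
  let N : Net ι :=
    { V := Empty, H := Empty, E := Empty, fintypeV := inferInstance, fintypeH := inferInstance,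
      fintypeE := inferInstance, vtx := id, link := Sum.elim id isEmptyElim, card_link := nofun }
  have : N.val w = fun _ => 1 := by
    funext φ
    rw [N.val_eq (inferInstanceAs (Fintype (Empty → Fin n)))]
    refine (Fintype.sum_subsingleton (ι := Empty → Fin n) _ (fun x => nomatch x)).trans ?_
    exact (@if_pos _ (_) (fun j => isEmptyElim j) _ _ _).trans Finset.prod_empty
  exact this ▸ N.val_mem_netSpan nofun

/-- The tensor of the identity matrix. -/
def metric (S : Type) [CommRing S] (n : ℕ) : (Bool → Fin n) → S :=
  fun φ => (1 : Matrix (Fin n) (Fin n) S) (φ true) (φ false)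

theorem metric_mem_netSpan : metric K n ∈ netSpan w D Bool := by
  let N : Net Bool :=
    { V := Empty, H := Empty, E := Unit, fintypeV := inferInstance, fintypeH := inferInstance,
      fintypeE := inferInstance, vtx := id, link := fun _ => (),
      card_link := fun e => Or.inl (by
        have : Nat.card {x : Empty ⊕ Bool // () = e} = Nat.card (Empty ⊕ Bool) :=
          Nat.card_congr (Equiv.subtypeUnivEquiv fun _ => rfl)
        rw [this]
        simp) }
  have : N.val w = metric K n := by
    funext φ
    rw [N.val_eq (inferInstanceAs (Fintype (Unit → Fin n)))]
    unfold metric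
    refine (Fintype.sum_equiv (Equiv.funUnique Unit (Fin n)) _
      (fun a => if a = φ true ∧ a = φ false then (1 : K) else 0) fun ψ => ?_).trans ?_
    · refine ite_congr_of_iff ?_ Finset.prod_empty
      exact ⟨fun h => ⟨h true, h false⟩, fun h b => by cases b; exacts [h.2, h.1]⟩
    · rw [Matrix.one_apply]
      simp only [ite_and]
      rw [Finset.sum_ite_eq']
      simp
  exact this ▸ N.val_mem_netSpan nofun

/-- The network with a single vertex attached to all open ends. -/
theorem exists_net_basic (K : Type) [Field K] (n : ℕ) (ι : Type) [Fintype ι] :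
    ∃ N : Net ι, (∀ v, N.deg v = Fintype.card ι) ∧ ∀ w : Multiset (Fin n) → K,
      N.val w = fun φ => w (values φ) := by
  let N : Net ι :=
    { V := Unit, H := ι, E := ι, fintypeV := inferInstance, fintypeH := inferInstance,
      fintypeE := inferInstance, vtx := fun _ => (), link := Sum.elim id id,
      card_link := fun e => Or.inl (by
        rw [Net.natCard_subtype_eq, Fintype.sum_sum_type]
        exact congrArg₂ (· + ·)
          ((Fintype.sum_eq_single e fun _ hx => if_neg hx).trans (if_pos rfl))
          ((Fintype.sum_eq_single e fun _ hx => if_neg hx).trans (if_pos rfl))) }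
  let e : {_x : ι // () = ()} ≃ ι := Equiv.subtypeUnivEquiv fun _ => rfl
  have h1 : ∀ v : Unit, N.deg v = Fintype.card ι := fun v =>
    @Fintype.card_congr _ _ (_) (_) e
  have (w : Multiset (Fin n) → K) : N.val w = fun φ : ι → Fin n => w (values φ) := by
    funext φ
    unfold Net.val
    refine (Fintype.sum_eq_single (α := ι → Fin n) φ fun ψ hψ =>
      if_neg fun h => hψ (funext h)).trans ?_
    refine (@if_pos _ (_) (fun _ => rfl) _ _ _).trans ?_
    refine (Fintype.prod_unique (ι := Unit) _).trans (congrArg w ?_)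
    exact @values_comp_equiv _ _ _ (_) (_) e φ
  exact ⟨N, h1, this⟩

theorem basic_mem_netSpan (h : D (Fintype.card ι)) :
    (fun φ : ι → Fin n => w (values φ)) ∈ netSpan w D ι := by
  obtain ⟨N, hN, hv⟩ := exists_net_basic K n ι
  exact hv w ▸ N.val_mem_netSpan fun v => (hN v).symm ▸ h

theorem netSpan_fin (k : ℕ) : netSpan w (fun _ => True) (Fin k)
    = Submodule.span K (Set.range fun F : Fragment k => fph w F) := by
  refine congrArg _ (Set.ext fun t => ⟨?_, ?_⟩)
  · rintro ⟨N, -, rfl⟩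
    exact ⟨N.toFragment, N.fph_toFragment w⟩
  · rintro ⟨F, rfl⟩
    exact ⟨F.toNet, fun _ => trivial, F.val_toNet w⟩

/-- Invariance of the span of networks under an orthogonal matrix preserving the weights. -/
theorem act_eq_of_mem_netSpan {g : Matrix (Fin n) (Fin n) K} (hg : g.transpose * g = 1)
    (hw : ∀ (κ : Type) [Fintype κ], (fun c : κ → Fin n => w (values c))
      = act g fun c => w (values c)) {t : (ι → Fin n) → K} (ht : t ∈ netSpan w D ι) :
    act g t = t := by
  have := netSpan_induction (actLin g - LinearMap.id) ⊥ (fun N hN => ?_) ht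
  · exact sub_eq_zero.1 ((Submodule.mem_bot K).1 this)
  · exact sub_eq_zero.2 (N.val_eq_act hg hw).symm

end NetSpan

end

noncomputable section

open scoped Classical

/-! ### Orthogonal projection onto the span of networks -/

section Projection

variable {n : ℕ} {K : Type} [Field K] {w : Multiset (Fin n) → K} {D : ℕ → Prop}

/-- The pairing restricts to a nondegenerate form on each span of networks. -/
def NondegSpan (w : Multiset (Fin n) → K) (D : ℕ → Prop) : Prop :=
  ∀ (ι : Type) [Fintype ι], ∀ t ∈ netSpan w D ι, (∀ u ∈ netSpan w D ι, pairing t u = 0) → t = 0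

variable {ι κ : Type} [Fintype ι] [Fintype κ]

theorem NondegSpan.exists_proj (hA : NondegSpan w D) (ι : Type) [Fintype ι] :
    ∃ π : ((ι → Fin n) → K) →ₗ[K] ((ι → Fin n) → K),
      ∀ t, π t ∈ netSpan w D ι ∧ ∀ u ∈ netSpan w D ι, pairing (π t) u = pairing t u := by
  let A := netSpan w D ι
  let R : ((ι → Fin n) → K) →ₗ[K] Module.Dual K A := A.subtype.dualMap ∘ₗ pairingForm K n ι
  let e : A ≃ₗ[K] Module.Dual K A := LinearMap.linearEquivOfInjective (R ∘ₗ A.subtype)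
    ((injective_iff_map_eq_zero _).2 fun t ht => Subtype.ext (hA ι t t.2 fun u hu =>
      LinearMap.congr_fun ht ⟨u, hu⟩)) Subspace.dual_finrank_eq.symm
  refine ⟨A.subtype ∘ₗ e.symm.toLinearMap ∘ₗ R, fun t => ⟨(e.symm (R t)).2, fun u hu => ?_⟩⟩
  exact LinearMap.congr_fun (e.apply_symm_apply (R t)) ⟨u, hu⟩

/-- The orthogonal projection onto the span of networks. -/
def NondegSpan.proj (hA : NondegSpan w D) (ι : Type) [Fintype ι] :
    ((ι → Fin n) → K) →ₗ[K] ((ι → Fin n) → K) := (hA.exists_proj ι).choose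

theorem NondegSpan.proj_mem (hA : NondegSpan w D) (t : (ι → Fin n) → K) :
    hA.proj ι t ∈ netSpan w D ι := ((hA.exists_proj ι).choose_spec t).1

theorem NondegSpan.pairing_proj (hA : NondegSpan w D) (t : (ι → Fin n) → K)
    {u : (ι → Fin n) → K} (hu : u ∈ netSpan w D ι) : pairing (hA.proj ι t) u = pairing t u :=
  ((hA.exists_proj ι).choose_spec t).2 u hu

theorem NondegSpan.proj_eq (hA : NondegSpan w D) {t s : (ι → Fin n) → K}
    (hs : s ∈ netSpan w D ι) (h : ∀ u ∈ netSpan w D ι, pairing s u = pairing t u) :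
    hA.proj ι t = s := by
  refine sub_eq_zero.1 (hA ι _ (sub_mem (hA.proj_mem t) hs) fun u hu => ?_)
  rw [← pairingForm_apply, map_sub, LinearMap.sub_apply, pairingForm_apply, pairingForm_apply,
    hA.pairing_proj t hu, h u hu, sub_self]

theorem NondegSpan.proj_of_mem (hA : NondegSpan w D) {t : (ι → Fin n) → K}
    (ht : t ∈ netSpan w D ι) : hA.proj ι t = t := hA.proj_eq ht fun _ _ => rfl

theorem NondegSpan.proj_eq_zero (hA : NondegSpan w D) {t : (ι → Fin n) → K}
    (h : ∀ u ∈ netSpan w D ι, pairing t u = 0) : hA.proj ι t = 0 :=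
  hA.proj_eq (zero_mem _) fun u hu => by
    rw [h u hu, ← pairingForm_apply, map_zero, LinearMap.zero_apply]

theorem NondegSpan.proj_relabel (hA : NondegSpan w D) (e : ι ≃ κ) (t : (ι → Fin n) → K) :
    hA.proj κ (relabel e t) = relabel e (hA.proj ι t) := by
  refine hA.proj_eq (relabel_mem_netSpan e (hA.proj_mem t)) fun u hu => ?_
  rw [pairing_relabel_left, pairing_relabel_left]
  exact hA.pairing_proj t (relabel_mem_netSpan e.symm hu)

theorem NondegSpan.proj_otimes (hA : NondegSpan w D) (s : (ι → Fin n) → K)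
    {t : (κ → Fin n) → K} (ht : t ∈ netSpan w D κ) :
    hA.proj (ι ⊕ κ) (otimes s t) = otimes (hA.proj ι s) t := by
  refine hA.proj_eq (otimes_mem_netSpan (hA.proj_mem s) ht) fun u hu => ?_
  rw [pairing_otimes, pairing_otimes]
  exact hA.pairing_proj s (plug_mem_netSpan hu ht)

end Projection

/-! ### Generic transforms of tensors -/

section Generic

variable {n : ℕ} {K : Type} [Field K] {ι κ : Type} [Fintype ι] [Fintype κ]

/-- The generic matrix. -/
def genMat (K : Type) [Field K] (n : ℕ) :
    Matrix (Fin n) (Fin n) (MvPolynomial (Fin n × Fin n) K) := Matrix.of fun i j => X (i, j)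

/-- A coordinate of the transform of a tensor under the generic matrix. -/
def gen (t : (ι → Fin n) → K) (φ : ι → Fin n) : MvPolynomial (Fin n × Fin n) K :=
  act (genMat K n) (fun ψ => C (t ψ)) φ

/-- The coordinates of the generic transform depend linearly on the tensor. -/
def genLin (K : Type) [Field K] (φ : ι → Fin n) :
    ((ι → Fin n) → K) →ₗ[K] MvPolynomial (Fin n × Fin n) K where
  toFun t := gen t φ
  map_add' t u := by
    unfold gen
    rw [← Pi.add_apply (act _ _), ← act_add]
    refine congrFun (congrArg _ (funext fun ψ => ?_)) φ
    simp
  map_smul' a t := by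
    unfold gen
    rw [RingHom.id_apply, MvPolynomial.smul_eq_C_mul, ← smul_eq_mul, ← Pi.smul_apply, ← act_smul]
    refine congrFun (congrArg _ (funext fun ψ => ?_)) φ
    simp

theorem genLin_apply (t : (ι → Fin n) → K) (φ : ι → Fin n) : genLin K φ t = gen t φ := rfl

theorem gen_single (ψ φ : ι → Fin n) :
    gen (Pi.single ψ (1 : K)) φ = ∏ i, X (φ i, ψ i) := by
  unfold gen act
  rw [pairing_comm]
  have : (fun χ : ι → Fin n => (C ((Pi.single ψ (1 : K) : (ι → Fin n) → K) χ) :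
      MvPolynomial (Fin n × Fin n) K)) = Pi.single ψ 1 := by
    funext χ
    by_cases h : χ = ψ
    · subst h
      simp
    · simp [h]
  rw [this, pairing_single_left]
  rfl

theorem gen_otimes (t : (ι → Fin n) → K) (u : (κ → Fin n) → K) (φ : ι → Fin n)
    (c : κ → Fin n) : gen (otimes t u) (Sum.elim φ c) = gen t φ * gen u c := by
  unfold gen
  have : (fun χ => C (otimes t u χ) : (ι ⊕ κ → Fin n) → MvPolynomial (Fin n × Fin n) K)
      = otimes (fun ψ => C (t ψ)) fun ψ => C (u ψ) := funext fun χ => C_mul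
  rw [this, act_otimes]
  rfl

theorem gen_relabel (e : ι ≃ κ) (t : (ι → Fin n) → K) (φ : κ → Fin n) :
    gen (relabel e t) φ = gen t (φ ∘ e) := by
  unfold gen
  rw [← relabel_apply e (act _ _), ← act_relabel]
  congr 1

theorem map_gen {T : Type} [CommRing T] (f : MvPolynomial (Fin n × Fin n) K →+* T)
    (t : (ι → Fin n) → K) (φ : ι → Fin n) :
    f (gen t φ) = act ((genMat K n).map f) (fun ψ => f (C (t ψ))) φ := map_act f _ _ φ

theorem monomial_eq_prod_X {σ : Type} (c : ι → σ) :
    (∏ i, X (c i) : MvPolynomial σ K) = monomial (∑ i, Finsupp.single (c i) 1) 1 := by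
  rw [MvPolynomial.monomial_sum_one]
  rfl

theorem exists_monomial_eq {σ : Type} (s : σ →₀ ℕ) :
    ∃ (k : ℕ) (c : Fin k → σ), s = ∑ i, Finsupp.single (c i) 1 := by
  obtain ⟨c, hc⟩ := exists_values_eq (Finsupp.toMultiset s)
  refine ⟨_, c, ?_⟩
  refine (Finsupp.toMultiset_toFinsupp s).symm.trans ?_
  refine (congrArg Multiset.toFinsupp hc).symm.trans ?_
  rw [values_eq_sum, map_sum]
  simp

theorem exists_equiv_of_sum_single_eq {σ : Type} {c : ι → σ} {d : κ → σ}
    (h : ∑ i, Finsupp.single (c i) 1 = ∑ j, Finsupp.single (d j) 1) :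
    ∃ e : ι ≃ κ, ∀ x, d (e x) = c x := by
  apply exists_equiv_of_values_eq
  rw [values_eq_sum, values_eq_sum]
  have := congrArg Finsupp.toMultiset h
  simpa using this

/-- A linear functional on a polynomial ring in the coordinates vanishes, or more generally lies in
a subspace, as soon as this holds on generic transforms. -/
theorem gen_induction {M : Type} [AddCommGroup M] [Module K M]
    (f : MvPolynomial (Fin n × Fin n) K →ₗ[K] M) (p : Submodule K M)
    (h : ∀ (k : ℕ) (t : (Fin k → Fin n) → K) (φ : Fin k → Fin n), f (gen t φ) ∈ p)
    (q : MvPolynomial (Fin n × Fin n) K) : f q ∈ p := by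
  rw [q.as_sum, map_sum]
  refine sum_mem fun s _ => ?_
  rw [← mul_one (coeff s q), ← smul_eq_mul, ← smul_monomial, map_smul]
  refine p.smul_mem _ ?_
  obtain ⟨k, c, rfl⟩ := exists_monomial_eq s
  rw [← monomial_eq_prod_X]
  have := h k (Pi.single (fun i => (c i).2) 1) fun i => (c i).1
  rwa [gen_single] at this

/-- A natural family of linear maps on tensors defines a linear functional on polynomials. -/
theorem exists_functional (ρ : ∀ (ι : Type) [Fintype ι], ((ι → Fin n) → K) →ₗ[K]
      ((ι → Fin n) → K))
    (hρ : ∀ (ι κ : Type) [Fintype ι] [Fintype κ] (e : ι ≃ κ) (t : (ι → Fin n) → K),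
      ρ κ (relabel e t) = relabel e (ρ ι t)) :
    ∃ η : MvPolynomial (Fin n × Fin n) K →ₗ[K] K, ∀ (ι : Type) [Fintype ι]
      (t : (ι → Fin n) → K) (φ : ι → Fin n), η (gen t φ) = ρ ι t φ := by
  choose k c hc using fun s : (Fin n × Fin n) →₀ ℕ => exists_monomial_eq s
  let η : MvPolynomial (Fin n × Fin n) K →ₗ[K] K := (basisMonomials _ K).constr K fun s =>
    ρ (Fin (k s)) (Pi.single (fun i => (c s i).2) 1) fun i => (c s i).1
  refine ⟨η, fun ι _ t φ => ?_⟩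
  suffices h : η ∘ₗ genLin K φ = LinearMap.proj φ ∘ₗ ρ ι from LinearMap.congr_fun h t
  refine LinearMap.pi_ext' fun ψ => LinearMap.ext_ring ?_
  change η (gen (Pi.single ψ 1) φ) = ρ ι (Pi.single ψ 1) φ
  rw [gen_single, monomial_eq_prod_X]
  set s := ∑ i, Finsupp.single (φ i, ψ i) 1 with hs
  obtain ⟨e, he⟩ := exists_equiv_of_sum_single_eq (hs ▸ (hc s).symm)
  have h1 : η (monomial s 1) = ρ (Fin (k s)) (Pi.single (fun i => (c s i).2) 1)
      fun i => (c s i).1 := by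
    have := (basisMonomials (Fin n × Fin n) K).constr_basis K (fun s =>
      ρ (Fin (k s)) (Pi.single (fun i => (c s i).2) 1) fun i => (c s i).1) s
    rwa [coe_basisMonomials] at this
  have h2 : (fun i => (c s i).1) = φ ∘ e := funext fun i => (congrArg Prod.fst (he i)).symm
  have h3 : (fun i => (c s i).2) = ψ ∘ e := funext fun i => (congrArg Prod.snd (he i)).symm
  have h4 : relabel e (Pi.single (ψ ∘ e) (1 : K)) = Pi.single ψ 1 := by
    funext χ
    rw [relabel_apply]
    by_cases h : χ = ψ
    · rw [h]
      simp
    · rw [Pi.single_eq_of_ne h,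
        Pi.single_eq_of_ne fun h4 => h (e.surjective.injective_comp_right h4)]
  rw [h1, h2, h3, ← h4, hρ, relabel_apply]

theorem gen_one {ι : Type} [Fintype ι] [IsEmpty ι] (φ : ι → Fin n) :
    gen (fun _ : ι → Fin n => (1 : K)) φ = 1 := by
  have h : (fun _ : ι → Fin n => (1 : K)) = Pi.single φ 1 := by
    funext χ
    rw [Subsingleton.elim χ φ, Pi.single_eq_same]
  rw [h, gen_single, Finset.univ_eq_empty, Finset.prod_empty]

/-- The ideal of relations expressing the invariance of tensors of networks. -/
def relIdeal (w : Multiset (Fin n) → K) (D : ℕ → Prop) : Ideal (MvPolynomial (Fin n × Fin n) K) :=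
  Ideal.span {p | ∃ (ι : Type) (_ : Fintype ι), ∃ t ∈ netSpan w D ι, ∃ φ : ι → Fin n,
    p = gen t φ - C (t φ)}

theorem gen_sub_mem_relIdeal {w : Multiset (Fin n) → K} {D : ℕ → Prop} {t : (ι → Fin n) → K}
    (ht : t ∈ netSpan w D ι) (φ : ι → Fin n) : gen t φ - C (t φ) ∈ relIdeal w D :=
  Ideal.subset_span ⟨ι, _, t, ht, φ, rfl⟩

/-- The projection of tensors onto the span of networks defines a functional on polynomials which
vanishes on all relations. -/
theorem NondegSpan.exists_functional {w : Multiset (Fin n) → K} {D : ℕ → Prop}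
    (hA : NondegSpan w D) : ∃ η : MvPolynomial (Fin n × Fin n) K →ₗ[K] K,
      (∀ (ι : Type) [Fintype ι] (t : (ι → Fin n) → K) (φ : ι → Fin n),
        η (gen t φ) = hA.proj ι t φ) ∧ (∀ p ∈ relIdeal w D, η p = 0) ∧ η 1 = 1 := by
  obtain ⟨η, hη⟩ := VertexModels.exists_functional (fun ι _ => hA.proj ι)
    (fun ι κ _ _ e t => hA.proj_relabel e t)
  refine ⟨η, hη, fun p hp => ?_, ?_⟩
  · suffices h : ∀ q, η (q * p) = 0 by simpa using h 1
    refine Submodule.span_induction ?_ ?_ ?_ ?_ hp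
    · rintro _ ⟨ι, _, t, ht, φ, rfl⟩ q
      refine (Submodule.mem_bot K).1 (gen_induction
        (η ∘ₗ LinearMap.mulRight K (gen t φ - C (t φ))) ⊥ (fun k s χ => ?_) q)
      rw [Submodule.mem_bot, LinearMap.comp_apply, LinearMap.mulRight_apply, mul_sub, map_sub,
        ← gen_otimes, hη, hA.proj_otimes s ht, mul_comm, ← smul_eq_C_mul, map_smul, hη]
      change hA.proj (Fin k) s χ * t φ - t φ * hA.proj (Fin k) s χ = 0
      ring
    · simp
    · intro x y _ _ hx hy q
      rw [mul_add, map_add, hx, hy, add_zero]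
    · intro a x _ hx q
      rw [smul_eq_mul, ← mul_assoc]
      exact hx _
  · have h := hη Empty (fun _ => 1) fun x => nomatch x
    rwa [gen_one, hA.proj_of_mem one_mem_netSpan] at h

end Generic

end

noncomputable section

open scoped Classical

/-! ### The span of networks without vertices -/

section NoVertices

variable {n : ℕ} {K : Type} [Field K] {ι : Type}

theorem Net.exists_natCast_eq_val (N : Net ι) (hN : ∀ _ : N.V, False) :
    ∃ m : (ι → Fin n) → ℕ, ∀ (R : Type) [CommSemiring R] (w : Multiset (Fin n) → R)
      (φ : ι → Fin n), N.val w φ = m φ := by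
  have : IsEmpty N.V := ⟨hN⟩
  refine ⟨N.val fun _ => 1, fun R _ w φ => ?_⟩
  unfold Net.val
  simp only [Finset.univ_eq_empty, Finset.prod_empty, Finset.sum_boole, Nat.cast_id]

theorem nondegSpan_false [CharZero K] (w : Multiset (Fin n) → K) :
    NondegSpan w fun _ => False := by
  intro ι _ t ht horth
  let S : Submodule ℚ ((ι → Fin n) → ℚ) := Submodule.span ℚ
    {m | ∃ N : Net ι, (∀ _ : N.V, False) ∧ N.val (fun _ => 1) = m}
  have h1 : ∀ ℓ : K →ₗ[ℚ] ℚ, (fun φ => ℓ (t φ)) ∈ S := by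
    refine Submodule.span_induction ?_ ?_ ?_ ?_ ht
    · rintro _ ⟨N, hN, rfl⟩ ℓ
      obtain ⟨m, hm⟩ := N.exists_natCast_eq_val (n := n) hN
      have : (fun φ => ℓ (N.val w φ)) = ℓ 1 • N.val fun _ => (1 : ℚ) := by
        funext φ
        rw [Pi.smul_apply, hm, hm, ← nsmul_one, map_nsmul, nsmul_eq_mul, smul_eq_mul, mul_comm]
      rw [this]
      exact S.smul_mem _ (Submodule.subset_span ⟨N, hN, rfl⟩)
    · intro ℓ
      simp only [Pi.zero_apply, map_zero]
      exact S.zero_mem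
    · intro x y _ _ hx hy ℓ
      simp only [Pi.add_apply, map_add]
      exact S.add_mem (hx ℓ) (hy ℓ)
    · intro a x _ hx ℓ
      exact hx (ℓ ∘ₗ (LinearMap.mulLeft ℚ a))
  have h2 : ∀ (ℓ : K →ₗ[ℚ] ℚ), ∀ s ∈ S, pairing (fun φ => ℓ (t φ)) s = 0 := by
    intro ℓ s hs
    refine Submodule.span_induction ?_ ?_ ?_ ?_ hs
    · rintro _ ⟨N, hN, rfl⟩
      obtain ⟨m, hm⟩ := N.exists_natCast_eq_val (n := n) hN
      have h := congrArg ℓ (horth _ (N.val_mem_netSpan hN))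
      unfold pairing at h ⊢
      rw [map_zero, map_sum] at h
      rw [← h]
      refine Finset.sum_congr rfl fun φ _ => ?_
      rw [hm, hm, mul_comm, mul_comm (t φ), ← nsmul_eq_mul, ← nsmul_eq_mul, map_nsmul]
    · exact map_zero (pairingForm ℚ n ι _)
    · intro x y _ _ hx hy
      rw [pairing_add_right, hx, hy, add_zero]
    · intro a x _ hx
      rw [pairing_smul_right, hx, mul_zero]
  funext φ
  refine (Module.forall_dual_apply_eq_zero_iff ℚ (t φ)).1 fun ℓ => ?_
  have h := h2 ℓ _ (h1 ℓ)
  unfold pairing at h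
  rw [Finset.sum_eq_zero_iff_of_nonneg fun _ _ => mul_self_nonneg _] at h
  exact mul_self_eq_zero.1 (h φ (Finset.mem_univ _))

end NoVertices

end

noncomputable section

open scoped Classical

/-! ### Specialising the universal vertex weights -/

theorem act_metric {n : ℕ} {S : Type} [CommRing S] (g : Matrix (Fin n) (Fin n) S)
    (φ : Bool → Fin n) : act g (metric S n) φ = (g * g.transpose) (φ true) (φ false) := by
  have h := Fintype.sum_equiv (Equiv.boolArrowEquivProd (Fin n))
    (fun ψ : Bool → Fin n => (∏ i, g (φ i) (ψ i)) * metric S n ψ)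
    (fun p => g (φ true) p.2 * g (φ false) p.1 * if p.2 = p.1 then 1 else 0) fun ψ => by
      rw [Fintype.prod_bool]
      rfl
  rw [act_eq, h, Fintype.sum_prod_type_right, Matrix.mul_apply]
  refine Finset.sum_congr rfl fun i _ => ?_
  simp

section Universal

variable {n : ℕ} {K : Type} [Field K]

/-- The linear combination of fragment tensors attached to a formal linear combination of
fragments. -/
def fphL {R : Type} [CommRing R] [Algebra K R] (w : Multiset (Fin n) → R) {k : ℕ}
    (φ : Fin k → Fin n) : (Fragment k →₀ K) →ₗ[K] R :=
  Finsupp.linearCombination K fun F : Fragment k => fph w F φ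

theorem map_fphL {R T : Type} [CommRing R] [Algebra K R] [CommRing T] [Algebra K T]
    (f : R →ₐ[K] T) (w : Multiset (Fin n) → R) {k : ℕ} (φ : Fin k → Fin n)
    (γ : Fragment k →₀ K) : f (fphL w φ γ) = fphL (fun s => f (w s)) φ γ := by
  suffices H : f.toLinearMap ∘ₗ fphL w φ = fphL (fun s => f (w s)) φ from LinearMap.congr_fun H γ
  refine Finsupp.lhom_ext' fun F => LinearMap.ext_ring ?_
  change f (fphL w φ (Finsupp.single F 1)) = fphL _ φ (Finsupp.single F 1)
  unfold fphL
  rw [Finsupp.linearCombination_single, Finsupp.linearCombination_single, one_smul, one_smul,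
    ← F.val_toNet, ← F.val_toNet]
  exact F.toNet.val_map (f : R →+* T) w φ

theorem phL_apply (h : VertexModel K n) {k : ℕ} (γ : Fragment k →₀ K) (φ : Fin k → Fin n) :
    phL h k γ φ = fphL (weight h) φ γ := by
  unfold phL fphL
  rw [Finsupp.linearCombination_apply, Finsupp.linearCombination_apply, Finsupp.sum, Finsupp.sum,
    Finset.sum_apply]
  refine Finset.sum_congr rfl fun F _ => ?_
  rw [Pi.smul_apply, ph_eq_fph]

theorem glueRow_apply (h : VertexModel K n) {k : ℕ} (γ : Fragment k →₀ K) (H : Fragment k) :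
    glueRow h k γ H = pairing (phL h k γ) (fph (weight h) H) := by
  rw [← ph_eq_fph]
  unfold glueRow phL
  rw [Finsupp.linearCombination_apply, Finsupp.linearCombination_apply, Finsupp.sum, Finsupp.sum,
    Finset.sum_apply, ← pairingForm_apply, map_sum, LinearMap.sum_apply]
  refine Finset.sum_congr rfl fun F _ => ?_
  rw [map_smul, Pi.smul_apply, LinearMap.smul_apply, pairingForm_apply, pairing_eq,
    partitionFun_glue]
  rfl

theorem glueRow_eq_zero_iff (h : VertexModel K n) {k : ℕ} (γ : Fragment k →₀ K) :
    glueRow h k γ = 0 ↔ ∀ u ∈ netSpan (weight h) (fun _ => True) (Fin k),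
      pairing (phL h k γ) u = 0 := by
  rw [netSpan_fin]
  refine ⟨fun hγ u hu => ?_, fun hγ => funext fun H => ?_⟩
  · refine Submodule.span_induction ?_ ?_ ?_ ?_ hu
    · rintro _ ⟨H, rfl⟩
      rw [← glueRow_apply, hγ, Pi.zero_apply]
    · exact map_zero (pairingForm K n (Fin k) _)
    · intro x y _ _ hx hy
      rw [pairing_add_right, hx, hy, add_zero]
    · intro a x _ hx
      rw [pairing_smul_right, hx, mul_zero]
  · rw [glueRow_apply]
    exact hγ _ (Submodule.subset_span ⟨H, rfl⟩)

/-- The relations satisfied by the universal vertex weights modulo the annihilator. -/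
def annIdeal (h : VertexModel K n) : Ideal (MvPolynomial (Multiset (Fin n)) K) :=
  Ideal.span {r | ∃ (k : ℕ) (γ : Fragment k →₀ K) (φ : Fin k → Fin n), glueRow h k γ = 0 ∧
    r = fphL X φ γ}

/-- The quotient by the relations on the entries of an orthogonal matrix. -/
abbrev OrthRing (w : Multiset (Fin n) → K) : Type :=
  MvPolynomial (Fin n × Fin n) K ⧸ relIdeal w fun _ => False

/-- The generic orthogonal matrix. -/
def orthMat (w : Multiset (Fin n) → K) : Matrix (Fin n) (Fin n) (OrthRing w) :=
  (genMat K n).map (Ideal.Quotient.mk _)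

theorem mk_gen (w : Multiset (Fin n) → K) {ι : Type} [Fintype ι] (t : (ι → Fin n) → K)
    (φ : ι → Fin n) : Ideal.Quotient.mk (relIdeal w fun _ => False) (gen t φ)
      = act (orthMat w) (fun ψ => algebraMap K (OrthRing w) (t ψ)) φ := map_gen _ t φ

theorem orthMat_orth (w : Multiset (Fin n) → K) : (orthMat w).transpose * orthMat w = 1 := by
  refine mul_eq_one_comm.1 (Matrix.ext fun i j => ?_)
  let φ : Bool → Fin n := fun b => if b then i else j
  have h := mk_gen w (metric K n) φ
  have h1 : (fun ψ => algebraMap K (OrthRing w) (metric K n ψ)) = metric (OrthRing w) n := by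
    funext ψ
    unfold metric
    rw [Matrix.one_apply, Matrix.one_apply, apply_ite (algebraMap K _), map_one, map_zero]
  have h2 := Ideal.Quotient.eq.2 (gen_sub_mem_relIdeal (w := w) (D := fun _ => False)
    metric_mem_netSpan φ)
  rw [h1, act_metric, h2] at h
  exact h.symm.trans (congrFun h1 φ)

/-- Moving the vertex weights by the generic orthogonal matrix. -/
def theta (w : Multiset (Fin n) → K) : MvPolynomial (Multiset (Fin n)) K →ₐ[K] OrthRing w :=
  aeval fun s => Ideal.Quotient.mk _ (gen (fun c => w (values c)) (exists_values_eq s).choose)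

theorem theta_X_values (w : Multiset (Fin n) → K) {κ : Type} [Fintype κ] (c : κ → Fin n) :
    theta w (X (values c)) = Ideal.Quotient.mk _ (gen (fun c => w (values c)) c) := by
  unfold theta
  rw [aeval_X]
  obtain ⟨e, he⟩ := exists_equiv_of_values_eq (exists_values_eq (values c)).choose_spec
  have h1 : (exists_values_eq (values c)).choose = c ∘ e := funext fun x => (he x).symm
  rw [h1, ← gen_relabel]
  congr 2
  funext φ
  rw [relabel_apply, values_comp_equiv]

theorem theta_val (w : Multiset (Fin n) → K) {ι : Type} [Fintype ι] (N : Net ι)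
    (φ : ι → Fin n) : theta w (N.val X φ) = Ideal.Quotient.mk _ (gen (N.val w) φ) := by
  rw [mk_gen]
  have h1 := N.val_map (theta w : MvPolynomial (Multiset (Fin n)) K →+* OrthRing w) X φ
  have h2 := N.val_eq_act (w := fun s => algebraMap K (OrthRing w) (w s))
    (w' := fun s => theta w (X s)) (orthMat_orth w) fun κ _ => funext fun c => by
      rw [theta_X_values, mk_gen]
  refine h1.trans ((congrFun h2 φ).trans (congrFun (congrArg _ (funext fun ψ => ?_)) φ))
  exact (N.val_map (algebraMap K (OrthRing w)) w ψ).symm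

theorem theta_fphL (h : VertexModel K n) {k : ℕ} (φ : Fin k → Fin n) (γ : Fragment k →₀ K) :
    theta (weight h) (fphL X φ γ) = Ideal.Quotient.mk _ (gen (phL h k γ) φ) := by
  suffices H : (theta (weight h)).toLinearMap ∘ₗ fphL X φ
      = (Ideal.Quotient.mkₐ K _).toLinearMap ∘ₗ genLin K φ ∘ₗ phL h k from
    LinearMap.congr_fun H γ
  refine Finsupp.lhom_ext' fun F => LinearMap.ext_ring ?_
  change theta (weight h) (fphL X φ (Finsupp.single F 1))
    = Ideal.Quotient.mk _ (gen (phL h k (Finsupp.single F 1)) φ)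
  unfold fphL phL
  rw [Finsupp.linearCombination_single, Finsupp.linearCombination_single, one_smul, one_smul,
    ph_eq_fph, ← F.val_toNet, ← F.val_toNet]
  exact theta_val _ _ _

theorem one_notMem_annIdeal [CharZero K] (h : VertexModel K n) :
    (1 : MvPolynomial _ K) ∉ annIdeal h := by
  have hB := nondegSpan_false (weight h)
  obtain ⟨η, hη, hη0, hη1⟩ := hB.exists_functional
  let η' : OrthRing (weight h) →ₗ[K] K := Submodule.liftQ
    ((relIdeal (weight h) fun _ => False).restrictScalars K) η fun p hp => hη0 p hp
  have hη' : ∀ p, η' (Ideal.Quotient.mk _ p) = η p := fun p => rfl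
  suffices H : ∀ r ∈ annIdeal h, ∀ q, η' (theta (weight h) (q * r)) = 0 by
    intro h1
    have h2 := H 1 h1 1
    rw [mul_one, map_one, ← map_one (Ideal.Quotient.mk _), hη', hη1] at h2
    exact one_ne_zero h2
  intro r hr
  refine Submodule.span_induction ?_ ?_ ?_ ?_ hr
  · rintro _ ⟨k, γ, φ, hγ, rfl⟩ q
    rw [glueRow_eq_zero_iff] at hγ
    rw [map_mul, theta_fphL]
    suffices H : ∀ (q) (ι : Type) [Fintype ι], ∀ t ∈ netSpan (weight h) (fun _ => True) ι,
        ∀ χ : ι → Fin n, η' (theta (weight h) q * Ideal.Quotient.mk _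
          (gen (phL h k γ) φ * gen t χ)) = 0 by
      have := H q Empty _ one_mem_netSpan fun x => nomatch x
      rwa [gen_one, mul_one] at this
    clear q
    intro q
    induction q using MvPolynomial.induction_on with
    | C a =>
      intro ι _ t ht χ
      rw [← algebraMap_eq, AlgHom.commutes, ← Algebra.smul_def, map_smul, hη', ← gen_otimes, hη,
        hB.proj_eq_zero, Pi.zero_apply, smul_zero]
      intro u hu
      rw [pairing_otimes]
      exact hγ _ (plug_mem_netSpan (netSpan_mono (fun _ h => h.elim) hu) ht)
    | add p q hp hq =>
      intro ι _ t ht χ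
      rw [map_add, add_mul, map_add, hp ι t ht χ, hq ι t ht χ, add_zero]
    | mul_X p s hp =>
      intro ι _ t ht χ
      obtain ⟨c, hc⟩ := exists_values_eq s
      rw [← hc]
      have := hp (_ ⊕ ι) _ (otimes_mem_netSpan (basic_mem_netSpan trivial) ht) (Sum.elim c χ)
      rw [map_mul (theta _), theta_X_values, mul_assoc, ← map_mul, ← this, gen_otimes,
        mul_left_comm]
  · simp
  · intro x y _ _ hx hy q
    rw [mul_add, map_add, map_add, hx, hy, add_zero]
  · intro a x _ hx q
    rw [smul_eq_mul, ← mul_assoc]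
    exact hx _

/-- Over some field extension there are vertex weights whose fragment tensors satisfy all
relations in the annihilator, and which generate this extension. -/
theorem exists_field_weights [CharZero K] (h : VertexModel K n) :
    ∃ (L : Type) (_ : Field L) (_ : Algebra K L) (w : Multiset (Fin n) → L),
      Algebra.adjoin K (Set.range w) = ⊤ ∧
      ∀ (k : ℕ) (γ : Fragment k →₀ K) (φ : Fin k → Fin n), glueRow h k γ = 0 →
        fphL w φ γ = 0 := by
  obtain ⟨m, hm, hle⟩ := Ideal.exists_le_maximal (annIdeal h)
    ((Ideal.ne_top_iff_one _).2 (one_notMem_annIdeal h))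
  let f : MvPolynomial (Multiset (Fin n)) K →ₐ[K] MvPolynomial (Multiset (Fin n)) K ⧸ m :=
    Ideal.Quotient.mkₐ K m
  refine ⟨_, Ideal.Quotient.field m, inferInstance, fun s => f (X s), ?_, ?_⟩
  · have := congrArg (Subalgebra.map f) (MvPolynomial.adjoin_range_X (R := K)
      (σ := Multiset (Fin n)))
    rw [AlgHom.map_adjoin, Algebra.map_top,
      (AlgHom.range_eq_top f).2 (Ideal.Quotient.mkₐ_surjective K m),
      ← Set.range_comp] at this
    exact this
  · intro k γ φ hγ
    have h1 : f (fphL X φ γ) = 0 :=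
      Ideal.Quotient.eq_zero_iff_mem.2 (hle (Ideal.subset_span ⟨k, γ, φ, hγ, rfl⟩))
    rwa [map_fphL] at h1

end Universal

end

noncomputable section

open scoped Classical

/-! ### Vertex weights in extension fields -/

section Compat

variable {n : ℕ} {K L : Type} [Field K] [Field L] [Algebra K L]

/-- The fragment tensors of the weights `w` satisfy all relations which `h` cannot see. -/
def Compat (h : VertexModel K n) (w : Multiset (Fin n) → L) : Prop :=
  ∀ (k : ℕ) (γ : Fragment k →₀ K) (φ : Fin k → Fin n), glueRow h k γ = 0 → fphL w φ γ = 0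

/-- The empty graph. -/
def emptyGraph : Graph where
  nv := 0
  ne := 0
  inc := Fin.elim0
  card_inc := fun e => e.elim0
  openEnd := fun j => j.elim0

theorem fph_emptyGraph (w : Multiset (Fin n) → L) (φ : Fin 0 → Fin n) :
    fph w emptyGraph φ = 1 := by
  have : IsEmpty (Fin emptyGraph.nv) := inferInstanceAs (IsEmpty (Fin 0))
  have : IsEmpty (Fin emptyGraph.ne) := inferInstanceAs (IsEmpty (Fin 0))
  unfold fph
  rw [Finset.filter_true_of_mem fun _ _ => ?_]
  · simp
  · exact fun e => isEmptyElim e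

variable {h : VertexModel K n} {w : Multiset (Fin n) → L}

theorem Compat.fph_graph (hw : Compat h w) (G : Graph) (φ : Fin 0 → Fin n) :
    fph w G φ = algebraMap K L (partitionFun h G) := by
  have h1 := hw 0 (Finsupp.single G 1 - Finsupp.single emptyGraph (partitionFun h G)) φ ?_
  · unfold fphL at h1
    rw [map_sub, Finsupp.linearCombination_single, Finsupp.linearCombination_single,
      fph_emptyGraph, one_smul, sub_eq_zero] at h1
    rw [h1, Algebra.algebraMap_eq_smul_one]
  · refine (glueRow_eq_zero_iff h _).2 fun u _ => ?_
    have h2 : phL h 0 (Finsupp.single G 1 - Finsupp.single emptyGraph (partitionFun h G)) = 0 := by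
      funext χ
      rw [phL_apply]
      unfold fphL
      rw [map_sub, Finsupp.linearCombination_single, Finsupp.linearCombination_single,
        fph_emptyGraph, one_smul, partitionFun_eq_fph h G χ, smul_eq_mul, mul_one, sub_self]
      rfl
    rw [h2]
    exact LinearMap.congr_fun (map_zero (pairingForm K n (Fin 0))) u

theorem fphL_mapRange_eq (w : Multiset (Fin n) → L) {k : ℕ} (c : Fragment k →₀ L)
    (ℓ : L →ₗ[K] K) (φ : Fin k → Fin n) : fphL w φ (c.mapRange ℓ (map_zero ℓ))
      = ∑ F ∈ c.support, ℓ (c F) • fph w F φ := by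
  unfold fphL
  rw [Finsupp.linearCombination_apply]
  exact Finsupp.sum_mapRange_index (h := fun F a => a • fph w F φ) fun _ => zero_smul K _

/-- Descent of relations between fragment tensors to the base field. -/
theorem Compat.fphL_mapRange (hw : Compat h w) {k : ℕ} (c : Fragment k →₀ L)
    (hc : ∀ u ∈ netSpan w (fun _ => True) (Fin k),
      pairing (Finsupp.linearCombination L (fun F => fph w F) c) u = 0)
    (ℓ : L →ₗ[K] K) (φ : Fin k → Fin n) : fphL w φ (c.mapRange ℓ (map_zero ℓ)) = 0 := by
  refine hw k _ φ (funext fun H => ?_)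
  have h1 := hc (fph w H) (netSpan_fin (w := w) k ▸ Submodule.subset_span ⟨H, rfl⟩)
  rw [Finsupp.linearCombination_apply, Finsupp.sum, ← pairingForm_apply, map_sum,
    LinearMap.sum_apply] at h1
  have h2 : ∀ F, pairingForm L n (Fin k) (c F • fph w F) (fph w H)
      = algebraMap K L (partitionFun h (glue F H)) * c F := by
    intro F
    rw [map_smul, LinearMap.smul_apply, smul_eq_mul, mul_comm, pairingForm_apply,
      ← hw.fph_graph _ Fin.elim0, fph_glue, pairing_eq]
  simp only [h2] at h1
  have h3 := congrArg ℓ h1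
  simp only [map_sum, ← Algebra.smul_def, map_smul, map_zero] at h3
  unfold glueRow
  rw [Finsupp.linearCombination_apply, Finsupp.sum_mapRange_index (by simp), Finsupp.sum,
    Finset.sum_apply, Pi.zero_apply, ← h3]
  exact Finset.sum_congr rfl fun F _ => mul_comm _ _

theorem Compat.nondegSpan (hw : Compat h w) : NondegSpan w fun _ => True := by
  suffices H : ∀ k, ∀ t ∈ netSpan w (fun _ => True) (Fin k),
      (∀ u ∈ netSpan w (fun _ => True) (Fin k), pairing t u = 0) → t = 0 by
    intro ι _ t ht horth
    let e := Fintype.equivFin ι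
    have h1 := H _ (relabel e t) (relabel_mem_netSpan e ht) fun u hu => by
      rw [pairing_relabel_left]
      exact horth _ (relabel_mem_netSpan e.symm hu)
    funext φ
    have h2 := congrFun h1 (φ ∘ e.symm)
    rwa [relabel_apply, Function.comp_assoc, Equiv.symm_comp_self] at h2
  intro k t ht horth
  rw [netSpan_fin] at ht
  obtain ⟨c, rfl⟩ := Finsupp.mem_span_range_iff_exists_finsupp.1 ht
  change Finsupp.linearCombination L (fun F => fph w F) c = 0
  let b := Module.Basis.ofVectorSpace K L
  funext φ
  let J := c.support.biUnion fun F => (b.repr (c F)).support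
  have h1 : ∀ F ∈ c.support, c F = ∑ j ∈ J, b.coord j (c F) • b j := by
    intro F hF
    conv_lhs => rw [← b.linearCombination_repr (c F), Finsupp.linearCombination_apply]
    refine Finsupp.sum_of_support_subset _ ?_ _ fun _ _ => zero_smul _ _
    exact Finset.subset_biUnion_of_mem (fun F => (b.repr (c F)).support) hF
  have h3 : ∑ j ∈ J, b j * ∑ F ∈ c.support, b.coord j (c F) • fph w F φ = 0 :=
    Finset.sum_eq_zero fun j _ => by
      rw [← fphL_mapRange_eq, hw.fphL_mapRange c horth (b.coord j) φ, mul_zero]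
  rw [Finsupp.linearCombination_apply, Finsupp.sum, Finset.sum_apply, Pi.zero_apply, ← h3]
  simp only [Finset.mul_sum]
  rw [Finset.sum_comm]
  refine Finset.sum_congr rfl fun F hF => ?_
  rw [Pi.smul_apply, smul_eq_mul]
  conv_lhs => rw [h1 F hF, Finset.sum_mul]
  refine Finset.sum_congr rfl fun j _ => ?_
  rw [Algebra.smul_def, Algebra.smul_def]
  ring

end Compat

end

noncomputable section

open scoped Classical

/-! ### Networks of bounded degree -/

section Bounded

variable {n : ℕ} {K : Type} [Field K]

/-- Generic transforms of nonconstant tensors spanned by networks of degree at most `d`. -/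
def boundedGen (w : Multiset (Fin n) → K) (d : ℕ) : Set (MvPolynomial (Fin n × Fin n) K) :=
  {p | ∃ m, 0 < m ∧ ∃ t ∈ netSpan w (· ≤ d) (Fin m), ∃ φ, p = gen t φ}

theorem boundedGen_mono (w : Multiset (Fin n) → K) {d d' : ℕ} (h : d ≤ d') :
    boundedGen w d ⊆ boundedGen w d' := by
  rintro p ⟨m, hm, t, ht, φ, rfl⟩
  exact ⟨m, hm, t, netSpan_mono (fun _ hd => hd.trans h) ht, φ, rfl⟩

theorem exists_gen_mem_span_boundedGen (w : Multiset (Fin n) → K) :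
    ∃ d, ∀ m, 0 < m → ∀ t ∈ netSpan w (fun _ => True) (Fin m), ∀ φ,
      gen t φ ∈ Ideal.span (boundedGen w d) := by
  let s : Set (MvPolynomial (Fin n × Fin n) K) := ⋃ d, boundedGen w d
  have hs : (Ideal.span s).FG := IsNoetherian.noetherian _
  obtain ⟨s', hs', he⟩ := (Submodule.fg_span_iff_fg_span_finset_subset s).1 hs
  have h1 : ∀ p, ∃ d, p ∈ s → p ∈ boundedGen w d := by
    intro p
    by_cases hp : p ∈ s
    · obtain ⟨d, hd⟩ := Set.mem_iUnion.1 hp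
      exact ⟨d, fun _ => hd⟩
    · exact ⟨0, fun h => absurd h hp⟩
  choose D hD using h1
  refine ⟨s'.sup D, fun m hm t ht φ => ?_⟩
  have h2 : Ideal.span s ≤ Ideal.span (boundedGen w (s'.sup D)) := by
    refine he.le.trans (Ideal.span_mono fun p hp => ?_)
    exact boundedGen_mono w (Finset.le_sup hp) (hD p (hs' hp))
  refine h2 (netSpan_induction (genLin K φ) ((Ideal.span s).restrictScalars K) (fun N _ => ?_) ht)
  refine Ideal.subset_span (Set.mem_iUnion.2 ⟨Finset.univ.sup N.deg, m, hm, N.val w, ?_, φ, rfl⟩)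
  exact N.val_mem_netSpan fun v => Finset.le_sup (Finset.mem_univ v)

/-- Symmetrization of an operator on the tensor power `m` into an operator on all tensors. -/
def symmetrize {m : ℕ} (σ : ((Fin m → Fin n) → K) →ₗ[K] ((Fin m → Fin n) → K))
    (ι : Type) [Fintype ι] : ((ι → Fin n) → K) →ₗ[K] ((ι → Fin n) → K) :=
  ∑ e : ι ≃ Fin m, relabel e.symm ∘ₗ σ ∘ₗ relabel e

theorem symmetrize_apply {m : ℕ} (σ : ((Fin m → Fin n) → K) →ₗ[K] ((Fin m → Fin n) → K))
    {ι : Type} [Fintype ι] [Fintype (ι ≃ Fin m)] (t : (ι → Fin n) → K) :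
    symmetrize σ ι t = ∑ e : ι ≃ Fin m, relabel e.symm (σ (relabel e t)) := by
  unfold symmetrize
  rw [LinearMap.sum_apply]
  refine Finset.sum_congr ?_ fun _ _ => rfl
  congr!

theorem symmetrize_relabel {m : ℕ} (σ : ((Fin m → Fin n) → K) →ₗ[K] ((Fin m → Fin n) → K))
    {ι κ : Type} [Fintype ι] [Fintype κ] (e : ι ≃ κ) (t : (ι → Fin n) → K) :
    symmetrize σ κ (relabel e t) = relabel e (symmetrize σ ι t) := by
  rw [symmetrize_apply, symmetrize_apply, map_sum]
  let E : (κ ≃ Fin m) ≃ (ι ≃ Fin m) :=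
    ⟨e.trans, e.symm.trans, fun f => Equiv.ext fun x => congrArg f (e.apply_symm_apply x),
      fun f => Equiv.ext fun x => congrArg f (e.symm_apply_apply x)⟩
  refine Fintype.sum_equiv E _ _ fun f => funext fun φ => ?_
  change σ _ (φ ∘ f.symm) = σ _ ((φ ∘ e) ∘ e.symm ∘ f.symm)
  rw [Function.comp_assoc, ← Function.comp_assoc e, Equiv.self_comp_symm]
  rfl

theorem NondegSpan.netSpan_le_of_gen_mem [CharZero K] {w : Multiset (Fin n) → K}
    (hA : NondegSpan w fun _ => True) {d : ℕ}
    (hd : ∀ m, 0 < m → ∀ t ∈ netSpan w (fun _ => True) (Fin m), ∀ φ,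
      gen t φ ∈ Ideal.span (boundedGen w d)) (m : ℕ) :
    netSpan w (fun _ => True) (Fin m) ≤ netSpan w (· ≤ d) (Fin m) := by
  induction m using Nat.strong_induction_on with
  | _ m IH =>
  intro t ht
  rcases Nat.eq_zero_or_pos m with rfl | hm
  · have : t = t Fin.elim0 • fun _ => 1 := by
      funext φ
      rw [Subsingleton.elim φ Fin.elim0, Pi.smul_apply, smul_eq_mul, mul_one]
    rw [this]
    exact Submodule.smul_mem _ _ one_mem_netSpan
  let Q := netSpan w (· ≤ d) (Fin m)
  obtain ⟨g, hg⟩ := LinearMap.exists_leftInverse_of_injective Q.subtype Q.ker_subtype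
  let σ := LinearMap.id - Q.subtype ∘ₗ g
  have hσ : ∀ u ∈ Q, σ u = 0 := fun u hu => by
    have := LinearMap.congr_fun hg ⟨u, hu⟩
    exact sub_eq_zero.2 (congrArg Subtype.val this).symm
  obtain ⟨η, hη⟩ := VertexModels.exists_functional (fun ι _ => symmetrize σ ι ∘ₗ hA.proj ι)
    fun ι κ _ _ e t => by
      rw [LinearMap.comp_apply, LinearMap.comp_apply, hA.proj_relabel, symmetrize_relabel]
  have h1 : ∀ p ∈ Ideal.span (boundedGen w d), η p = 0 := by
    intro p hp
    suffices h : ∀ q, η (q * p) = 0 by simpa using h 1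
    refine Submodule.span_induction ?_ ?_ ?_ ?_ hp
    · rintro _ ⟨m', hm', u, hu, φ, rfl⟩ q
      refine (Submodule.mem_bot K).1 (gen_induction
        (η ∘ₗ LinearMap.mulRight K (gen u φ)) ⊥ (fun k s χ => ?_) q)
      rw [Submodule.mem_bot, LinearMap.comp_apply, LinearMap.mulRight_apply, ← gen_otimes, hη,
        LinearMap.comp_apply, hA.proj_otimes s (netSpan_mono (fun _ _ => trivial) hu),
        symmetrize_apply, Finset.sum_eq_zero fun e _ => ?_]
      · rfl
      rw [hσ, map_zero]
      have hk := Fintype.card_congr e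
      rw [Fintype.card_sum, Fintype.card_fin, Fintype.card_fin, Fintype.card_fin] at hk
      exact relabel_mem_netSpan e
        (otimes_mem_netSpan (IH k (by omega) (hA.proj_mem s)) hu)
    · simp
    · intro x y _ _ hx hy q
      rw [mul_add, map_add, hx, hy, add_zero]
    · intro a x _ hx q
      rw [smul_eq_mul, ← mul_assoc]
      exact hx _
  have h2 : symmetrize σ (Fin m) t = 0 := by
    funext φ
    have := hη (Fin m) t φ
    rw [h1 _ (hd m hm t ht φ), LinearMap.comp_apply, hA.proj_of_mem ht] at this
    exact this.symm
  rw [symmetrize_apply] at h2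
  have h3 : ∀ e : Fin m ≃ Fin m, relabel e.symm (σ (relabel e t))
      = t - relabel e.symm (g (relabel e t)) := by
    intro e
    change relabel e.symm (relabel e t - (g (relabel e t) : (Fin m → Fin n) → K)) = _
    rw [map_sub]
    refine congrArg (· - _) (funext fun φ => ?_)
    rw [relabel_apply, relabel_apply, Function.comp_assoc, Equiv.symm_comp_self]
    rfl
  simp only [h3, Finset.sum_sub_distrib, Finset.sum_const, Finset.card_univ] at h2
  rw [sub_eq_zero] at h2
  have h4 := sum_mem fun e (_ : e ∈ (Finset.univ : Finset (Fin m ≃ Fin m))) =>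
    relabel_mem_netSpan e.symm (g (relabel e t)).2
  rw [← h2, ← Nat.cast_smul_eq_nsmul K] at h4
  rwa [Submodule.smul_mem_iff _ (Nat.cast_ne_zero.2 Fintype.card_ne_zero)] at h4

end Bounded

end

noncomputable section

open scoped Classical

/-! ### Existence of a nondegenerate vertex model -/

section Descent

variable {n : ℕ} {K L : Type} [Field K] [Field L] [Algebra K L]

theorem Net.val_mem_adjoin {ι : Type} (N : Net ι) (w : Multiset (Fin n) → L) {d : ℕ}
    (hN : ∀ v, N.deg v ≤ d) (φ : ι → Fin n) :
    N.val w φ ∈ Algebra.adjoin K (w '' {s | s.card ≤ d}) := by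
  unfold Net.val
  refine sum_mem fun ψ _ => ?_
  split_ifs
  · refine prod_mem fun v _ => Algebra.subset_adjoin ⟨_, ?_, rfl⟩
    exact (N.card_col ψ v).trans_le (hN v)
  · exact zero_mem _

variable {h : VertexModel K n} {w : Multiset (Fin n) → L}

theorem Compat.mem_adjoin (hw : Compat h w) {d : ℕ}
    (hd : ∀ m, netSpan w (fun _ => True) (Fin m) ≤ netSpan w (· ≤ d) (Fin m))
    (s : Multiset (Fin n)) : w s ∈ Algebra.adjoin K (w '' {s | s.card ≤ d}) := by
  obtain ⟨m, φ, rfl⟩ : ∃ (m : ℕ) (φ : Fin m → Fin n), values φ = s := ⟨_, exists_values_eq s⟩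
  obtain ⟨N, -, hv⟩ := exists_net_basic L n (Fin m)
  let S : Set (Fragment m) := {F | ∃ N : Net (Fin m), (∀ v, N.deg v ≤ d) ∧ N.toFragment = F}
  have h1 : N.val w ∈ Submodule.span L ((fun F => fph w F) '' S) := by
    refine Submodule.span_mono ?_ (hd m (N.val_mem_netSpan fun _ => trivial))
    rintro _ ⟨N', hN', rfl⟩
    exact ⟨N'.toFragment, ⟨N', hN', rfl⟩, N'.fph_toFragment w⟩
  obtain ⟨c, hc, hcN⟩ := Finsupp.mem_span_image_iff_linearCombination L |>.1 h1
  obtain ⟨ℓ, hℓ⟩ := LinearMap.exists_leftInverse_of_injective (Algebra.linearMap K L)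
    (LinearMap.ker_eq_bot.2 (algebraMap K L).injective)
  have hℓ1 : ℓ 1 = 1 := by
    rw [← map_one (algebraMap K L)]
    exact LinearMap.congr_fun hℓ 1
  have h2 := hw.fphL_mapRange (Finsupp.single N.toFragment 1 - c) (fun u _ => ?_) ℓ φ
  · rw [Finsupp.mapRange_sub (map_sub ℓ), map_sub, Finsupp.mapRange_single, hℓ1,
      fphL_mapRange_eq, sub_eq_zero] at h2
    unfold fphL at h2
    rw [Finsupp.linearCombination_single, one_smul, N.fph_toFragment, hv] at h2
    refine (congrArg (· ∈ _) h2).mpr (sum_mem fun F hF => Subalgebra.smul_mem _ ?_ _)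
    obtain ⟨N', hN', rfl⟩ := hc hF
    rw [N'.fph_toFragment]
    exact N'.val_mem_adjoin w hN' φ
  · rw [map_sub, Finsupp.linearCombination_single, one_smul, hcN, N.fph_toFragment, sub_self,
      ← pairingForm_apply, map_zero, LinearMap.zero_apply]

theorem finite_setOf_card_le (n d : ℕ) : {s : Multiset (Fin n) | s.card ≤ d}.Finite := by
  have h1 : (⋃ k ∈ Set.Iic d, Set.range (values : (Fin k → Fin n) → Multiset (Fin n))).Finite :=
    (Set.finite_Iic d).biUnion fun k _ => Set.finite_range _
  refine h1.subset fun s hs => ?_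
  obtain ⟨c, hc⟩ := exists_values_eq s
  exact Set.mem_biUnion hs ⟨c, hc⟩

theorem exists_compat_self [CharZero K] [IsAlgClosed K] (h : VertexModel K n) :
    ∃ w : Multiset (Fin n) → K, Compat h w := by
  obtain ⟨L, _, _, w, hadj, hrel⟩ := exists_field_weights h
  have hw : Compat h w := fun k γ φ => hrel k γ φ
  have : CharZero L := charZero_of_injective_algebraMap (algebraMap K L).injective
  obtain ⟨d, hd⟩ := exists_gen_mem_span_boundedGen w
  have h1 := hw.mem_adjoin fun m => hw.nondegSpan.netSpan_le_of_gen_mem hd m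
  have : Algebra.FiniteType K L := by
    refine ⟨Subalgebra.fg_def.2 ⟨_, (finite_setOf_card_le n d).image w, top_le_iff.1 ?_⟩⟩
    rw [← hadj]
    refine Algebra.adjoin_le ?_
    rintro _ ⟨s, rfl⟩
    exact h1 s
  have : Module.Finite K L := finite_of_finite_type_of_isJacobsonRing K L
  let f := (AlgEquiv.ofBijective (Algebra.ofId K L)
    (IsAlgClosed.algebraMap_bijective_of_isIntegral (k := K) (K := L))).symm
  refine ⟨fun s => f (w s), fun k γ φ hγ => ?_⟩
  rw [← AlgEquiv.coe_toAlgHom, ← map_fphL, hw k γ φ hγ, map_zero]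

theorem exists_weight_eq (w : Multiset (Fin n) → K) : ∃ h : VertexModel K n, weight h = w := by
  refine ⟨(basisMonomials (Fin n) K).constr K fun s => w (Finsupp.toMultiset s), funext fun s => ?_⟩
  obtain ⟨m, c, rfl⟩ : ∃ (m : ℕ) (c : Fin m → Fin n), values c = s := ⟨_, exists_values_eq s⟩
  unfold weight
  have h1 : ((values c).map X).prod
      = basisMonomials (Fin n) K (∑ i, Finsupp.single (c i) 1) := by
    rw [prod_values, coe_basisMonomials]
    exact monomial_eq_prod_X c
  rw [h1, Module.Basis.constr_basis, values_eq_sum]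
  simp

theorem Compat.partitionFun_eq {h' : VertexModel K n} (hw : Compat h (weight h')) (G : Graph) :
    partitionFun h G = partitionFun h' G := by
  have h1 := hw.fph_graph G Fin.elim0
  rw [partitionFun_eq_fph h' G Fin.elim0, h1]
  rfl

theorem Compat.nondeg {h' : VertexModel K n} (hw : Compat h (weight h')) : Nondeg h' := by
  intro k γ
  constructor
  · intro hγ
    funext H
    rw [glueRow_apply, hγ, ← pairingForm_apply, map_zero, LinearMap.zero_apply]
    rfl
  · intro hγ
    have h1 : glueRow h k γ = 0 := by
      rw [← hγ]
      unfold glueRow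
      simp only [hw.partitionFun_eq]
    funext φ
    rw [phL_apply, hw k γ φ h1]
    rfl

end Descent

end

noncomputable section

open scoped Classical

/-! ### Evaluation, translation and invariant derivations on matrix polynomials -/

section MatrixPolynomials

variable {n : ℕ} {K : Type} [Field K] {ι : Type} [Fintype ι]

/-- Evaluation of a polynomial at a matrix. -/
def evalAt (g : Matrix (Fin n) (Fin n) K) : MvPolynomial (Fin n × Fin n) K →ₐ[K] K :=
  aeval fun p => g p.1 p.2

theorem evalAt_X (g : Matrix (Fin n) (Fin n) K) (p : Fin n × Fin n) :
    evalAt g (X p) = g p.1 p.2 := aeval_X _ _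

theorem evalAt_C (g : Matrix (Fin n) (Fin n) K) (a : K) : evalAt g (C a) = a :=
  aeval_C _ _

theorem evalAt_gen (g : Matrix (Fin n) (Fin n) K) (t : (ι → Fin n) → K) (φ : ι → Fin n) :
    evalAt g (gen t φ) = act g t φ := by
  refine (map_gen (evalAt g : MvPolynomial (Fin n × Fin n) K →+* K) t φ).trans ?_
  congr 2
  · ext i j
    exact evalAt_X g (i, j)
  · funext ψ
    exact evalAt_C g _

theorem eq_of_evalAt_eq [Infinite K] {p q : MvPolynomial (Fin n × Fin n) K}
    (h : ∀ g, evalAt g p = evalAt g q) : p = q :=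
  MvPolynomial.funext fun x => h fun i j => x (i, j)

/-- Translation of the generic matrix by a fixed matrix from the left. -/
def leftMul (g : Matrix (Fin n) (Fin n) K) :
    MvPolynomial (Fin n × Fin n) K →ₐ[K] MvPolynomial (Fin n × Fin n) K :=
  aeval fun p => ∑ l, C (g p.1 l) * X (l, p.2)

theorem leftMul_X (g : Matrix (Fin n) (Fin n) K) (p : Fin n × Fin n) :
    leftMul g (X p) = ∑ l, C (g p.1 l) * X (l, p.2) := aeval_X _ _

theorem evalAt_leftMul (g x : Matrix (Fin n) (Fin n) K) (p : MvPolynomial (Fin n × Fin n) K) :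
    evalAt x (leftMul g p) = evalAt (g * x) p := by
  suffices H : (evalAt x).comp (leftMul g) = evalAt (g * x) from AlgHom.congr_fun H p
  refine MvPolynomial.algHom_ext fun q => ?_
  rw [AlgHom.comp_apply, leftMul_X, evalAt_X, map_sum, Matrix.mul_apply]
  simp [evalAt_X]

theorem leftMul_gen (g : Matrix (Fin n) (Fin n) K) (t : (ι → Fin n) → K) (φ : ι → Fin n) :
    leftMul g (gen t φ) = act (g.map C) (fun ψ => gen t ψ) φ := by
  refine (map_gen (leftMul g : _ →+* MvPolynomial (Fin n × Fin n) K) t φ).trans ?_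
  unfold gen
  rw [← act_mul]
  refine congrFun (congrArg₂ act (Matrix.ext fun i j => ?_) (funext fun ψ => ?_)) φ
  · exact (leftMul_X g (i, j)).trans (Matrix.mul_apply (M := g.map C) (N := genMat K n)).symm
  · exact (leftMul g).commutes _

theorem leftMul_leftMul [Infinite K] {g g' : Matrix (Fin n) (Fin n) K} (h : g' * g = 1)
    (p : MvPolynomial (Fin n × Fin n) K) : leftMul g (leftMul g' p) = p :=
  eq_of_evalAt_eq fun x => by
    rw [evalAt_leftMul, evalAt_leftMul, ← mul_assoc, h, one_mul]

/-- The left invariant derivation with a given value at the identity. -/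
def der (x : Matrix (Fin n) (Fin n) K) :
    Derivation K (MvPolynomial (Fin n × Fin n) K) (MvPolynomial (Fin n × Fin n) K) :=
  mkDerivation K fun p => ∑ l, X (p.1, l) * C (x l p.2)

theorem der_X (x : Matrix (Fin n) (Fin n) K) (p : Fin n × Fin n) :
    der x (X p) = ∑ l, X (p.1, l) * C (x l p.2) := mkDerivation_X _ _ _

theorem der_C (x : Matrix (Fin n) (Fin n) K) (a : K) : der x (C a) = 0 :=
  (der x).map_algebraMap a

theorem der_add (x y : Matrix (Fin n) (Fin n) K) : der (x + y) = der x + der y := by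
  refine MvPolynomial.derivation_ext fun p => ?_
  rw [Derivation.add_apply, der_X, der_X, der_X, ← Finset.sum_add_distrib]
  exact Finset.sum_congr rfl fun l _ => by rw [Matrix.add_apply, C_add, mul_add]

theorem der_smul (a : K) (x : Matrix (Fin n) (Fin n) K) : der (a • x) = a • der x := by
  refine MvPolynomial.derivation_ext fun p => ?_
  rw [Derivation.smul_apply, der_X, der_X, Finset.smul_sum]
  refine Finset.sum_congr rfl fun l _ => ?_
  rw [Matrix.smul_apply, smul_eq_mul, C_mul, smul_eq_C_mul]
  ring

theorem leftMul_der (g x : Matrix (Fin n) (Fin n) K) (p : MvPolynomial (Fin n × Fin n) K) :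
    leftMul g (der x p) = der x (leftMul g p) := by
  induction p using MvPolynomial.induction_on with
  | C a =>
    rw [der_C, map_zero, show leftMul g (C a) = C a from (leftMul g).commutes a, der_C]
  | add p q hp hq => rw [map_add, map_add, hp, hq, map_add, map_add]
  | mul_X p q hp =>
    have h1 : leftMul g (der x (X q)) = der x (leftMul g (X q)) := by
      rw [der_X, leftMul_X, map_sum, map_sum]
      simp only [Derivation.leibniz, der_C, der_X, map_mul, leftMul_X, Finset.sum_mul,
        smul_eq_mul, mul_zero, add_zero, Finset.mul_sum]
      rw [Finset.sum_comm]
      refine Finset.sum_congr rfl fun l _ => Finset.sum_congr rfl fun m _ => ?_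
      rw [show leftMul g (C (x m q.2)) = C (x m q.2) from (leftMul g).commutes _, mul_assoc]
    rw [Derivation.leibniz, map_add, smul_eq_mul, smul_eq_mul, map_mul (leftMul g),
      map_mul (leftMul g), h1, hp, map_mul (leftMul g), Derivation.leibniz, smul_eq_mul,
      smul_eq_mul]

/-- The infinitesimal action of matrices on tensors. -/
def inf (x : Matrix (Fin n) (Fin n) K) (t : (ι → Fin n) → K) : (ι → Fin n) → K :=
  fun φ => evalAt 1 (der x (gen t φ))

theorem der_gen [Infinite K] (x : Matrix (Fin n) (Fin n) K) (t : (ι → Fin n) → K)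
    (φ : ι → Fin n) : der x (gen t φ) = gen (inf x t) φ := by
  refine eq_of_evalAt_eq fun g => ?_
  rw [evalAt_gen, ← mul_one g, ← evalAt_leftMul, leftMul_der, leftMul_gen, mul_one]
  unfold act pairing
  rw [map_sum, map_sum]
  refine Finset.sum_congr rfl fun ψ _ => ?_
  simp only [Matrix.map_apply]
  rw [← map_prod C (fun i => g (φ i) (ψ i)), ← smul_eq_C_mul, (der x).map_smul, map_smul]
  rfl

/-- The differential of a polynomial at the identity matrix. -/
def diffAt (p : MvPolynomial (Fin n × Fin n) K) : Module.Dual K (Matrix (Fin n) (Fin n) K) where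
  toFun x := evalAt 1 (der x p)
  map_add' x y := by rw [der_add, Derivation.add_apply, map_add]
  map_smul' a x := by
    rw [der_smul, Derivation.smul_apply, map_smul]
    rfl

theorem diffAt_apply (p : MvPolynomial (Fin n × Fin n) K) (x : Matrix (Fin n) (Fin n) K) :
    diffAt p x = evalAt 1 (der x p) := rfl

theorem diffAt_C (a : K) : diffAt (n := n) (C a) = 0 :=
  LinearMap.ext fun x => by rw [diffAt_apply, der_C, map_zero, LinearMap.zero_apply]

theorem diffAt_X (q : Fin n × Fin n) (x : Matrix (Fin n) (Fin n) K) :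
    diffAt (X q) x = x q.1 q.2 := by
  rw [diffAt_apply, der_X, map_sum]
  simp only [map_mul, evalAt_X, evalAt_C]
  rw [← Matrix.mul_apply, one_mul]

theorem diffAt_add (p q : MvPolynomial (Fin n × Fin n) K) :
    diffAt (p + q) = diffAt p + diffAt q :=
  LinearMap.ext fun x => by
    rw [diffAt_apply, map_add, map_add, LinearMap.add_apply, diffAt_apply, diffAt_apply]

theorem diffAt_mul (p q : MvPolynomial (Fin n × Fin n) K) :
    diffAt (p * q) = evalAt 1 p • diffAt q + evalAt 1 q • diffAt p :=
  LinearMap.ext fun x => by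
    rw [diffAt_apply, Derivation.leibniz, map_add, smul_eq_mul, smul_eq_mul, map_mul, map_mul]
    rfl

end MatrixPolynomials

end

noncomputable section

open scoped Classical

/-! ### Expansion of matrix polynomials at the identity -/

section Jets

variable {n : ℕ} {K : Type} [Field K]

/-- The ideal of polynomials vanishing at the identity matrix. -/
def oneIdeal (K : Type) [Field K] (n : ℕ) : Ideal (MvPolynomial (Fin n × Fin n) K) :=
  RingHom.ker (evalAt (1 : Matrix (Fin n) (Fin n) K))

theorem mem_oneIdeal {p : MvPolynomial (Fin n × Fin n) K} :
    p ∈ oneIdeal K n ↔ evalAt 1 p = 0 := RingHom.mem_ker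

/-- The coordinates centred at the identity matrix. -/
def coordOne (K : Type) [Field K] {n : ℕ} (q : Fin n × Fin n) : MvPolynomial (Fin n × Fin n) K :=
  X q - C ((1 : Matrix (Fin n) (Fin n) K) q.1 q.2)

theorem coordOne_mem (q : Fin n × Fin n) : coordOne K q ∈ oneIdeal K n := by
  rw [mem_oneIdeal, coordOne, map_sub, evalAt_X, evalAt_C, sub_self]

/-- The linear polynomial attached to a linear form on matrices. -/
def linPart (K : Type) [Field K] (n : ℕ) : Module.Dual K (Matrix (Fin n) (Fin n) K) →ₗ[K]
    MvPolynomial (Fin n × Fin n) K where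
  toFun ℓ := ∑ q : Fin n × Fin n, C (ℓ (Matrix.single q.1 q.2 1)) * coordOne K q
  map_add' ℓ ℓ' := by
    rw [← Finset.sum_add_distrib]
    exact Finset.sum_congr rfl fun q _ => by rw [LinearMap.add_apply, C_add, add_mul]
  map_smul' a ℓ := by
    rw [Finset.smul_sum]
    refine Finset.sum_congr rfl fun q _ => ?_
    rw [LinearMap.smul_apply, smul_eq_mul, C_mul, mul_assoc, RingHom.id_apply, smul_eq_C_mul]

theorem linPart_apply (ℓ : Module.Dual K (Matrix (Fin n) (Fin n) K)) :
    linPart K n ℓ = ∑ q : Fin n × Fin n, C (ℓ (Matrix.single q.1 q.2 1)) * coordOne K q := rfl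

theorem linPart_mem (ℓ : Module.Dual K (Matrix (Fin n) (Fin n) K)) :
    linPart K n ℓ ∈ oneIdeal K n :=
  sum_mem fun q _ => Ideal.mul_mem_left _ _ (coordOne_mem q)

theorem linPart_diffAt_X (q : Fin n × Fin n) : linPart K n (diffAt (X q)) = coordOne K q := by
  rw [linPart_apply, Finset.sum_eq_single q]
  · rw [diffAt_X, Matrix.single_apply_same, C_1, one_mul]
  · intro r _ hr
    rw [diffAt_X, Matrix.single_apply_of_ne, C_0, zero_mul]
    rintro ⟨h1, h2⟩
    exact hr (Prod.ext h1 h2)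
  · exact fun h => absurd (Finset.mem_univ q) h

/-- First order expansion at the identity matrix. -/
theorem sub_linPart_mem (p : MvPolynomial (Fin n × Fin n) K) :
    p - C (evalAt 1 p) - linPart K n (diffAt p) ∈ oneIdeal K n ^ 2 := by
  induction p using MvPolynomial.induction_on with
  | C a => rw [evalAt_C, sub_self, diffAt_C, map_zero, sub_zero]; exact zero_mem _
  | add p q hp hq =>
    have := add_mem hp hq
    rw [diffAt_add, map_add (evalAt 1), C_add, map_add (linPart K n)]
    convert this using 1
    ring
  | mul_X p q hp =>
    have h1 : linPart K n (diffAt p) * coordOne K q ∈ oneIdeal K n ^ 2 := by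
      rw [pow_two]
      exact Ideal.mul_mem_mul (linPart_mem _) (coordOne_mem q)
    have h2 := add_mem (Ideal.mul_mem_right (X q) _ hp) h1
    rw [diffAt_mul, map_add (linPart K n), map_smul, map_smul, linPart_diffAt_X, map_mul (evalAt 1),
      C_mul, smul_eq_C_mul, smul_eq_C_mul]
    convert h2 using 1
    rw [coordOne, evalAt_X]
    ring

/-- The Euler derivation of a projection of matrices. -/
def euler (π : Matrix (Fin n) (Fin n) K →ₗ[K] Matrix (Fin n) (Fin n) K) :
    Derivation K (MvPolynomial (Fin n × Fin n) K) (MvPolynomial (Fin n × Fin n) K) :=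
  ∑ q : Fin n × Fin n, coordOne K q • der (π (Matrix.single q.1 q.2 1))

theorem euler_apply (π : Matrix (Fin n) (Fin n) K →ₗ[K] Matrix (Fin n) (Fin n) K)
    (p : MvPolynomial (Fin n × Fin n) K) :
    euler π p = ∑ q : Fin n × Fin n, coordOne K q * der (π (Matrix.single q.1 q.2 1)) p := by
  unfold euler
  rw [← Derivation.coeFnAddMonoidHom_apply, map_sum, Finset.sum_apply]
  rfl

theorem euler_mem (π : Matrix (Fin n) (Fin n) K →ₗ[K] Matrix (Fin n) (Fin n) K)
    (p : MvPolynomial (Fin n × Fin n) K) : euler π p ∈ oneIdeal K n := by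
  rw [euler_apply]
  exact sum_mem fun q _ => Ideal.mul_mem_right _ _ (coordOne_mem q)

theorem euler_sub_linPart_mem (π : Matrix (Fin n) (Fin n) K →ₗ[K] Matrix (Fin n) (Fin n) K)
    (p : MvPolynomial (Fin n × Fin n) K) :
    euler π p - linPart K n (diffAt p ∘ₗ π) ∈ oneIdeal K n ^ 2 := by
  rw [euler_apply, linPart_apply, ← Finset.sum_sub_distrib, pow_two]
  refine sum_mem fun q _ => ?_
  rw [LinearMap.comp_apply, diffAt_apply, mul_comm (C _), ← mul_sub]
  refine Ideal.mul_mem_mul (coordOne_mem q) ?_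
  rw [mem_oneIdeal, map_sub, evalAt_C, sub_self]

variable {N : Ideal (MvPolynomial (Fin n × Fin n) K)}
  {𝔤 : Submodule K (Matrix (Fin n) (Fin n) K)}
  {π : Matrix (Fin n) (Fin n) K →ₗ[K] Matrix (Fin n) (Fin n) K}

theorem euler_sub_mem (hlin : ∀ ℓ : Module.Dual K (Matrix (Fin n) (Fin n) K),
      (∀ x ∈ 𝔤, ℓ x = 0) → linPart K n ℓ ∈ N ⊔ oneIdeal K n ^ 2)
    (hπ : ∀ x ∈ 𝔤, π x = x) {p : MvPolynomial (Fin n × Fin n) K} (hp : p ∈ oneIdeal K n) :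
    euler π p - p ∈ N ⊔ oneIdeal K n ^ 2 := by
  have h1 := hlin (diffAt p ∘ₗ π - diffAt p) fun x hx => by
    rw [LinearMap.sub_apply, LinearMap.comp_apply, hπ x hx, sub_self]
  have h2 : _ ∈ N ⊔ oneIdeal K n ^ 2 := le_sup_right (a := N) (euler_sub_linPart_mem π p)
  have h3 : _ ∈ N ⊔ oneIdeal K n ^ 2 := le_sup_right (a := N) (sub_linPart_mem p)
  rw [mem_oneIdeal.1 hp, C_0, sub_zero] at h3
  rw [map_sub] at h1
  convert sub_mem (add_mem h1 h2) h3 using 1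
  ring

theorem euler_sub_nsmul_mem (hlin : ∀ ℓ : Module.Dual K (Matrix (Fin n) (Fin n) K),
      (∀ x ∈ 𝔤, ℓ x = 0) → linPart K n ℓ ∈ N ⊔ oneIdeal K n ^ 2)
    (hπ : ∀ x ∈ 𝔤, π x = x) (k : ℕ) {p : MvPolynomial (Fin n × Fin n) K}
    (hp : p ∈ oneIdeal K n ^ k) :
    euler π p - (k : MvPolynomial (Fin n × Fin n) K) * p ∈ N ⊔ oneIdeal K n ^ (k + 1) := by
  induction k generalizing p with
  | zero =>
    rw [Nat.cast_zero, zero_mul, sub_zero, zero_add, pow_one]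
    exact le_sup_right (a := N) (euler_mem π p)
  | succ k IH =>
    rw [pow_succ] at hp
    refine Submodule.mul_induction_on hp (fun x hx y hy => ?_) fun x y hx hy => ?_
    · have h1 : x * (euler π y - y) ∈ N ⊔ oneIdeal K n ^ (k + 1 + 1) := by
        have := Ideal.mul_mem_mul hx (euler_sub_mem hlin hπ hy)
        rw [Ideal.mul_sup, ← pow_add] at this
        obtain ⟨a, ha, b, hb, e⟩ := Submodule.mem_sup.1 this
        rw [← e]
        exact add_mem (le_sup_left (a := N) (Ideal.mul_le_right ha)) (le_sup_right (a := N) hb)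
      have h2 : (euler π x - k * x) * y ∈ N ⊔ oneIdeal K n ^ (k + 1 + 1) := by
        have := Ideal.mul_mem_mul (IH hx) hy
        rw [Ideal.sup_mul, ← pow_succ] at this
        obtain ⟨a, ha, b, hb, e⟩ := Submodule.mem_sup.1 this
        rw [← e]
        exact add_mem (le_sup_left (a := N) (Ideal.mul_le_left ha)) (le_sup_right (a := N) hb)
      convert add_mem h1 h2 using 1
      rw [Derivation.leibniz, smul_eq_mul, smul_eq_mul]
      push_cast
      ring
    · convert add_mem hx hy using 1
      rw [map_add]
      ring

theorem mem_sup_pow [CharZero K] (hlin : ∀ ℓ : Module.Dual K (Matrix (Fin n) (Fin n) K),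
      (∀ x ∈ 𝔤, ℓ x = 0) → linPart K n ℓ ∈ N ⊔ oneIdeal K n ^ 2)
    (hN : ∀ x ∈ 𝔤, ∀ p ∈ N, der x p ∈ N) {z : MvPolynomial (Fin n × Fin n) K}
    (hz : z ∈ oneIdeal K n) (hz' : ∀ x ∈ 𝔤, der x z = 0) (k : ℕ) :
    z ∈ N ⊔ oneIdeal K n ^ k := by
  obtain ⟨g, hg⟩ := LinearMap.exists_leftInverse_of_injective 𝔤.subtype 𝔤.ker_subtype
  let π := 𝔤.subtype ∘ₗ g
  have hπ : ∀ x ∈ 𝔤, π x = x := fun x hx => congrArg Subtype.val (LinearMap.congr_fun hg ⟨x, hx⟩)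
  have hE : ∀ p ∈ N, euler π p ∈ N := fun p hp => by
    rw [euler_apply]
    exact sum_mem fun q _ => Ideal.mul_mem_left _ _ (hN _ (g _).2 _ hp)
  have hEz : euler π z = 0 := by
    rw [euler_apply]
    exact Finset.sum_eq_zero fun q _ => by
      rw [hz' (π (Matrix.single q.1 q.2 1)) (g _).2, mul_zero]
  rcases k with _ | k
  · rw [pow_zero, Ideal.one_eq_top, sup_top_eq]
    trivial
  induction k with
  | zero => rw [zero_add, pow_one]; exact le_sup_right (a := N) hz
  | succ k IH =>
    obtain ⟨a, ha, b, hb, rfl⟩ := Submodule.mem_sup.1 IH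
    refine add_mem (le_sup_left (a := N) ha) ?_
    have h1 := euler_sub_nsmul_mem hlin hπ (k + 1) hb
    have h2 : euler π b ∈ N ⊔ oneIdeal K n ^ (k + 1 + 1) := by
      rw [map_add, add_comm] at hEz
      rw [eq_neg_of_add_eq_zero_left hEz]
      exact le_sup_left (a := N) (neg_mem (hE a ha))
    have h3 := Ideal.mul_mem_left _ (C (((k + 1 : ℕ) : K)⁻¹)) (sub_mem h2 h1)
    rwa [sub_sub_cancel, ← mul_assoc, ← map_natCast (C : K →+* MvPolynomial (Fin n × Fin n) K),
      ← C_mul, inv_mul_cancel₀ (Nat.cast_ne_zero.2 k.succ_ne_zero), C_1, one_mul] at h3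

/-- A polynomial vanishing at the identity to infinite order modulo `N` lies in `N` locally. -/
theorem exists_mul_mem_of_mem_sup_pow {z : MvPolynomial (Fin n × Fin n) K}
    (hz : ∀ k, z ∈ N ⊔ oneIdeal K n ^ k) : ∃ c, evalAt 1 c = 1 ∧ c * z ∈ N := by
  have h1 : Ideal.Quotient.mk N z ∈ (⨅ i : ℕ, oneIdeal K n ^ i •
      (⊤ : Submodule (MvPolynomial (Fin n × Fin n) K) (MvPolynomial (Fin n × Fin n) K ⧸ N))) := by
    refine (Submodule.mem_iInf _).2 fun k => ?_
    obtain ⟨a, ha, b, hb, rfl⟩ := Submodule.mem_sup.1 (hz k)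
    rw [map_add, Ideal.Quotient.eq_zero_iff_mem.2 ha, zero_add, ← mul_one b, map_mul]
    exact Submodule.smul_mem_smul hb (Submodule.mem_top (x := Ideal.Quotient.mk N 1))
  obtain ⟨r, hr⟩ := (Ideal.mem_iInf_smul_pow_eq_bot_iff (oneIdeal K n) _).1 h1
  refine ⟨1 - r, ?_, ?_⟩
  · rw [map_sub, map_one, mem_oneIdeal.1 r.2, sub_zero]
  · rw [← Ideal.Quotient.eq_zero_iff_mem, sub_mul, one_mul, map_sub, sub_eq_zero]
    exact hr.symm

end Jets

end

noncomputable section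

open scoped Classical

/-! ### Stabilizers of vertex models -/

section Stabilizer

variable {n : ℕ} {K : Type} [Field K] {ι : Type} [Fintype ι] {h : VertexModel K n}
  {g : Matrix (Fin n) (Fin n) K}

theorem tact_eq_act (g : Matrix (Fin n) (Fin n) K) (k : ℕ) (t : (Fin k → Fin n) → K) :
    tact g k t = act g t := by
  funext φ
  rw [act_eq]
  rfl

theorem dualAct_prod (h : VertexModel K n) (g : Matrix (Fin n) (Fin n) K) (c : ι → Fin n) :
    dualAct g h (∏ i, X (c i)) = act g (fun ψ => weight h (values ψ)) c := by
  have h1 : polSub g (∏ i, X (c i)) = ∏ i, ∑ j, C (g (c i) j) * X j := by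
    unfold polSub
    rw [AlgHom.toLinearMap_apply, map_prod]
    exact Finset.prod_congr rfl fun i _ => aeval_X _ _
  rw [act_eq, dualAct, LinearMap.comp_apply, h1, Finset.prod_univ_sum, Fintype.piFinset_univ,
    map_sum]
  refine Finset.sum_congr rfl fun ψ _ => ?_
  rw [Finset.prod_mul_distrib, ← map_prod C, ← smul_eq_C_mul, map_smul, smul_eq_mul, weight,
    prod_values]

theorem mem_Stab_iff : g ∈ Stab h ↔ g.transpose * g = 1 ∧ ∀ (κ : Type) [Fintype κ],
    (fun c : κ → Fin n => weight h (values c)) = act g fun c => weight h (values c) := by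
  refine and_congr Iff.rfl ⟨fun hg κ _ => funext fun c => ?_, fun hg => ?_⟩
  · rw [← dualAct_prod, hg, weight, prod_values]
  · refine (basisMonomials (Fin n) K).ext fun s => ?_
    obtain ⟨k, c, rfl⟩ := exists_monomial_eq s
    rw [coe_basisMonomials]
    beta_reduce
    rw [← monomial_eq_prod_X, dualAct_prod, ← congrFun (hg (Fin k)) c, weight, prod_values]

theorem act_eq_of_mem_Stab {D : ℕ → Prop} (hg : g ∈ Stab h) {t : (ι → Fin n) → K}
    (ht : t ∈ netSpan (weight h) D ι) : act g t = t :=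
  act_eq_of_mem_netSpan (mem_Stab_iff.1 hg).1 (mem_Stab_iff.1 hg).2 ht

theorem mem_Stab_of_act_eq (hg : ∀ (κ : Type) [Fintype κ],
    ∀ t ∈ netSpan (weight h) (fun _ => True) κ, act g t = t) : g ∈ Stab h := by
  refine mem_Stab_iff.2 ⟨?_, fun κ _ => (hg κ _ (basic_mem_netSpan trivial)).symm⟩
  refine mul_eq_one_comm.1 (Matrix.ext fun i j => ?_)
  have h1 := congrFun (hg Bool _ metric_mem_netSpan) (fun b => cond b i j)
  have h2 := congrFun (act_one (metric K n)) (fun b => cond b i j)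
  rw [← h2, act_metric, act_metric, Matrix.transpose_one, mul_one] at h1
  exact h1

end Stabilizer

section Relations

variable {n : ℕ} {K : Type} [Field K] {ι : Type} [Fintype ι] {w : Multiset (Fin n) → K}
  {D : ℕ → Prop}

theorem relIdeal_le_iff {I : Ideal (MvPolynomial (Fin n × Fin n) K)} : relIdeal w D ≤ I ↔
    ∀ (κ : Type) [Fintype κ], ∀ t ∈ netSpan w D κ, ∀ φ, gen t φ - C (t φ) ∈ I := by
  refine ⟨fun H κ _ t ht φ => H (gen_sub_mem_relIdeal ht φ), fun H => Ideal.span_le.2 ?_⟩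
  rintro _ ⟨κ, _, t, ht, φ, rfl⟩
  exact H κ t ht φ

theorem act_eq_of_evalAt_eq_zero {g : Matrix (Fin n) (Fin n) K}
    (hg : ∀ p ∈ relIdeal w D, evalAt g p = 0) {t : (ι → Fin n) → K} (ht : t ∈ netSpan w D ι) :
    act g t = t := by
  funext φ
  have := hg _ (gen_sub_mem_relIdeal ht φ)
  rwa [map_sub, evalAt_gen, evalAt_C, sub_eq_zero] at this

theorem evalAt_one_gen_sub (t : (ι → Fin n) → K) (φ : ι → Fin n) :
    evalAt 1 (gen t φ - C (t φ)) = 0 := by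
  rw [map_sub, evalAt_gen, evalAt_C, act_one, sub_self]

theorem relIdeal_le_oneIdeal : relIdeal w D ≤ oneIdeal K n :=
  relIdeal_le_iff.2 fun _ _ _ _ _ => mem_oneIdeal.2 (evalAt_one_gen_sub _ _)

/-- The differentials at the identity of the relations. -/
def conormal (w : Multiset (Fin n) → K) (D : ℕ → Prop) :
    Submodule K (Module.Dual K (Matrix (Fin n) (Fin n) K)) :=
  Submodule.span K {ℓ | ∃ (ι : Type) (_ : Fintype ι), ∃ t ∈ netSpan w D ι, ∃ φ : ι → Fin n,
    ℓ = diffAt (gen t φ)}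

theorem inf_eq_zero {x : Matrix (Fin n) (Fin n) K} (hx : x ∈ (conormal w D).dualCoannihilator)
    {t : (ι → Fin n) → K} (ht : t ∈ netSpan w D ι) : inf x t = 0 :=
  funext fun φ => (Submodule.mem_dualCoannihilator x).1 hx _
    (Submodule.subset_span ⟨ι, _, t, ht, φ, rfl⟩)

theorem der_gen_eq_zero [Infinite K] {x : Matrix (Fin n) (Fin n) K} {t : (ι → Fin n) → K}
    (ht : inf x t = 0) (φ : ι → Fin n) : der x (gen t φ - C (t φ)) = 0 := by
  rw [map_sub, der_gen, der_C, sub_zero, ht, ← genLin_apply, map_zero]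

theorem der_mem_relIdeal [Infinite K] {x : Matrix (Fin n) (Fin n) K}
    (hx : x ∈ (conormal w D).dualCoannihilator) {p : MvPolynomial (Fin n × Fin n) K}
    (hp : p ∈ relIdeal w D) : der x p ∈ relIdeal w D := by
  refine Submodule.span_induction ?_ ?_ ?_ ?_ hp
  · rintro _ ⟨κ, _, t, ht, φ, rfl⟩
    rw [der_gen_eq_zero (inf_eq_zero hx ht)]
    exact zero_mem _
  · rw [map_zero]
    exact zero_mem _
  · intro p q _ _ hp hq
    rw [map_add]
    exact add_mem hp hq
  · intro a p hp hp'
    rw [smul_eq_mul, Derivation.leibniz, smul_eq_mul, smul_eq_mul]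
    exact add_mem (Ideal.mul_mem_left _ _ hp') (Ideal.mul_mem_right _ _ hp)

theorem linPart_mem_relIdeal_sup {ℓ : Module.Dual K (Matrix (Fin n) (Fin n) K)}
    (hℓ : ∀ x ∈ (conormal w D).dualCoannihilator, ℓ x = 0) :
    linPart K n ℓ ∈ relIdeal w D ⊔ oneIdeal K n ^ 2 := by
  have h1 : ℓ ∈ (conormal w D).dualCoannihilator.dualAnnihilator :=
    (Submodule.mem_dualAnnihilator ℓ).2 hℓ
  rw [Subspace.dualCoannihilator_dualAnnihilator_eq] at h1
  refine Submodule.span_induction ?_ ?_ ?_ ?_ h1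
  · rintro _ ⟨κ, _, t, ht, φ, rfl⟩
    have h2 : _ ∈ relIdeal w D ⊔ oneIdeal K n ^ 2 :=
      le_sup_right (a := relIdeal w D) (sub_linPart_mem (gen t φ))
    have h3 : _ ∈ relIdeal w D ⊔ oneIdeal K n ^ 2 :=
      le_sup_left (a := relIdeal w D) (gen_sub_mem_relIdeal ht φ)
    rw [evalAt_gen, act_one] at h2
    convert sub_mem h3 h2 using 1
    ring
  · rw [map_zero]
    exact zero_mem _
  · intro p q _ _ hp hq
    rw [map_add]
    exact add_mem hp hq
  · intro a p _ hp
    rw [map_smul, smul_eq_C_mul]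
    exact Ideal.mul_mem_left _ _ hp

theorem leftMul_gen_sub {g : Matrix (Fin n) (Fin n) K} {t : (ι → Fin n) → K} (ht : act g t = t)
    (φ : ι → Fin n) : leftMul g (gen t φ - C (t φ))
      = ∑ ψ, C (∏ i, g (φ i) (ψ i)) * (gen t ψ - C (t ψ)) := by
  have h1 : leftMul g (C (t φ)) = C (act g t φ) := by
    rw [ht]
    exact (leftMul g).commutes _
  rw [map_sub, leftMul_gen, h1, act_eq, act_eq, map_sum, ← Finset.sum_sub_distrib]
  refine Finset.sum_congr rfl fun ψ _ => ?_
  rw [C_mul, mul_sub, map_prod]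
  rfl

theorem leftMul_mem_relIdeal {g : Matrix (Fin n) (Fin n) K}
    (hg : ∀ (κ : Type) [Fintype κ], ∀ t ∈ netSpan w D κ, act g t = t)
    {p : MvPolynomial (Fin n × Fin n) K} (hp : p ∈ relIdeal w D) :
    leftMul g p ∈ relIdeal w D := by
  suffices H : relIdeal w D ≤ (relIdeal w D).comap (leftMul g) from H hp
  refine relIdeal_le_iff.2 fun κ _ t ht φ => ?_
  rw [Ideal.mem_comap, leftMul_gen_sub (hg κ t ht)]
  exact sum_mem fun ψ _ => Ideal.mul_mem_left _ _ (gen_sub_mem_relIdeal ht ψ)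

end Relations

section Nullstellensatz

variable {n : ℕ} {K : Type} [Field K] {ι : Type} [Fintype ι]

theorem exists_evalAt_eq_zero [IsAlgClosed K] {I : Ideal (MvPolynomial (Fin n × Fin n) K)}
    (hI : I ≠ ⊤) : ∃ g, ∀ p ∈ I, evalAt g p = 0 := by
  by_contra! H
  refine hI (Ideal.radical_eq_top.1 ((Ideal.eq_top_iff_one _).2 ?_))
  rw [← vanishingIdeal_zeroLocus_eq_radical (K := K) I]
  intro x hx
  obtain ⟨p, hp, hp'⟩ := H fun i j => x (i, j)
  exact absurd (hx p hp) hp'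

theorem mem_radical_of_evalAt [IsAlgClosed K] {I : Ideal (MvPolynomial (Fin n × Fin n) K)}
    {z : MvPolynomial (Fin n × Fin n) K} (hz : ∀ g, (∀ p ∈ I, evalAt g p = 0) → evalAt g z = 0) :
    z ∈ I.radical := by
  rw [← vanishingIdeal_zeroLocus_eq_radical (K := K) I]
  exact fun x hx => hz (fun i j => x (i, j)) hx

theorem evalAt_iterate_der (x g : Matrix (Fin n) (Fin n) K) {z : MvPolynomial (Fin n × Fin n) K}
    (hz : evalAt g z = 0) (j : ℕ) (p : MvPolynomial (Fin n × Fin n) K) :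
    evalAt g ((der x)^[j] (z ^ j * p)) = j.factorial * evalAt g (der x z) ^ j * evalAt g p := by
  induction j generalizing p with
  | zero => simp
  | succ j IH =>
    have h1 : der x (z ^ (j + 1) * p) = z ^ j * ((j + 1 : ℕ) * der x z * p + z * der x p) := by
      rw [Derivation.leibniz, Derivation.leibniz_pow, smul_eq_mul, smul_eq_mul, smul_eq_mul,
        nsmul_eq_mul, Nat.add_sub_cancel]
      ring
    rw [Function.iterate_succ_apply, h1, IH, map_add, map_mul (evalAt g), map_mul (evalAt g),
      map_mul (evalAt g), hz, map_natCast, Nat.factorial_succ]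
    push_cast
    ring

theorem evalAt_der_eq_zero [CharZero K] {I : Ideal (MvPolynomial (Fin n × Fin n) K)}
    {x g : Matrix (Fin n) (Fin n) K} (hx : ∀ p ∈ I, der x p ∈ I) (hg : ∀ p ∈ I, evalAt g p = 0)
    {z : MvPolynomial (Fin n × Fin n) K} (hz : z ∈ I.radical) : evalAt g (der x z) = 0 := by
  obtain ⟨r, hr⟩ := hz
  have h0 : evalAt g z = 0 := by
    have := hg _ hr
    rw [map_pow] at this
    exact eq_zero_of_pow_eq_zero this
  have h1 : ∀ j, (der x)^[j] (z ^ r) ∈ I := fun j => by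
    induction j with
    | zero => exact hr
    | succ j IH => rw [Function.iterate_succ_apply']; exact hx _ IH
  have h2 := evalAt_iterate_der x g h0 r 1
  rw [mul_one, hg _ (h1 r), map_one, mul_one, zero_eq_mul] at h2
  exact eq_zero_of_pow_eq_zero (h2.resolve_left (Nat.cast_ne_zero.2 r.factorial_ne_zero))

theorem gen_sub_mem_relIdeal_of_stab [IsAlgClosed K] [CharZero K] {h : VertexModel K n}
    {v : (ι → Fin n) → K} (hv : ∀ g ∈ Stab h, act g v = v) (φ : ι → Fin n) :
    gen v φ - C (v φ) ∈ relIdeal (weight h) fun _ => True := by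
  let N : Ideal (MvPolynomial (Fin n × Fin n) K) := relIdeal (weight h) fun _ => True
  let z : (ι → Fin n) → MvPolynomial (Fin n × Fin n) K := fun φ => gen v φ - C (v φ)
  have hstab : ∀ g, (∀ p ∈ N, evalAt g p = 0) → g ∈ Stab h := fun g hg =>
    mem_Stab_of_act_eq fun κ _ t ht => act_eq_of_evalAt_eq_zero hg ht
  have hrad : ∀ φ, z φ ∈ N.radical := fun φ => mem_radical_of_evalAt fun g hg => by
    rw [map_sub, evalAt_gen, evalAt_C, hv g (hstab g hg), sub_self]
  have hloc : ∀ φ, ∃ c, evalAt 1 c = 1 ∧ c * z φ ∈ N := fun φ => by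
    refine exists_mul_mem_of_mem_sup_pow fun k => mem_sup_pow
      (𝔤 := (conormal (weight h) fun _ => True).dualCoannihilator)
      (fun ℓ hℓ => linPart_mem_relIdeal_sup hℓ) (fun x hx p hp => der_mem_relIdeal hx hp)
      (mem_oneIdeal.2 (evalAt_one_gen_sub v φ)) (fun x hx => der_gen_eq_zero ?_ φ) k
    refine funext fun ψ => ?_
    have h1 := evalAt_der_eq_zero (g := 1) (fun p hp => der_mem_relIdeal hx hp)
      (fun p hp => mem_oneIdeal.1 (relIdeal_le_oneIdeal hp)) (hrad ψ)
    rwa [map_sub, der_C, sub_zero] at h1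
  choose c hc hcz using hloc
  let 𝔞 : Ideal (MvPolynomial (Fin n × Fin n) K) := ⨅ φ, N.colon {z φ}
  have h𝔞 : ∀ p, p ∈ 𝔞 ↔ ∀ φ, p * z φ ∈ N := fun p => by
    simp only [𝔞, Submodule.mem_iInf, Submodule.mem_colon_singleton, smul_eq_mul]
  suffices H : 𝔞 = ⊤ by
    have := (h𝔞 1).1 (H ▸ Submodule.mem_top) φ
    rwa [one_mul] at this
  by_contra H
  obtain ⟨g, hg⟩ := exists_evalAt_eq_zero H
  have hgS := hstab g fun p hp => hg p ((h𝔞 p).2 fun φ => Ideal.mul_mem_right _ _ hp)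
  have hg1 : g.transpose * g = 1 := hgS.1
  have hg2 : g * g.transpose = 1 := mul_eq_one_comm.1 hg1
  have hmem : leftMul g.transpose (∏ φ, c φ) ∈ 𝔞 := by
    refine (h𝔞 _).2 fun φ => ?_
    rw [← leftMul_leftMul hg2 (z φ), ← map_mul, leftMul_gen_sub (hv g hgS), Finset.mul_sum]
    refine leftMul_mem_relIdeal (fun κ _ t ht => ?_) (sum_mem fun ψ _ => ?_)
    · rw [← act_eq_of_mem_Stab hgS ht, ← act_mul, hg1, act_one, act_eq_of_mem_Stab hgS ht]
    · rw [mul_left_comm]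
      refine Ideal.mul_mem_left _ _ ?_
      rw [← Finset.mul_prod_erase _ _ (Finset.mem_univ ψ), mul_right_comm]
      exact Ideal.mul_mem_right _ _ (hcz ψ)
  have h1 := hg _ hmem
  rw [evalAt_leftMul, hg1, map_prod, Finset.prod_congr rfl fun φ _ => hc φ,
    Finset.prod_const_one] at h1
  exact one_ne_zero h1

theorem NondegSpan.mem_netSpan_iff [IsAlgClosed K] [CharZero K] {h : VertexModel K n}
    (hA : NondegSpan (weight h) fun _ => True) {v : (ι → Fin n) → K} :
    v ∈ netSpan (weight h) (fun _ => True) ι ↔ ∀ g ∈ Stab h, act g v = v := by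
  refine ⟨fun ht g hg => act_eq_of_mem_Stab hg ht, fun hv => ?_⟩
  obtain ⟨η, h1, h2, h3⟩ := hA.exists_functional
  suffices H : hA.proj ι v = v from H ▸ hA.proj_mem v
  refine funext fun φ => ?_
  have h4 := h2 _ (gen_sub_mem_relIdeal_of_stab hv φ)
  rwa [map_sub, h1, ← mul_one (C (v φ)), ← smul_eq_C_mul, map_smul, h3, smul_eq_mul, mul_one,
    sub_eq_zero] at h4

theorem NondegSpan.span_ph_eq [IsAlgClosed K] [CharZero K] {h : VertexModel K n}
    (hA : NondegSpan (weight h) fun _ => True) (k : ℕ) :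
    Submodule.span K (Set.range fun F : Fragment k => ph h F) = invSub (Stab h) k := by
  simp only [ph_eq_fph]
  rw [← netSpan_fin]
  refine Submodule.ext fun v => hA.mem_netSpan_iff.trans ?_
  exact forall₂_congr fun g _ => by rw [tact_eq_act]

end Nullstellensatz

end

end VertexModels

open VertexModels

/-- **Theorem 5** (combinatorial parameterization of invariant tensors).
There is a nondegenerate vertex model `h'` with the same partition function
as `h` such that `p_{h'}(𝒜) = T(V)^{Stab(h')}` (gradedwise: the span of the
tensors `p_{h'}(F)`, `F` a `k`-fragment, is the space of `Stab(h')`-invariant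
tensors in `V^{⊗k}`). -/
theorem exists_nondeg_image_eq_invariants (𝔽 : Type) [Field 𝔽] [IsAlgClosed 𝔽]
    [CharZero 𝔽] (n : ℕ) (h : VertexModel 𝔽 n) :
    ∃ h' : VertexModel 𝔽 n,
      Nondeg h' ∧
      (∀ G : Graph, partitionFun h G = partitionFun h' G) ∧
      ∀ k : ℕ,
        Submodule.span 𝔽 (Set.range fun F : Fragment k => ph h' F)
          = invSub (Stab h') k := by
  obtain ⟨w, hw⟩ := exists_compat_self h
  obtain ⟨h', rfl⟩ := exists_weight_eq w
  exact ⟨h', hw.nondeg, hw.partitionFun_eq, hw.nondegSpan.span_ph_eq⟩
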